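/- arXiv:2512.10645 — 4 statements merged into one kernel-verified Lean document; each statement's English description precedes it below -/
import Mathlib

section
/- Let k be a positive integer and let φ : ℋ_{2k}^0 → ℋ_{2k}^0 be a map. The following two statements are equivalent: (1) φ is real-linear and φ(I(ℋ_{2k}^0)) ⊆ I(ℋ_{2k}^0); (2) there exist U ∈ 𝒰_{2k} and s ∈ {−1, 1} such that either φ(A) = s·U A U* for all A ∈ ℋ_{2k}^0, or k ≥ 2 and φ(A) = s·U Ā U* for all A ∈ ℋ_{2k}^0. -/
open Matrix Kronecker

/-- `Mat m` is the space of `m × m` complex matrices. -/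
abbrev Mat (m : ℕ) : Type := Matrix (Fin m) (Fin m) ℂ

/-- The "real part" `(A + A*)/2` of a square complex matrix. -/
noncomputable def MRe {m : ℕ} (A : Mat m) : Mat m := (2⁻¹ : ℂ) • (A + Aᴴ)

/-- The real vector space `ℋ_m` of `m × m` complex hermitian matrices,
as a real submodule of `Mat m`. -/
noncomputable def HermS (m : ℕ) : Submodule ℝ (Mat m) where
  carrier := {A | A.IsHermitian}
  add_mem' := fun ha hb => ha.add hb
  zero_mem' := Matrix.isHermitian_zero
  smul_mem' := fun r A hA => by
    simpa [Matrix.IsHermitian, Matrix.conjTranspose_smul] using congrArg (r • ·) hA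

/-- The real vector space `ℋ_m^0` of trace-zero `m × m` complex hermitian matrices,
as a real submodule of `Mat m`. -/
noncomputable def H0S (m : ℕ) : Submodule ℝ (Mat m) where
  carrier := {A | A.IsHermitian ∧ A.trace = 0}
  add_mem' := fun ha hb => ⟨ha.1.add hb.1, by simp [Matrix.trace_add, ha.2, hb.2]⟩
  zero_mem' := ⟨Matrix.isHermitian_zero, by simp⟩
  smul_mem' := fun r A hA => ⟨by
    simpa [Matrix.IsHermitian, Matrix.conjTranspose_smul] using congrArg (r • ·) hA.1,
    by simp [Matrix.trace_smul, hA.2]⟩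

/-- Transport a square matrix along an equality of sizes. -/
def castM {a b : ℕ} (h : a = b) (A : Mat a) : Mat b :=
  Matrix.reindex (finCongr h) (finCongr h) A

/-- A `2 × 2` block matrix with blocks of sizes `a` and `b`. -/
def blks {a b : ℕ} (A : Matrix (Fin a) (Fin a) ℂ) (B : Matrix (Fin a) (Fin b) ℂ)
    (C : Matrix (Fin b) (Fin a) ℂ) (D : Matrix (Fin b) (Fin b) ℂ) : Mat (a + b) :=
  Matrix.reindex finSumFinEquiv finSumFinEquiv (Matrix.fromBlocks A B C D)

/-- The direct (block-diagonal) sum `A ⊕ B` of square matrices. -/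
def dsum {a b : ℕ} (A : Mat a) (B : Mat b) : Mat (a + b) := blks A 0 0 B

/-- The Kronecker product of complex matrices, with `Fin`-indexing. -/
def kron {a b c d : ℕ} (A : Matrix (Fin a) (Fin b) ℂ) (B : Matrix (Fin c) (Fin d) ℂ) :
    Matrix (Fin (a * c)) (Fin (b * d)) ℂ :=
  Matrix.reindex finProdFinEquiv finProdFinEquiv (A ⊗ₖ B)

/-- Iterated direct (block-diagonal) sum `A 0 ⊕ A 1 ⊕ ⋯ ⊕ A (r-1)` of square matrices
of sizes `m 0, …, m (r-1)`. -/
def bdiag : {r : ℕ} → (m : Fin r → ℕ) → ((j : Fin r) → Mat (m j)) → Mat (∑ j, m j)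
  | 0, _, _ => 0
  | _+1, m, A =>
      castM (Fin.sum_univ_succ m).symm
        (dsum (A 0) (bdiag (fun j => m j.succ) (fun j => A j.succ)))


set_option linter.unusedSectionVars false
set_option linter.unusedSimpArgs false

section Pres

variable {ι : Type} [Fintype ι] [DecidableEq ι]

structure Good (ψ : Matrix ι ι ℂ →ₗ[ℝ] Matrix ι ι ℂ) : Prop where
  herm : ∀ X, (ψ X)ᴴ = ψ X
  tr : ∀ X, Matrix.trace (ψ X) = 0
  sq : ∀ X : Matrix ι ι ℂ, Xᴴ = X → Matrix.trace X = 0 → X * X = 1 → ψ X * ψ X = 1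

def Sm (i j : ι) (z : ℂ) : Matrix ι ι ℂ := Matrix.single i j z + Matrix.single j i (star z)
def Dm (i j : ι) : Matrix ι ι ℂ := Matrix.single i i 1 - Matrix.single j j 1
def Pm (i j : ι) : Matrix ι ι ℂ := Matrix.single i i 1 + Matrix.single j j 1

structure IsSph (i j : ι) (X : Matrix ι ι ℂ) : Prop where
  herm : Xᴴ = X
  tr : Matrix.trace X = 0
  sq : X * X = Pm i j
  supp : Pm i j * X = X

lemma Pm_herm (i j : ι) : (Pm i j)ᴴ = Pm i j := by
  simp [Pm, Matrix.conjTranspose_add, Matrix.conjTranspose_single]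

lemma IsSph.supp' {i j : ι} {X : Matrix ι ι ℂ} (h : IsSph i j X) : X * Pm i j = X := by
  have := congrArg Matrix.conjTranspose h.supp
  rwa [Matrix.conjTranspose_mul, h.herm, Pm_herm] at this

/-- general sphere point -/
lemma isSph_comb {i j : ι} (hij : i ≠ j) (c : ℝ) (z : ℂ) (h : c ^ 2 + Complex.normSq z = 1) :
    IsSph i j (c • Dm i j + Sm i j z) := by
  have hz : z * star z = ((1 - c ^ 2 : ℝ) : ℂ) := by
    rw [Complex.star_def, Complex.mul_conj]; congr 1; linarith
  have hc : (c : ℂ) * c + z * star z = 1 := by rw [hz]; push_cast; ring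
  have hc2 : (c : ℂ) * c + star z * z = 1 := by rw [mul_comm (star z)]; exact hc
  have e : c • Dm i j + Sm i j z = Matrix.single i i (c : ℂ) - Matrix.single j j (c : ℂ)
      + (Matrix.single i j z + Matrix.single j i (star z)) := by
    simp [Dm, Sm, smul_sub, Matrix.smul_single]
  rw [e]
  refine ⟨?_, ?_, ?_, ?_⟩
  · simp [Matrix.conjTranspose_add, Matrix.conjTranspose_sub, Matrix.conjTranspose_single]
    abel
  · simp [hij, hij.symm, Matrix.trace_single_eq_of_ne]
  · simp only [mul_add, add_mul, mul_sub, sub_mul, Matrix.single_mul_single_same, Matrix.single_mul_single_of_ne _ _ _ _ hij, Matrix.single_mul_single_of_ne _ _ _ _ hij.symm, Pm]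
    rw [← hc, Matrix.single_add, Matrix.single_add, mul_comm z (c:ℂ), mul_comm (star z) (c:ℂ), mul_comm (star z) z]
    abel
  · simp only [mul_add, add_mul, mul_sub, sub_mul, Matrix.single_mul_single_same, Matrix.single_mul_single_of_ne _ _ _ _ hij, Matrix.single_mul_single_of_ne _ _ _ _ hij.symm, Pm, one_mul]
    abel

lemma isSph_D {i j : ι} (hij : i ≠ j) : IsSph i j (Dm i j) := by
  have := isSph_comb hij 1 0 (by simp)
  simpa [Sm] using this

lemma isSph_S {i j : ι} (hij : i ≠ j) (z : ℂ) (h : Complex.normSq z = 1) : IsSph i j (Sm i j z) := by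
  have := isSph_comb hij 0 z (by simp [h])
  simpa using this

lemma Sm_add (i j : ι) (z w : ℂ) : Sm i j (z + w) = Sm i j z + Sm i j w := by
  simp only [Sm, star_add, Matrix.single_add]; abel

lemma Sm_smul (i j : ι) (r : ℝ) (z : ℂ) : Sm i j (r * z) = r • Sm i j z := by
  simp [Sm, Matrix.smul_single]

lemma exists_signs (s : Finset ι) (h : Even (sᶜ).card) :
    ∃ M : Matrix ι ι ℂ, Mᴴ = M ∧ Matrix.trace M = 0 ∧
      M * M = Matrix.diagonal (fun i => if i ∈ s then 0 else 1) ∧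
      ∀ i j, i ∈ s → j ∈ s → Pm i j * M = 0 := by
  obtain ⟨r, hr⟩ := h
  obtain ⟨u, hu, hur⟩ := Finset.exists_subset_card_eq (s := sᶜ) (n := r) (by omega)
  let d : ι → ℂ := fun i => if i ∈ u then 1 else if i ∈ s then 0 else -1
  have hus : ∀ i ∈ u, i ∉ s := fun i hi => by simpa using hu hi
  refine ⟨Matrix.diagonal d, ?_, ?_, ?_, ?_⟩
  · rw [Matrix.diagonal_conjTranspose]
    congr 1; ext i; simp only [d, Pi.star_apply]; split_ifs <;> simp
  · rw [Matrix.trace_diagonal]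
    have : ∀ i, d i = (if i ∈ u then 2 else 0) - (if i ∈ sᶜ then 1 else 0) := by
      intro i; simp only [d, Finset.mem_compl]
      by_cases h1 : i ∈ u
      · simp [h1, hus i h1]; norm_num
      · by_cases h2 : i ∈ s <;> simp [h1, h2]
    simp_rw [this, Finset.sum_sub_distrib, Finset.sum_ite_mem, Finset.univ_inter]
    simp only [Finset.sum_const, hr, hur]; push_cast [nsmul_eq_mul]; ring
  · rw [Matrix.diagonal_mul_diagonal]
    congr 1; ext i; simp only [d]
    by_cases h1 : i ∈ u
    · simp [h1, hus i h1]
    · by_cases h2 : i ∈ s <;> simp [h1, h2]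
  · intro i j hi hj
    have hi' : d i = 0 := by
      have : i ∉ u := fun h => hus i h hi
      simp [d, this, hi]
    have hj' : d j = 0 := by
      have : j ∉ u := fun h => hus j h hj
      simp [d, this, hj]
    rw [Pm, add_mul]
    have aux : ∀ a, d a = 0 → Matrix.single a a (1:ℂ) * Matrix.diagonal d = 0 := by
      intro a ha
      ext b c
      rw [Matrix.mul_diagonal, Matrix.single_apply]
      by_cases h : a = b ∧ a = c
      · rw [← h.2, ha]; simp
      · simp [h]
    rw [aux i hi', aux j hj', add_zero]

variable {ψ : Matrix ι ι ℂ →ₗ[ℝ] Matrix ι ι ℂ}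

lemma Pm_mul_zero {i j k l : ι} (hik : i ≠ k) (hil : i ≠ l) (hjk : j ≠ k)
    (hjl : j ≠ l) : Pm i j * Pm k l = (0 : Matrix ι ι ℂ) := by
  simp [Pm, mul_add, add_mul, Matrix.single_mul_single_of_ne, hik, hil, hjk, hjl]

lemma zero_mul_of_supp {P R X Y : Matrix ι ι ℂ} (h1 : X * P = X) (h2 : R * Y = Y) (h : P * R = 0) :
    X * Y = 0 := by
  rw [← h1, ← h2, Matrix.mul_assoc, ← Matrix.mul_assoc P, h]; simp

/-- basic four-index fact -/
lemma four (hψ : Good ψ) (hc : Even (Fintype.card ι)) {i j k l : ι} (hij : i ≠ j) (hkl : k ≠ l)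
    (hik : i ≠ k) (hil : i ≠ l) (hjk : j ≠ k) (hjl : j ≠ l) :
    ∃ m : Matrix ι ι ℂ, ∀ X Y, IsSph i j X → IsSph k l Y →
      ψ X * ψ X + ψ Y * ψ Y + m = 1 ∧ ψ X * ψ Y + ψ Y * ψ X = 0 := by
  have hcard : ({i, j, k, l} : Finset ι).card = 4 := by
    simp [Finset.card_insert_of_notMem, hij, hkl, hik, hil, hjk, hjl]
  obtain ⟨M, hM1, hM2, hM3, hM4⟩ := exists_signs ({i, j, k, l} : Finset ι) (by
    rw [Finset.card_compl, hcard]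
    exact (Nat.even_sub (by rw [← hcard]; exact Finset.card_le_univ _)).2 (by simp [hc]; decide))
  refine ⟨ψ M * ψ M, fun X Y hX hY => ?_⟩
  have hPM := hM4 i j (by simp) (by simp)
  have hPM' := hM4 k l (by simp) (by simp)
  have hMP : M * Pm i j = 0 := by
    have := congrArg Matrix.conjTranspose hPM
    simpa [Matrix.conjTranspose_mul, hM1, Pm_herm] using this
  have hMP' : M * Pm k l = 0 := by
    have := congrArg Matrix.conjTranspose hPM'
    simpa [Matrix.conjTranspose_mul, hM1, Pm_herm] using this
  have a1 : X * Y = 0 := zero_mul_of_supp hX.supp' hY.supp (Pm_mul_zero hik hil hjk hjl)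
  have a2 : Y * X = 0 := zero_mul_of_supp hY.supp' hX.supp (Pm_mul_zero hik.symm hjk.symm hil.symm hjl.symm)
  have a3 : X * M = 0 := by rw [← hX.supp', Matrix.mul_assoc, hPM, Matrix.mul_zero]
  have a4 : Y * M = 0 := by rw [← hY.supp', Matrix.mul_assoc, hPM', Matrix.mul_zero]
  have a5 : M * X = 0 := by rw [← hX.supp, ← Matrix.mul_assoc, hMP, Matrix.zero_mul]
  have a6 : M * Y = 0 := by rw [← hY.supp, ← Matrix.mul_assoc, hMP', Matrix.zero_mul]
  have tot : X * X + Y * Y + M * M = 1 := by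
    rw [hX.sq, hY.sq, hM3, Pm, Pm, ← Matrix.diagonal_one]
    ext a b
    by_cases hab : a = b
    · subst hab
      simp only [Matrix.add_apply, Matrix.single_apply, Matrix.diagonal_apply_eq]
      by_cases h1 : i = a
      · subst h1; simp [hij.symm, hik.symm, hil.symm]
      by_cases h2 : j = a
      · subst h2; simp [hij, hjk.symm, hjl.symm]
      by_cases h3 : k = a
      · subst h3; simp [hik, hjk, hkl.symm]
      by_cases h4 : l = a
      · subst h4; simp [hil, hjl, hkl]
      have h1' := Ne.symm h1
      have h2' := Ne.symm h2
      have h3' := Ne.symm h3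
      have h4' := Ne.symm h4
      simp [h1, h2, h3, h4, h1', h2', h3', h4']
    · have hab2 : ∀ c : ι, ¬ (c = a ∧ c = b) := fun c h => hab (h.1.symm.trans h.2)
      simp [Matrix.single_apply, hab, hab2]
  have key : ∀ e f : ℝ, e * e = 1 → f * f = 1 →
      (ψ X + e • ψ Y + f • ψ M) * (ψ X + e • ψ Y + f • ψ M) = 1 := by
    intro e f he hf
    have := hψ.sq (X + e • Y + f • M) (by simp [hX.herm, hY.herm, hM1])
      (by simp [hX.tr, hY.tr, hM2]) (by
        simp only [add_mul, mul_add, smul_mul_assoc, mul_smul_comm, a1, a2, a3, a4, a5, a6, smul_smul, he, hf]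
        have s1 : ∀ Z : Matrix ι ι ℂ, e • e • Z = Z := fun Z => by rw [smul_smul, he, one_smul]
        have s2 : ∀ Z : Matrix ι ι ℂ, f • f • Z = Z := fun Z => by rw [smul_smul, hf, one_smul]
        simp only [smul_zero, add_zero, zero_add, s1, s2]
        exact tot)
    simpa using this
  have k1 := key 1 1 (by norm_num) (by norm_num)
  have k2 := key 1 (-1) (by norm_num) (by norm_num)
  have k3 := key (-1) 1 (by norm_num) (by norm_num)
  have k4 := key (-1) (-1) (by norm_num) (by norm_num)
  generalize ψ X = x at *
  generalize ψ Y = y at *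
  generalize ψ M = m at *
  simp only [add_mul, mul_add, smul_mul_assoc, mul_smul_comm] at k1 k2 k3 k4
  constructor
  · linear_combination (norm := module) (1/4 : ℝ) • k1 + (1/4 : ℝ) • k2 + (1/4 : ℝ) • k3 + (1/4 : ℝ) • k4
  · linear_combination (norm := module) (1/4 : ℝ) • k1 + (1/4 : ℝ) • k2 - (1/4 : ℝ) • k3 - (1/4 : ℝ) • k4

lemma exists_two_more (h4 : 4 ≤ Fintype.card ι) (i j : ι) :
    ∃ k l, k ≠ l ∧ i ≠ k ∧ i ≠ l ∧ j ≠ k ∧ j ≠ l := by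
  have h1 : 1 < (({i, j} : Finset ι)ᶜ).card := by
    rw [Finset.card_compl]
    have := Finset.card_le_two (a := i) (b := j)
    omega
  obtain ⟨k, hk, l, hl, hkl⟩ := Finset.one_lt_card.1 h1
  simp only [Finset.mem_compl, Finset.mem_insert, Finset.mem_singleton, not_or] at hk hl
  exact ⟨k, l, hkl, Ne.symm hk.1, Ne.symm hl.1, Ne.symm hk.2, Ne.symm hl.2⟩

/-- the square is constant on the sphere of a coordinate plane -/
def QC (ψ : Matrix ι ι ℂ →ₗ[ℝ] Matrix ι ι ℂ) : Prop :=
  ∀ i j X X', i ≠ j → IsSph i j X → IsSph i j X' → ψ X * ψ X = ψ X' * ψ X'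

lemma qc_of_four (hψ : Good ψ) (hc : Even (Fintype.card ι)) (h4 : 4 ≤ Fintype.card ι) : QC ψ := by
  intro i j X X' hij hX hX'
  obtain ⟨k, l, hkl, hik, hil, hjk, hjl⟩ := exists_two_more h4 i j
  obtain ⟨m, hm⟩ := four hψ hc hij hkl hik hil hjk hjl
  have e1 := (hm X _ hX (isSph_D hkl)).1
  have e2 := (hm X' _ hX' (isSph_D hkl)).1
  linear_combination (norm := module) e1 - e2

lemma qc_of_two (hψ : Good ψ) (h2 : Fintype.card ι = 2) : QC ψ := by
  intro i j X X' hij hX hX'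
  have hP : Pm i j = (1 : Matrix ι ι ℂ) := by
    have : ∀ a, a = i ∨ a = j := by
      intro a
      by_contra h
      push Not at h
      have : ({a, i, j} : Finset ι).card = 3 := by
        simp [Finset.card_insert_of_notMem, h.1, h.2, hij]
      have h3 := Finset.card_le_univ ({a, i, j} : Finset ι)
      omega
    ext a b
    simp only [Pm, Matrix.add_apply, Matrix.single_apply, Matrix.one_apply]
    rcases this a with rfl | rfl <;> rcases this b with rfl | rfl <;> simp [hij, hij.symm]
  rw [hψ.sq X hX.herm hX.tr (hX.sq.trans hP), hψ.sq X' hX'.herm hX'.tr (hX'.sq.trans hP)]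

lemma QC.anti (h : QC ψ) {i j : ι} (hij : i ≠ j) {X Y : Matrix ι ι ℂ} (hX : IsSph i j X) (hY : IsSph i j Y)
    (hXY : IsSph i j ((3/5 : ℝ) • X + (4/5 : ℝ) • Y)) : ψ X * ψ Y + ψ Y * ψ X = 0 := by
  have e1 := h i j _ _ hij hXY hX
  have e2 := h i j _ _ hij hY hX
  simp only [map_add, map_smul, add_mul, mul_add, smul_mul_assoc, mul_smul_comm] at e1
  linear_combination (norm := module) (25/12 : ℝ) • e1 - (16/12 : ℝ) • e2

lemma QC.anti_DS (h : QC ψ) {i j : ι} (hij : i ≠ j) (z : ℂ) (hz : Complex.normSq z = 1) :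
    ψ (Dm i j) * ψ (Sm i j z) + ψ (Sm i j z) * ψ (Dm i j) = 0 := by
  refine h.anti hij (isSph_D hij) (isSph_S hij z hz) ?_
  rw [← Sm_smul]
  exact isSph_comb hij _ _ (by simp [hz, Complex.normSq_mul]; norm_num)

lemma QC.anti_SS (h : QC ψ) {i j : ι} (hij : i ≠ j) :
    ψ (Sm i j 1) * ψ (Sm i j Complex.I) + ψ (Sm i j Complex.I) * ψ (Sm i j 1) = 0 := by
  refine h.anti hij (isSph_S hij 1 (by simp)) (isSph_S hij _ (by simp)) ?_
  rw [← Sm_smul, ← Sm_smul, ← Sm_add]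
  refine isSph_S hij _ ?_
  simp [Complex.normSq_apply]; norm_num

end Pres

section Cliff

variable {ι : Type} [Fintype ι] [DecidableEq ι]

lemma one_le_trace_idem (p : Matrix ι ι ℂ) (hp : p * p = p) (h0 : p ≠ 0) : (1 : ℝ) ≤ (Matrix.trace p).re := by
  have hi : IsIdempotentElem (Matrix.toLin' p) := by
    show Matrix.toLin' p * Matrix.toLin' p = _
    rw [Module.End.mul_eq_comp, ← Matrix.toLin'_mul, hp]
  have h1 := (LinearMap.IsIdempotentElem.isProj_range _ hi).trace
  rw [Matrix.trace_toLin'_eq] at h1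
  rw [h1, Complex.natCast_re]
  have : LinearMap.range (Matrix.toLin' p) ≠ ⊥ := by
    intro h
    rw [LinearMap.range_eq_bot] at h
    exact h0 (by simpa using h)
  have h2 := (Submodule.one_le_finrank_iff).2 this
  exact_mod_cast h2

lemma clifford_fin : ∀ (m : ℕ) (p : Matrix ι ι ℂ) (c : Fin m → Matrix ι ι ℂ), p * p = p → p ≠ 0 →
    (∀ i, c i * c i = p) → (∀ i, p * c i = c i) → (∀ i, c i * p = c i) →
    (∀ i j, i ≠ j → c i * c j = -(c j * c i)) → (2 : ℝ) ^ (m / 2) ≤ (Matrix.trace p).re := by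
  intro m
  induction m using Nat.strong_induction_on with
  | _ m ih =>
    intro p c hp h0 hsq hpc hcp hac
    rcases Nat.lt_or_ge m 2 with hm | hm
    · have : m / 2 = 0 := by omega
      rw [this, pow_zero]
      exact one_le_trace_idem p hp h0
    · obtain ⟨r, rfl⟩ : ∃ r, m = r + 2 := ⟨m - 2, by omega⟩
      set a := c 0 with ha
      set b := c 1 with hb
      have hab : a * b = -(b * a) := hac 0 1 (by simp)
      have htab : Matrix.trace (a * b) = 0 := by
        have h1 : Matrix.trace (a * b) = - Matrix.trace (a * b) := by
          conv_lhs => rw [hab, Matrix.trace_neg, Matrix.trace_mul_comm]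
        linear_combination (1/2 : ℂ) * h1
      have hw : (Complex.I • (a * b)) * (Complex.I • (a * b)) = p := by
        have : (a * b) * (a * b) = - p := by
          calc (a * b) * (a * b) = a * (b * a) * b := by noncomm_ring
            _ = - ((a * a) * (b * b)) := by
              have : b * a = -(a * b) := by rw [hab, neg_neg]
              rw [this]; noncomm_ring
            _ = - p := by rw [hsq 0, hsq 1, hp]
        rw [smul_mul_assoc, mul_smul_comm, smul_smul, Complex.I_mul_I, this]; simp
      set w := Complex.I • (a * b) with hwdef
      have hpw : p * w = w := by rw [hwdef, mul_smul_comm, ← mul_assoc, hpc 0]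
      have hwp : w * p = w := by rw [hwdef, smul_mul_assoc, mul_assoc, hcp 1]
      set q := (1/2 : ℂ) • (p + w) with hq
      have hqq : q * q = q := by
        rw [hq, smul_mul_assoc, mul_smul_comm, smul_smul, add_mul, mul_add, mul_add, hp, hpw, hwp, hw]
        module
      have hqtr : Matrix.trace q = (1/2 : ℂ) * Matrix.trace p := by
        rw [hq, Matrix.trace_smul, Matrix.trace_add, hwdef, Matrix.trace_smul, htab]; simp
      have hqre : (Matrix.trace q).re = (1/2 : ℝ) * (Matrix.trace p).re := by
        rw [hqtr]; simp
      have hq0 : q ≠ 0 := by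
        intro h
        have h1 := one_le_trace_idem p hp h0
        rw [h] at hqre; simp at hqre; linarith
      have hqp : q * p = q := by rw [hq, smul_mul_assoc, add_mul, hp, hwp]
      have hcw : ∀ i : Fin r, c i.succ.succ * w = w * c i.succ.succ := by
        intro i
        have h1 := hac i.succ.succ 0 (Fin.succ_ne_zero _)
        have h2 := hac i.succ.succ 1 (by
          rw [← Fin.succ_zero_eq_one]; exact fun h => Fin.succ_ne_zero _ (Fin.succ_injective _ h))
        rw [hwdef, smul_mul_assoc, mul_smul_comm]
        congr 1
        rw [← mul_assoc, h1, neg_mul, mul_assoc, h2]; noncomm_ring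
      have hcq : ∀ i : Fin r, c i.succ.succ * q = q * c i.succ.succ := by
        intro i
        rw [hq, smul_mul_assoc, mul_smul_comm, mul_add, add_mul, hcw, hpc, hcp]
      have := ih r (by omega) q (fun i => q * c i.succ.succ) hqq hq0
        (fun i => by
          show q * c i.succ.succ * (q * c i.succ.succ) = q
          rw [mul_assoc, ← mul_assoc (c _) q, hcq, mul_assoc q (c _), hsq, ← mul_assoc, hqq, hqp])
        (fun i => by show q * (q * _) = _; rw [← mul_assoc, hqq])
        (fun i => by show q * _ * q = _; rw [mul_assoc, hcq, ← mul_assoc, hqq])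
        (fun i j hij => by
          show q * c i.succ.succ * (q * c j.succ.succ) = -(q * c j.succ.succ * (q * c i.succ.succ))
          have := hac i.succ.succ j.succ.succ (fun h => hij (Fin.succ_injective _ (Fin.succ_injective _ h)))
          calc q * c i.succ.succ * (q * c j.succ.succ) = q * (c i.succ.succ * q) * c j.succ.succ := by noncomm_ring
            _ = q * q * (c i.succ.succ * c j.succ.succ) := by rw [hcq]; noncomm_ring
            _ = - (q * (q * c j.succ.succ) * c i.succ.succ) := by rw [this]; noncomm_ring
            _ = _ := by rw [show q * c j.succ.succ * (q * c i.succ.succ) = q * (c j.succ.succ * q) * c i.succ.succ by noncomm_ring, hcq])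
      have hd : (r + 2) / 2 = r / 2 + 1 := by omega
      rw [hd, pow_succ]; linarith

lemma clifford {κ : Type} [Fintype κ] (p : Matrix ι ι ℂ) (c : κ → Matrix ι ι ℂ) (hp : p * p = p) (h0 : p ≠ 0)
    (h1 : ∀ i, c i * c i = p) (h2 : ∀ i, p * c i = c i) (h3 : ∀ i, c i * p = c i)
    (h4 : ∀ i j, i ≠ j → c i * c j = -(c j * c i)) : (2 : ℝ) ^ (Fintype.card κ / 2) ≤ (Matrix.trace p).re := by
  refine clifford_fin (Fintype.card κ) p (fun i => c ((Fintype.equivFin κ).symm i)) hp h0 (fun _ => h1 _)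
    (fun _ => h2 _) (fun _ => h3 _) (fun i j hij => h4 _ _ (fun h => hij ?_))
  simpa using h

lemma pow_bound (m : ℕ) : 2 * m + (if 2 ≤ m then 1 else 0) ≤ 2 ^ (m * 3 / 2) := by
  induction m using Nat.strong_induction_on with
  | _ m ih =>
    rcases Nat.lt_or_ge m 4 with h | h
    · interval_cases m <;> decide
    · have := ih (m - 2) (by omega)
      have e : m * 3 / 2 = (m - 2) * 3 / 2 + 3 := by omega
      rw [e, pow_add]
      have h2 : 2 ≤ m := by omega
      simp only [h2, if_true]
      split_ifs at this <;> omega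

variable {κ : Type} [Fintype κ] [DecidableEq κ]

structure CliffSys (c : κ → Fin 3 → Matrix ι ι ℂ) (s : κ → Matrix ι ι ℂ) : Prop where
  idem : ∀ j, s j * s j = s j
  sq : ∀ j i, c j i * c j i = s j
  sc : ∀ j i, s j * c j i = c j i
  anti : ∀ j i j' i', (j, i) ≠ (j', i') → c j i * c j' i' = -(c j' i' * c j i)

lemma CliffSys.comm {c : κ → Fin 3 → Matrix ι ι ℂ} {s : κ → Matrix ι ι ℂ} (h : CliffSys c s) (j j' i') :
    s j * c j' i' = c j' i' * s j := by
  rw [← h.sq j 0]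
  by_cases e : (j, (0 : Fin 3)) = (j', i')
  · obtain ⟨rfl, rfl⟩ := Prod.mk.inj e; rw [mul_assoc]
  · have := h.anti _ _ _ _ e
    rw [mul_assoc, this, mul_neg, ← mul_assoc, this]; noncomm_ring

lemma CliffSys.comm' {c : κ → Fin 3 → Matrix ι ι ℂ} {s : κ → Matrix ι ι ℂ} (h : CliffSys c s) (j j') :
    s j * s j' = s j' * s j := by
  rw [← h.sq j' 0, ← mul_assoc, h.comm, mul_assoc, h.comm, mul_assoc]

open Classical in
lemma count {c : κ → Fin 3 → Matrix ι ι ℂ} {s : κ → Matrix ι ι ℂ} (h : CliffSys c s) (T : Finset κ) :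
    ∀ (S : Finset κ) (p : Matrix ι ι ℂ), Disjoint T S → p ≠ 0 → p * p = p →
      (∀ j i, c j i * p = p * c j i) → (∀ j ∈ S, s j * p = p) →
      (2 : ℝ) * (T.filter (fun j => s j * p ≠ 0)).card + 2 * S.card +
        (if ∃ i ∈ T ∪ S, ∃ j ∈ T ∪ S, i ≠ j ∧ s i * s j * p ≠ 0 then 1 else 0) ≤ (Matrix.trace p).re := by
  induction T using Finset.induction_on with
  | empty =>
    intro S p _ h0 hp hcp hsp
    have key := clifford (κ := S × Fin 3) p (fun x => c x.1 x.2 * p) hp h0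
      (fun x => by
        show c x.1 x.2 * p * (c x.1 x.2 * p) = p
        rw [mul_assoc, ← mul_assoc p, ← hcp, mul_assoc (c _ _) p p, hp, ← mul_assoc, h.sq, hsp _ x.1.2])
      (fun x => by show p * (_ * p) = _; rw [← mul_assoc, ← hcp, mul_assoc, hp])
      (fun x => by show _ * p * p = _; rw [mul_assoc, hp])
      (fun x y hxy => by
        show c x.1 x.2 * p * (c y.1 y.2 * p) = -(c y.1 y.2 * p * (c x.1 x.2 * p))
        have e := h.anti x.1 x.2 y.1 y.2 (fun e => hxy (by
          obtain ⟨e1, e2⟩ := Prod.mk.inj e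
          exact Prod.ext (Subtype.ext e1) e2))
        have l1 : ∀ a b a' b', c a b * p * (c a' b' * p) = c a b * c a' b' * p := by
          intro a b a' b'
          rw [mul_assoc, ← mul_assoc p, ← hcp, mul_assoc (c _ _) p p, hp, mul_assoc]
        rw [l1, l1, e, neg_mul])
    rw [Fintype.card_prod, Fintype.card_coe, Fintype.card_fin] at key
    have pb := pow_bound S.card
    have hle : (if ∃ i ∈ (∅ : Finset κ) ∪ S, ∃ j ∈ (∅ : Finset κ) ∪ S, i ≠ j ∧ s i * s j * p ≠ 0 then (1 : ℝ) else 0)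
        ≤ ((if 2 ≤ S.card then 1 else 0 : ℕ) : ℝ) := by
      split_ifs with h1 h2 h2
      · simp
      · exfalso
        obtain ⟨i, hi, j, hj, hij, _⟩ := h1
        simp only [Finset.empty_union] at hi hj
        exact h2 (Finset.one_lt_card.2 ⟨i, hi, j, hj, hij⟩)
      · simp
      · simp
    have pb' : (2 : ℝ) * S.card + ((if 2 ≤ S.card then 1 else 0 : ℕ) : ℝ) ≤ 2 ^ (S.card * 3 / 2) := by
      exact_mod_cast pb
    simp only [Finset.filter_empty, Finset.card_empty, Nat.cast_zero, mul_zero, zero_add]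
    linarith
  | insert t T ht ih =>
    intro S p hd h0 hp hcp hsp
    rw [Finset.disjoint_insert_left] at hd
    have hsc : ∀ j, s j * p = p * s j := by
      intro j
      rw [← h.sq j 0, mul_assoc, hcp, ← mul_assoc, hcp, mul_assoc]
    have hd2 : Disjoint T (insert t S) := by
      rw [Finset.disjoint_insert_right]; exact ⟨ht, hd.2⟩
    by_cases c1 : s t * p = 0
    · have := ih S p hd.2 h0 hp hcp hsp
      rw [Finset.filter_insert, if_neg (by simp [c1])]
      refine le_trans ?_ this
      gcongr
      split_ifs with h1 h2 h2
      · simp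
      · exfalso
        obtain ⟨i, hi, j, hj, hij, hn⟩ := h1
        refine h2 ⟨i, ?_, j, ?_, hij, hn⟩
        · rw [Finset.insert_union, Finset.mem_insert] at hi
          refine hi.resolve_left ?_
          rintro rfl
          exact hn (by rw [h.comm', mul_assoc, c1, mul_zero])
        · rw [Finset.insert_union, Finset.mem_insert] at hj
          refine hj.resolve_left ?_
          rintro rfl
          exact hn (by rw [mul_assoc, c1, mul_zero])
      · simp
      · simp
    by_cases c2 : s t * p = p
    · have := ih (insert t S) p hd2 h0 hp hcp (fun j hj => by
        rcases Finset.mem_insert.1 hj with rfl | hj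
        · exact c2
        · exact hsp j hj)
      rw [Finset.filter_insert, if_pos c1, Finset.card_insert_of_notMem (by simp [ht])]
      rw [Finset.card_insert_of_notMem hd.1] at this
      rw [Finset.insert_union, ← Finset.union_insert]
      push_cast at this ⊢
      linarith
    set p1 := s t * p with hp1
    set p2 := p - s t * p with hp2
    have h11 : p1 * p1 = p1 := by
      rw [hp1, mul_assoc, ← mul_assoc p, ← hsc, mul_assoc (s t) p p, hp, ← mul_assoc, h.idem]
    have hpp1 : p * p1 = p1 := by rw [hp1, ← mul_assoc, ← hsc, mul_assoc, hp]
    have hp1p : p1 * p = p1 := by rw [hp1, mul_assoc, hp]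
    have h22 : p2 * p2 = p2 := by
      show (p - p1) * (p - p1) = p - p1
      rw [sub_mul, mul_sub, mul_sub, hp, hpp1, hp1p, h11]; abel
    have hc1 : ∀ j i, c j i * p1 = p1 * c j i := by
      intro j i
      rw [hp1, ← mul_assoc, ← h.comm, mul_assoc, hcp, mul_assoc]
    have hc2 : ∀ j i, c j i * p2 = p2 * c j i := by
      intro j i
      show c j i * (p - p1) = (p - p1) * c j i
      rw [mul_sub, sub_mul, hcp, hc1]
    have hs1 : ∀ j ∈ S, s j * p1 = p1 := by
      intro j hj
      rw [hp1, ← mul_assoc, h.comm', mul_assoc, hsp j hj]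
    have i1 := ih (insert t S) p1 hd2 c1 h11 hc1 (fun j hj => by
      rcases Finset.mem_insert.1 hj with rfl | hj
      · rw [hp1, ← mul_assoc, h.idem]
      · exact hs1 j hj)
    have i2 := ih S p2 hd.2 (sub_ne_zero.2 (Ne.symm c2)) h22 hc2 (fun j hj => by
      show s j * (p - p1) = p - p1
      rw [mul_sub, hsp j hj, hs1 j hj])
    have hsum : p = p1 + p2 := by rw [hp2]; abel
    have hst2 : s t * p2 = 0 := by
      rw [hp2, mul_sub, ← mul_assoc, h.idem, sub_self]
    have htr : (Matrix.trace p).re = (Matrix.trace p1).re + (Matrix.trace p2).re := by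
      rw [← Complex.add_re, ← Matrix.trace_add, ← hsum]
    have hcard : (T.filter (fun j => s j * p ≠ 0)).card ≤
        (T.filter (fun j => s j * p1 ≠ 0)).card + (T.filter (fun j => s j * p2 ≠ 0)).card := by
      refine le_trans (Finset.card_le_card ?_) (Finset.card_union_le _ _)
      intro j hj
      simp only [Finset.mem_filter, Finset.mem_union] at hj ⊢
      by_contra hcon
      push Not at hcon
      refine hj.2 ?_
      rw [hsum, mul_add, hcon.1 hj.1, hcon.2 hj.1, add_zero]
    have hcard' : ((T.filter (fun j => s j * p ≠ 0)).card : ℝ) ≤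
        (T.filter (fun j => s j * p1 ≠ 0)).card + (T.filter (fun j => s j * p2 ≠ 0)).card := by
      exact_mod_cast hcard
    have hext : (if ∃ i ∈ insert t T ∪ S, ∃ j ∈ insert t T ∪ S, i ≠ j ∧ s i * s j * p ≠ 0 then (1 : ℝ) else 0) ≤
        (if ∃ i ∈ T ∪ insert t S, ∃ j ∈ T ∪ insert t S, i ≠ j ∧ s i * s j * p1 ≠ 0 then 1 else 0) +
        (if ∃ i ∈ T ∪ S, ∃ j ∈ T ∪ S, i ≠ j ∧ s i * s j * p2 ≠ 0 then 1 else 0) := by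
      by_cases h1 : ∃ i ∈ insert t T ∪ S, ∃ j ∈ insert t T ∪ S, i ≠ j ∧ s i * s j * p ≠ 0
      · rw [if_pos h1]
        obtain ⟨i, hi, j, hj, hij, hn⟩ := h1
        by_cases g1 : s i * s j * p1 = 0
        · have g2 : s i * s j * p2 ≠ 0 := by
            intro g2; apply hn; rw [hsum, mul_add, g1, g2, add_zero]
          have : ∃ i ∈ T ∪ S, ∃ j ∈ T ∪ S, i ≠ j ∧ s i * s j * p2 ≠ 0 := by
            refine ⟨i, ?_, j, ?_, hij, g2⟩
            · rw [Finset.insert_union, Finset.mem_insert] at hi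
              refine hi.resolve_left ?_
              rintro rfl
              exact g2 (by rw [h.comm', mul_assoc, hst2, mul_zero])
            · rw [Finset.insert_union, Finset.mem_insert] at hj
              refine hj.resolve_left ?_
              rintro rfl
              exact g2 (by rw [mul_assoc, hst2, mul_zero])
          rw [if_pos this]
          split_ifs <;> norm_num
        · have : ∃ i ∈ T ∪ insert t S, ∃ j ∈ T ∪ insert t S, i ≠ j ∧ s i * s j * p1 ≠ 0 := by
            rw [Finset.union_insert, ← Finset.insert_union]
            exact ⟨i, hi, j, hj, hij, g1⟩
          rw [if_pos this]
          split_ifs <;> norm_num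
      · rw [if_neg h1]
        split_ifs <;> norm_num
    rw [Finset.filter_insert, if_pos c1, Finset.card_insert_of_notMem (fun hm => ht (Finset.mem_filter.1 hm).1), htr]
    rw [Finset.card_insert_of_notMem hd.1] at i1
    have hS : (0 : ℝ) ≤ S.card := Nat.cast_nonneg _
    push_cast at i1 ⊢
    linarith

lemma count_main {c : κ → Fin 3 → Matrix ι ι ℂ} {s : κ → Matrix ι ι ℂ} (h : CliffSys c s)
    (hn : ∀ j, s j ≠ 0) (hc : Fintype.card ι = 2 * Fintype.card κ) (i j : κ) (hij : i ≠ j) : s i * s j = 0 := by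
  classical
  by_contra hne
  have h1 : (1 : Matrix ι ι ℂ) ≠ 0 := by
    intro h; apply hne; rw [← mul_one (s i * s j), h, mul_zero]
  have := count h Finset.univ ∅ 1 (by simp) h1 (by simp) (by simp) (by simp)
  rw [if_pos ⟨i, by simp, j, by simp, hij, by simpa using hne⟩] at this
  simp [hn, hc] at this
  linarith

end Cliff

section Frame
open scoped ComplexOrder

variable {ι : Type} [Fintype ι] [DecidableEq ι]

lemma spec (Q : Matrix ι ι ℂ) (hQ : Qᴴ = Q) : ∃ (U : Matrix ι ι ℂ) (d : ι → ℝ), star U * U = 1 ∧ U * star U = 1 ∧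
    U * Matrix.diagonal (fun i => (d i : ℂ)) * star U = Q := by
  have hQ' : Q.IsHermitian := hQ
  refine ⟨hQ'.eigenvectorUnitary, hQ'.eigenvalues, (Matrix.mem_unitaryGroup_iff'.1 hQ'.eigenvectorUnitary.2),
    (Matrix.mem_unitaryGroup_iff.1 hQ'.eigenvectorUnitary.2), ?_⟩
  conv_rhs => rw [hQ'.spectral_theorem]
  rw [Unitary.conjStarAlgAut_apply]; rfl

def Fd (U : Matrix ι ι ℂ) (d : ι → ℝ) (h : ℝ → ℂ) : Matrix ι ι ℂ := U * Matrix.diagonal (fun i => h (d i)) * star U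

lemma Fd_mul (U : Matrix ι ι ℂ) (d : ι → ℝ) (hU1 : star U * U = 1) (h h' : ℝ → ℂ) :
    Fd U d h * Fd U d h' = Fd U d (fun x => h x * h' x) := by
  rw [Fd, Fd, Fd, ← Matrix.diagonal_mul_diagonal]
  generalize Matrix.diagonal (fun i => h (d i)) = A
  generalize Matrix.diagonal (fun i => h' (d i)) = B
  rw [show U * A * star U * (U * B * star U) = U * A * (star U * U) * B * star U by noncomm_ring, hU1, mul_one,
    mul_assoc U]

lemma Fd_key (U X D : Matrix ι ι ℂ) (hU1 : star U * U = 1) (hU2 : U * star U = 1) :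
    X * (U * D * star U) = U * D * star U * X ↔ (star U * X * U) * D = D * (star U * X * U) := by
  constructor
  · intro e
    calc star U * X * U * D = star U * (X * (U * D * star U)) * U := by
          rw [show star U * (X * (U * D * star U)) * U = star U * X * U * D * (star U * U) by noncomm_ring, hU1, mul_one]
      _ = _ := by
          rw [e, show star U * (U * D * star U * X) * U = (star U * U) * D * (star U * X * U) by noncomm_ring, hU1, one_mul]
  · intro e
    calc X * (U * D * star U) = (U * star U) * (X * (U * D * star U)) := by rw [hU2, one_mul]
      _ = U * (star U * X * U * D) * star U := by noncomm_ring
      _ = U * D * star U * X * (U * star U) := by rw [e]; noncomm_ring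
      _ = _ := by rw [hU2, mul_one]

lemma Fd_comm (U X : Matrix ι ι ℂ) (d : ι → ℝ) (hU1 : star U * U = 1) (hU2 : U * star U = 1) (h : ℝ → ℂ)
    (hX : X * Fd U d (fun x => (x : ℂ)) = Fd U d (fun x => (x : ℂ)) * X) : X * Fd U d h = Fd U d h * X := by
  rw [Fd, Fd_key _ _ _ hU1 hU2] at hX ⊢
  generalize star U * X * U = Y at *
  ext i j
  have := congrFun (congrFun hX i) j
  rw [Matrix.mul_diagonal, Matrix.diagonal_mul] at this ⊢
  by_cases hij : d i = d j
  · rw [hij, mul_comm]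
  · have h0 : Y i j = 0 := by
      have h2 : (Y i j) * ((d j : ℂ) - d i) = 0 := by linear_combination this
      rcases mul_eq_zero.1 h2 with h | h
      · exact h
      · exfalso; apply hij; rw [sub_eq_zero] at h; exact_mod_cast h.symm
    rw [h0]; simp

lemma glem (Q : Matrix ι ι ℂ) (hQ : Qᴴ = Q) : ∃ g s : Matrix ι ι ℂ,
    (∀ X, X * Q = Q * X → X * g = g * X) ∧ (∀ X, X * Q = Q * X → X * s = s * X) ∧
    g * g * Q = s ∧ s * s = s ∧ s * Q = Q := by
  obtain ⟨U, d, hU1, hU2, hF⟩ := spec Q hQ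
  replace hF : Fd U d (fun x => (x : ℂ)) = Q := hF
  subst hF
  refine ⟨Fd U d (fun x => if x = 0 then 0 else (Complex.cpow (x : ℂ) (1/2 : ℂ))⁻¹), Fd U d (fun x => if x = 0 then 0 else 1),
    fun X hX => Fd_comm U X d hU1 hU2 _ hX, fun X hX => Fd_comm U X d hU1 hU2 _ hX, ?_, ?_, ?_⟩
  · rw [Fd_mul _ _ hU1, Fd_mul _ _ hU1]; congr 1; ext x
    by_cases hx : x = 0
    · simp [hx]
    · have hx' : (x : ℂ) ≠ 0 := by exact_mod_cast hx
      have : Complex.cpow (x : ℂ) (1/2 : ℂ) * Complex.cpow (x : ℂ) (1/2 : ℂ) = x := by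
        have := Complex.cpow_add (1/2 : ℂ) (1/2 : ℂ) hx'
        norm_num at this ⊢
        exact this.symm
      simp only [hx, if_false]
      rw [← mul_inv, this, inv_mul_cancel₀ hx']
  · rw [Fd_mul _ _ hU1]; congr 1; ext x; split_ifs <;> simp
  · rw [Fd_mul _ _ hU1]; congr 1; ext x; split_ifs with h <;> simp [h]

lemma herm_cancel {a B : Matrix ι ι ℂ} (ha : aᴴ = a) (h : B * (a * a) = 0) : B * a = 0 := by
  rw [← Matrix.self_mul_conjTranspose_eq_zero, Matrix.conjTranspose_mul, ha,
    show B * a * (a * Bᴴ) = B * (a * a) * Bᴴ by noncomm_ring, h, zero_mul]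

lemma herm_sq_zero {a : Matrix ι ι ℂ} (ha : aᴴ = a) (h : a * a = 0) : a = 0 := by
  have := herm_cancel (B := 1) ha (by rw [h, mul_zero])
  simpa using this

variable {κ : Type} [Fintype κ] [DecidableEq κ]

lemma comm_sq_of_anti {a b : Matrix ι ι ℂ} (h : a * b = -(b * a)) : a * (b * b) = b * b * a := by
  rw [← mul_assoc, h, neg_mul, mul_assoc, h]; noncomm_ring

lemma frame_main {a : κ → Fin 3 → Matrix ι ι ℂ} {Q : κ → Matrix ι ι ℂ} (ha : ∀ j i, (a j i)ᴴ = a j i)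
    (hsq : ∀ j i, a j i * a j i = Q j)
    (anti : ∀ j i j' i', (j, i) ≠ (j', i') → a j i * a j' i' = -(a j' i' * a j i))
    (h0 : ∀ j, Q j ≠ 0) (hc : Fintype.card ι = 2 * Fintype.card κ) (hsum : ∑ j, Q j = 1) :
    (∀ i j, i ≠ j → Q i * Q j = 0) ∧ (∀ j, Q j * Q j = Q j) ∧ (∀ j, (Matrix.trace (Q j)).re = 2) := by
  have hQh : ∀ j, (Q j)ᴴ = Q j := fun j => by rw [← hsq j 0, Matrix.conjTranspose_mul, ha]
  choose g s hg hs hgs hss hsQ using fun j => glem (Q j) (hQh j)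
  have aQ : ∀ j i j', a j i * Q j' = Q j' * a j i := by
    intro j i j'
    by_cases e : (j, i) = (j', (0 : Fin 3))
    · obtain ⟨rfl, rfl⟩ := Prod.mk.inj e; rw [← hsq j 0]; noncomm_ring
    · rw [← hsq j' 0]; exact comm_sq_of_anti (anti _ _ _ _ e)
  have ag : ∀ j i j', a j i * g j' = g j' * a j i := fun j i j' => hg _ _ (aQ _ _ _)
  have as : ∀ j i j', a j i * s j' = s j' * a j i := fun j i j' => hs _ _ (aQ _ _ _)
  have gQ : ∀ j j', g j * Q j' = Q j' * g j := fun j j' => by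
    rw [← hsq j' 0, ← mul_assoc, ← ag, mul_assoc, ← ag, mul_assoc]
  have sQ : ∀ j j', s j * Q j' = Q j' * s j := fun j j' => by
    rw [← hsq j' 0, ← mul_assoc, ← as, mul_assoc, ← as, mul_assoc]
  have gg : ∀ j j', g j * g j' = g j' * g j := fun j j' => hg _ _ (gQ _ _)
  have gs : ∀ j j', g j * s j' = s j' * g j := fun j j' => hs _ _ (gQ _ _)
  have ss : ∀ j j', s j * s j' = s j' * s j := fun j j' => hs _ _ (sQ _ _)
  let e : κ → Matrix ι ι ℂ := fun j => g j * s j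
  have ae : ∀ j i j', a j i * e j' = e j' * a j i := fun j i j' => by
    show a j i * (g j' * s j') = g j' * s j' * a j i
    rw [← mul_assoc, ag, mul_assoc, as, mul_assoc]
  have se : ∀ j j', s j * e j' = e j' * s j := fun j j' => by
    show s j * (g j' * s j') = g j' * s j' * s j
    rw [← mul_assoc, ← gs, mul_assoc, ss, mul_assoc]
  have ge : ∀ j j', g j * e j' = e j' * g j := fun j j' => by
    show g j * (g j' * s j') = g j' * s j' * g j
    rw [← mul_assoc, gg, mul_assoc, gs, mul_assoc]
  have ee : ∀ j j', e j * e j' = e j' * e j := fun j j' => by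
    show g j * s j * e j' = e j' * (g j * s j)
    rw [mul_assoc, se, ← mul_assoc, ge, mul_assoc]
  have prod : ∀ j i j' i', (a j i * e j) * (a j' i' * e j') = (a j i * a j' i') * (e j * e j') := by
    intro j i j' i'
    rw [mul_assoc, ← mul_assoc (e j), ← ae]; simp only [mul_assoc]
  have eeQ : ∀ j, Q j * (e j * e j) = s j := by
    intro j
    show Q j * (g j * s j * (g j * s j)) = s j
    rw [mul_assoc (g j), ← mul_assoc (s j), ← gs, mul_assoc (g j), hss, ← mul_assoc (g j), ← mul_assoc,
      ← mul_assoc, ← gQ, mul_assoc (g j), ← gQ, ← mul_assoc, hgs, hss]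
  have cs : CliffSys (fun j i => a j i * e j) s := by
    refine ⟨hss, ?_, ?_, ?_⟩
    · intro j i
      show a j i * e j * (a j i * e j) = s j
      rw [prod, hsq, eeQ]
    · intro j i
      show s j * (a j i * e j) = a j i * e j
      rw [← mul_assoc, ← as, mul_assoc, se]
      show a j i * (g j * s j * s j) = a j i * (g j * s j)
      rw [mul_assoc (g j), hss]
    · intro j i j' i' h
      show a j i * e j * (a j' i' * e j') = -(a j' i' * e j' * (a j i * e j))
      rw [prod, prod, anti _ _ _ _ h, ee, neg_mul]
  have sn : ∀ j, s j ≠ 0 := fun j h => h0 j (by rw [← hsQ j, h, zero_mul])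
  have orth : ∀ i j, i ≠ j → Q i * Q j = 0 := by
    intro i j hij
    have := count_main cs sn hc i j hij
    rw [← hsQ i, ← hsQ j, sQ i i, mul_assoc, ← mul_assoc (s i), this, zero_mul, mul_zero]
  have idem : ∀ j, Q j * Q j = Q j := by
    intro j
    have := congrArg (Q j * ·) hsum
    simp only [Finset.mul_sum, mul_one] at this
    rwa [Finset.sum_eq_single j (fun b _ hb => orth j b hb.symm) (by simp)] at this
  have Qa : ∀ j i, Q j * a j i = a j i := by
    intro j i
    have := herm_cancel (a := a j i) (B := Q j - 1) (ha j i) (by rw [hsq, sub_mul, idem, one_mul, sub_self])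
    rw [sub_mul, one_mul, sub_eq_zero] at this
    exact this
  have ge2 : ∀ j, (2 : ℝ) ≤ (Matrix.trace (Q j)).re := by
    intro j
    have := clifford (Q j) (a j) (idem j) (h0 j) (hsq j) (Qa j) (fun i => by rw [aQ, Qa])
      (fun i i' h => anti _ _ _ _ (fun h' => h (Prod.mk.inj h').2))
    simpa using this
  refine ⟨orth, idem, fun j => ?_⟩
  have htr : ∑ j, (Matrix.trace (Q j)).re = 2 * Fintype.card κ := by
    rw [← Complex.re_sum, ← Matrix.trace_sum, hsum, Matrix.trace_one, hc]; simp
  have h3 : ∑ j, ((Matrix.trace (Q j)).re - 2) = 0 := by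
    rw [Finset.sum_sub_distrib, htr]; simp; ring
  have h4 := (Finset.sum_eq_zero_iff_of_nonneg (fun j _ => sub_nonneg.2 (ge2 j))).1 h3 j (Finset.mem_univ _)
  linarith

end Frame

section Frame2

variable {ι : Type} [Fintype ι] [DecidableEq ι]
variable {ψ : Matrix ι ι ℂ →ₗ[ℝ] Matrix ι ι ℂ}

lemma sum_sq_anti {κ : Type} [DecidableEq κ] (a : κ → Matrix ι ι ℂ) (s : Finset κ)
    (h : ∀ i j, i ≠ j → a i * a j = -(a j * a i)) : (∑ i ∈ s, a i) * (∑ i ∈ s, a i) = ∑ i ∈ s, a i * a i := by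
  induction s using Finset.induction_on with
  | empty => simp
  | insert t s ht ih =>
    have : a t * (∑ i ∈ s, a i) = -((∑ i ∈ s, a i) * a t) := by
      rw [Finset.mul_sum, Finset.sum_mul, ← Finset.sum_neg_distrib]
      exact Finset.sum_congr rfl (fun i hi => h _ _ (fun e => ht (e ▸ hi)))
    rw [Finset.sum_insert ht, Finset.sum_insert ht, ← ih, add_mul, mul_add, mul_add, this]
    abel

noncomputable def fr (ψ : Matrix ι ι ℂ →ₗ[ℝ] Matrix ι ι ℂ) (i j : ι) : Fin 3 → Matrix ι ι ℂ :=
  ![ψ (Dm i j), ψ (Sm i j 1), ψ (Sm i j Complex.I)]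

lemma fr_sph {i j : ι} (hij : i ≠ j) (t : Fin 3) : ∃ X, IsSph i j X ∧ fr ψ i j t = ψ X := by
  fin_cases t
  · exact ⟨_, isSph_D hij, rfl⟩
  · exact ⟨_, isSph_S hij 1 (by simp), rfl⟩
  · exact ⟨_, isSph_S hij Complex.I (by simp), rfl⟩

lemma fr_anti (h : QC ψ) {i j : ι} (hij : i ≠ j) (t t' : Fin 3) (htt : t ≠ t') :
    fr ψ i j t * fr ψ i j t' = -(fr ψ i j t' * fr ψ i j t) := by
  have h1 := eq_neg_of_add_eq_zero_left (h.anti_DS hij 1 (by simp))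
  have h2 := eq_neg_of_add_eq_zero_left (h.anti_DS hij Complex.I (by simp))
  have h3 := eq_neg_of_add_eq_zero_left (h.anti_SS hij)
  have h1' := eq_neg_of_add_eq_zero_right (h.anti_DS hij 1 (by simp))
  have h2' := eq_neg_of_add_eq_zero_right (h.anti_DS hij Complex.I (by simp))
  have h3' := eq_neg_of_add_eq_zero_right (h.anti_SS hij)
  fin_cases t <;> fin_cases t' <;> first | exact absurd rfl htt | assumption

lemma exists_match {r : ℕ} (hc : Fintype.card ι = 2 * (r + 2)) {i j k l : ι} (hij : i ≠ j) (hkl : k ≠ l)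
    (hik : i ≠ k) (hil : i ≠ l) (hjk : j ≠ k) (hjl : j ≠ l) :
    ∃ e : Fin (r + 2) × Fin 2 ≃ ι, e (0, 0) = i ∧ e (0, 1) = j ∧ e (1, 0) = k ∧ e (1, 1) = l := by
  let f : Fin (r + 2) × Fin 2 → ι := fun x =>
    if x = (0, 0) then i else if x = (0, 1) then j else if x = (1, 0) then k else l
  obtain ⟨g, hg⟩ := Finset.exists_equiv_extend_of_card_eq (α := Fin (r + 2) × Fin 2) (t := (Finset.univ : Finset ι))
    (by simp [hc]; ring) (s := {(0, 0), (0, 1), (1, 0), (1, 1)}) (f := f) (by simp) (by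
      intro x hx y hy
      simp only [Finset.coe_insert, Finset.coe_singleton, Set.mem_insert_iff, Set.mem_singleton_iff] at hx hy
      rcases hx with rfl | rfl | rfl | rfl <;> rcases hy with rfl | rfl | rfl | rfl <;>
        simp [f, hij, hkl, hik, hil, hjk, hjl, hij.symm, hkl.symm, hik.symm, hil.symm, hjk.symm, hjl.symm])
  refine ⟨g.trans (Equiv.subtypeUnivEquiv (by simp)), ?_, ?_, ?_, ?_⟩
  · have := hg (0, 0) (by simp); simpa [f] using this
  · have := hg (0, 1) (by simp); simpa [f] using this
  · have := hg (1, 0) (by simp); simpa [f] using this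
  · have := hg (1, 1) (by simp); simpa [f] using this

lemma frame_rel (hψ : Good ψ) {r : ℕ} (hc : Fintype.card ι = 2 * (r + 2))
    (hgen : ∀ i j, i ≠ j → ψ (Sm i j 1) ≠ 0) {i j k l : ι} (hij : i ≠ j) (hkl : k ≠ l)
    (hik : i ≠ k) (hil : i ≠ l) (hjk : j ≠ k) (hjl : j ≠ l) :
    (ψ (Dm i j) * ψ (Dm i j)) * (ψ (Dm k l) * ψ (Dm k l)) = 0 ∧
    (ψ (Dm i j) * ψ (Dm i j)) * (ψ (Dm i j) * ψ (Dm i j)) = ψ (Dm i j) * ψ (Dm i j) ∧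
    (Matrix.trace (ψ (Dm i j) * ψ (Dm i j))).re = 2 := by
  obtain ⟨e, e1, e2, e3, e4⟩ := exists_match hc hij hkl hik hil hjk hjl
  have hev : Even (Fintype.card ι) := by rw [hc]; simp
  have hqc := qc_of_four hψ hev (by omega)
  have en : ∀ a, e (a, 0) ≠ e (a, 1) := fun a h => by simpa using e.injective h
  have en' : ∀ a b s t, a ≠ b → e (a, s) ≠ e (b, t) := fun a b s t hab h =>
    hab (Prod.mk.inj (e.injective h)).1
  let a : Fin (r + 2) → Fin 3 → Matrix ι ι ℂ := fun j => fr ψ (e (j, 0)) (e (j, 1))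
  have anti : ∀ j i j' i', (j, i) ≠ (j', i') → a j i * a j' i' = -(a j' i' * a j i) := by
    intro j i j' i' hne
    by_cases hj : j = j'
    · subst hj
      exact fr_anti hqc (en j) i i' (fun h => hne (by rw [h]))
    · obtain ⟨m, hm⟩ := four hψ hev (en j) (en j') (en' _ _ _ _ hj) (en' _ _ _ _ hj) (en' _ _ _ _ hj) (en' _ _ _ _ hj)
      obtain ⟨X, hX, hX'⟩ := fr_sph (ψ := ψ) (en j) i
      obtain ⟨Y, hY, hY'⟩ := fr_sph (ψ := ψ) (en j') i'
      show fr ψ _ _ i * fr ψ _ _ i' = -(fr ψ _ _ i' * fr ψ _ _ i)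
      rw [hX', hY']
      exact eq_neg_of_add_eq_zero_left (hm X Y hX hY).2
  have hsq : ∀ j i, a j i * a j i = a j 0 * a j 0 := by
    intro j i
    obtain ⟨X, hX, hX'⟩ := fr_sph (ψ := ψ) (en j) i
    show fr ψ _ _ i * fr ψ _ _ i = _
    rw [hX']
    exact hqc _ _ _ _ (en j) hX (isSph_D (en j))
  have ha : ∀ j i, (a j i)ᴴ = a j i := by
    intro j i
    obtain ⟨X, hX, hX'⟩ := fr_sph (ψ := ψ) (en j) i
    show (fr ψ _ _ i)ᴴ = fr ψ _ _ i
    rw [hX', hψ.herm]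
  have hsum : ∑ j, a j 0 * a j 0 = 1 := by
    rw [← sum_sq_anti (fun j => a j 0) Finset.univ (fun i j h => anti _ _ _ _ (by simp [h]))]
    show (∑ j, ψ (Dm (e (j, 0)) (e (j, 1)))) * (∑ j, ψ (Dm (e (j, 0)) (e (j, 1)))) = 1
    rw [← map_sum]
    refine hψ.sq _ ?_ ?_ ?_
    · rw [Matrix.conjTranspose_sum]
      exact Finset.sum_congr rfl (fun j _ => (isSph_D (en j)).herm)
    · rw [Matrix.trace_sum]
      exact Finset.sum_eq_zero (fun j _ => (isSph_D (en j)).tr)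
    · rw [sum_sq_anti]
      · calc ∑ j, Dm (e (j, 0)) (e (j, 1)) * Dm (e (j, 0)) (e (j, 1))
            = ∑ j, ∑ t, Matrix.single (e (j, t)) (e (j, t)) (1 : ℂ) := by
              refine Finset.sum_congr rfl (fun j _ => ?_)
              rw [(isSph_D (en j)).sq, Fin.sum_univ_two, Pm]
          _ = ∑ x, Matrix.single (e x) (e x) (1 : ℂ) := by rw [Fintype.sum_prod_type]
          _ = ∑ i, Matrix.single i i (1 : ℂ) := Equiv.sum_comp e (fun i => Matrix.single i i (1 : ℂ))
          _ = 1 := Matrix.sum_single_one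
      · intro a b hab
        have z : ∀ a b, a ≠ b → Dm (e (a, 0)) (e (a, 1)) * Dm (e (b, 0)) (e (b, 1)) = 0 := fun a b hab =>
          zero_mul_of_supp (isSph_D (en a)).supp' (isSph_D (en b)).supp (Pm_mul_zero (en' _ _ _ _ hab)
            (en' _ _ _ _ hab) (en' _ _ _ _ hab) (en' _ _ _ _ hab))
        rw [z _ _ hab, z _ _ hab.symm, neg_zero]
  obtain ⟨r1, r2, r3⟩ := frame_main (a := a) (Q := fun j => a j 0 * a j 0) ha hsq anti (fun j h => by
    refine hgen _ _ (en j) (herm_sq_zero (hψ.herm _) ?_)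
    have h2 := hsq j 1
    rw [h] at h2
    exact h2) (by simp [hc]) hsum
  have f0 : a 0 0 = ψ (Dm i j) := by
    show ψ (Dm (e (0, 0)) (e (0, 1))) = _
    rw [e1, e2]
  have f1 : a 1 0 = ψ (Dm k l) := by
    show ψ (Dm (e (1, 0)) (e (1, 1))) = _
    rw [e3, e4]
  have q1 := r1 0 1 (by simp)
  have q2 := r2 0
  have q3 := r3 0
  simp only [f0, f1] at q1 q2 q3
  exact ⟨q1, q2, q3⟩

end Frame2

section Generic

variable {ι : Type} [Fintype ι] [DecidableEq ι]
variable {ψ : Matrix ι ι ℂ →ₗ[ℝ] Matrix ι ι ℂ}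

noncomputable def Ad (U : Matrix ι ι ℂ) : Matrix ι ι ℂ →ₗ[ℝ] Matrix ι ι ℂ where
  toFun X := U * X * Uᴴ
  map_add' X Y := by rw [mul_add, add_mul]
  map_smul' r X := by simp

lemma Ad_apply (U X : Matrix ι ι ℂ) : Ad U X = U * X * Uᴴ := rfl

lemma Ad_mul (U V : Matrix ι ι ℂ) : Ad (U * V) = Ad U ∘ₗ Ad V := by
  ext1 X
  simp only [LinearMap.comp_apply, Ad_apply, Matrix.conjTranspose_mul]
  noncomm_ring

lemma Good.comp_Ad (h : Good ψ) {U : Matrix ι ι ℂ} (hU : Uᴴ * U = 1) : Good (ψ ∘ₗ Ad U) := by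
  have hU' := mul_eq_one_comm.1 hU
  refine ⟨fun X => h.herm _, fun X => h.tr _, fun X h1 h2 h3 => h.sq _ ?_ ?_ ?_⟩
  · simp only [Ad_apply, Matrix.conjTranspose_mul, Matrix.conjTranspose_conjTranspose, h1, mul_assoc]
  · rw [Ad_apply, Matrix.trace_mul_comm, ← mul_assoc, hU, one_mul, h2]
  · rw [Ad_apply, show U * X * Uᴴ * (U * X * Uᴴ) = U * X * (Uᴴ * U) * X * Uᴴ by noncomm_ring, hU, mul_one,
      mul_assoc U, h3, mul_one, hU']

lemma Good.Ad_comp (h : Good ψ) {U : Matrix ι ι ℂ} (hU : Uᴴ * U = 1) : Good (Ad U ∘ₗ ψ) := by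
  have hU' := mul_eq_one_comm.1 hU
  refine ⟨fun X => ?_, fun X => ?_, fun X h1 h2 h3 => ?_⟩
  · simp only [LinearMap.comp_apply, Ad_apply, Matrix.conjTranspose_mul, Matrix.conjTranspose_conjTranspose, h.herm, mul_assoc]
  · rw [LinearMap.comp_apply, Ad_apply, Matrix.trace_mul_comm, ← mul_assoc, hU, one_mul, h.tr]
  · rw [LinearMap.comp_apply, Ad_apply, show ∀ Y, U * Y * Uᴴ * (U * Y * Uᴴ) = U * Y * (Uᴴ * U) * Y * Uᴴ from
      fun Y => by noncomm_ring, hU, mul_one, mul_assoc U, h.sq X h1 h2 h3, mul_one, hU']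

lemma Sm_decomp (i j : ι) (z : ℂ) : Sm i j z = z.re • Sm i j 1 + z.im • Sm i j Complex.I := by
  rw [← Sm_smul, ← Sm_smul, ← Sm_add]; congr 1
  simp [Complex.re_add_im]

lemma Sm_symm (i j : ι) (z : ℂ) : Sm i j z = Sm j i (star z) := by
  simp only [Sm, star_star]; abel

lemma herm_decomp (o : ι) (X : Matrix ι ι ℂ) (h1 : Xᴴ = X) (h2 : Matrix.trace X = 0) :
    X = ∑ i, (X i i).re • Dm i o + ∑ i, ∑ j, if i = j then 0 else (1/2 : ℝ) • Sm i j (X i j) := by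
  have hre : ∀ i, ((X i i).re : ℂ) = X i i := fun i => by
    have := congrFun (congrFun h1 i) i
    rw [Matrix.conjTranspose_apply] at this
    exact Complex.conj_eq_iff_re.1 this
  have h3 : ∑ i, (X i i).re • Dm i o = ∑ i, Matrix.single i i (X i i) := by
    have : ∀ i, (X i i).re • Dm i o = Matrix.single i i (X i i) - X i i • Matrix.single o o (1 : ℂ) := by
      intro i
      rw [← hre i]
      simp [Dm, smul_sub, Matrix.smul_single]
    simp_rw [this]
    rw [Finset.sum_sub_distrib, ← Finset.sum_smul]
    have : ∑ i, X i i = 0 := h2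
    rw [this]; simp
  have h4 : ∀ i j, (if i = j then 0 else (1/2 : ℝ) • Sm i j (X i j)) =
      (1/2 : ℝ) • (Matrix.single i j (X i j) + Matrix.single j i (X j i)) - 
      if i = j then Matrix.single i i (X i i) else 0 := by
    intro i j
    have := congrFun (congrFun h1 j) i
    rw [Matrix.conjTranspose_apply] at this
    by_cases hij : i = j
    · subst hij; simp only [if_true]; module
    · simp [hij, Sm, ← this]
  rw [h3]
  simp_rw [h4]
  simp only [Finset.sum_sub_distrib, ← Finset.smul_sum, Finset.sum_add_distrib, Finset.sum_ite_eq, Finset.mem_univ, if_true]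
  rw [Finset.sum_comm (f := fun i j => Matrix.single j i (X j i)), ← Matrix.matrix_eq_sum_single]
  module

lemma ext_lin {f g : Matrix ι ι ℂ →ₗ[ℝ] Matrix ι ι ℂ} (hD : ∀ i j, i ≠ j → f (Dm i j) = g (Dm i j))
    (hS : ∀ i j, i ≠ j → f (Sm i j 1) = g (Sm i j 1)) (hS' : ∀ i j, i ≠ j → f (Sm i j Complex.I) = g (Sm i j Complex.I))
    (X : Matrix ι ι ℂ) (h1 : Xᴴ = X) (h2 : Matrix.trace X = 0) : f X = g X := by
  rcases isEmpty_or_nonempty ι with h | ⟨⟨o⟩⟩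
  · rw [show X = 0 from Subsingleton.elim _ _, map_zero, map_zero]
  rw [herm_decomp o X h1 h2]
  simp only [map_add, map_sum]
  congr 1
  · refine Finset.sum_congr rfl (fun i _ => ?_)
    by_cases hi : i = o
    · subst hi; simp [Dm]
    · rw [map_smul, map_smul, hD i o hi]
  · refine Finset.sum_congr rfl (fun i _ => Finset.sum_congr rfl (fun j _ => ?_))
    by_cases hi : i = j
    · simp [hi]
    · rw [if_neg hi, Sm_decomp]
      simp only [map_smul, map_add, hS i j hi, hS' i j hi]

noncomputable def Rot (b c : ι) (x y : ℝ) : Matrix ι ι ℂ :=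
  1 + (x - 1) • (Matrix.single b b 1 + Matrix.single c c 1) + y • (Matrix.single c b 1 - Matrix.single b c 1)

lemma Rot_star (b c : ι) (x y : ℝ) : (Rot b c x y)ᴴ = Rot b c x (-y) := by
  simp [Rot, Matrix.conjTranspose_add, Matrix.conjTranspose_single]
  module

lemma Rot_mul {b c : ι} (hbc : b ≠ c) (x y : ℝ) (h : x ^ 2 + y ^ 2 = 1) : (Rot b c x y)ᴴ * Rot b c x y = 1 := by
  rw [Rot_star, Rot, Rot]
  simp only [add_mul, mul_add, sub_mul, mul_sub, one_mul, mul_one, smul_mul_assoc, mul_smul_comm,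
    Matrix.single_mul_single_same, Matrix.single_mul_single_of_ne _ _ _ _ hbc, Matrix.single_mul_single_of_ne _ _ _ _ hbc.symm]
  have h' : y * y = 1 - x * x := by linarith
  match_scalars <;> linarith

lemma Rot_S {a b c : ι} (hab : a ≠ b) (hac : a ≠ c) (hbc : b ≠ c) (x y : ℝ) :
    Ad (Rot b c x y) (Sm a b 1) = x • Sm a b 1 + y • Sm a c 1 := by
  rw [Ad_apply, Rot_star, Rot, Rot, Sm, Sm]
  simp only [add_mul, mul_add, sub_mul, mul_sub, one_mul, mul_one, smul_mul_assoc, mul_smul_comm, star_one,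
    Matrix.single_mul_single_same, Matrix.single_mul_single_of_ne _ _ _ _ hbc, Matrix.single_mul_single_of_ne _ _ _ _ hbc.symm,
    Matrix.single_mul_single_of_ne _ _ _ _ hab, Matrix.single_mul_single_of_ne _ _ _ _ hab.symm,
    Matrix.single_mul_single_of_ne _ _ _ _ hac, Matrix.single_mul_single_of_ne _ _ _ _ hac.symm, zero_mul]
  module

open Classical in
noncomputable def Np (χ : Matrix ι ι ℂ →ₗ[ℝ] Matrix ι ι ℂ) : Finset (ι × ι) :=
  Finset.univ.filter (fun p => χ (Sm p.1 p.2 1) ≠ 0)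

lemma improve (hψ : Good ψ) (hev : Even (Fintype.card ι)) (h4 : 4 ≤ Fintype.card ι)
    (hn : ∃ i j, i ≠ j ∧ ψ (Sm i j 1) = 0) :
    ∃ R : Matrix ι ι ℂ, Rᴴ * R = 1 ∧ (Np ψ).card < (Np (ψ ∘ₗ Ad R)).card := by
  have hqc := qc_of_four hψ hev h4
  have hsy : ∀ i j : ι, Sm i j 1 = Sm j i 1 := fun i j => by rw [Sm_symm, star_one]
  have key : ∃ a b c, a ≠ b ∧ a ≠ c ∧ b ≠ c ∧ ψ (Sm a b 1) = 0 ∧ ψ (Sm a c 1) ≠ 0 := by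
    by_contra hcon
    push Not at hcon
    obtain ⟨i, j, hij, h0⟩ := hn
    have H : ∀ a b c, a ≠ b → a ≠ c → ψ (Sm a b 1) = 0 → ψ (Sm a c 1) = 0 := by
      intro a b c h1 h2 h3
      by_cases h : b = c
      · rw [← h, h3]
      · exact hcon a b c h1 h2 h h3
    have all : ∀ a b, a ≠ b → ψ (Sm a b 1) = 0 := by
      intro a b hab
      by_cases ha : i = a
      · subst ha; exact H _ _ _ hij hab h0
      · refine H _ i _ (Ne.symm ha) hab ?_
        rw [hsy]; exact H _ _ _ hij ha h0
    obtain ⟨M, hM1, hM2, hM3, -⟩ := exists_signs (∅ : Finset ι) (by simpa using hev)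
    have hz : ψ M = (0 : Matrix ι ι ℂ →ₗ[ℝ] Matrix ι ι ℂ) M := by
      have hz' : ∀ a b X, a ≠ b → IsSph a b X → ψ X = 0 := by
        intro a b X hab hX
        refine herm_sq_zero (hψ.herm _) ?_
        rw [hqc a b X _ hab hX (isSph_S hab 1 (by simp)), all a b hab, mul_zero]
      refine ext_lin ?_ ?_ ?_ M hM1 hM2
      · intro a b hab; exact hz' a b _ hab (isSph_D hab)
      · intro a b hab; exact hz' a b _ hab (isSph_S hab 1 (by simp))
      · intro a b hab; exact hz' a b _ hab (isSph_S hab _ (by simp))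
    have h1 := hψ.sq M hM1 hM2 (by rw [hM3]; simp)
    rw [hz] at h1
    have h2 := congrFun (congrFun h1 i) i
    simp at h2
  obtain ⟨a, b, c, hab, hac, hbc, e1, e2⟩ := key
  have hcont : ∀ p : ι × ι, Continuous (fun t : ℝ => ψ (Ad (Rot b c (Real.cos t) (Real.sin t)) (Sm p.1 p.2 1))) := by
    intro p
    have hψc : Continuous ψ := LinearMap.continuous_of_finiteDimensional ψ
    refine hψc.comp ?_
    simp only [Ad_apply]
    have : Continuous (fun t : ℝ => Rot b c (Real.cos t) (Real.sin t)) := by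
      unfold Rot; fun_prop
    exact (this.mul continuous_const).mul this.matrix_conjTranspose
  have hev1 : ∀ p ∈ Np ψ, ∀ᶠ t in nhdsWithin (0 : ℝ) (Set.Ioi 0),
      ψ (Ad (Rot b c (Real.cos t) (Real.sin t)) (Sm p.1 p.2 1)) ≠ 0 := by
    intro p hp
    have hp' : ψ (Sm p.1 p.2 1) ≠ 0 := by simpa [Np] using hp
    refine ((hcont p).continuousAt.eventually_ne ?_).filter_mono nhdsWithin_le_nhds
    simpa [Rot, Ad_apply] using hp'
  have hev2 := (Filter.eventually_all_finset (Np ψ)).2 hev1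
  have hev3 : ∀ᶠ t in nhdsWithin (0 : ℝ) (Set.Ioi 0), t ∈ Set.Ioo 0 Real.pi := Ioo_mem_nhdsGT Real.pi_pos
  obtain ⟨t, ht1, ht2⟩ := (hev2.and hev3).exists
  refine ⟨Rot b c (Real.cos t) (Real.sin t), Rot_mul hbc _ _ (by rw [add_comm]; exact Real.sin_sq_add_cos_sq t), ?_⟩
  refine Finset.card_lt_card ⟨fun p hp => ?_, fun hsub => ?_⟩
  · simpa [Np] using ht1 p hp
  · have : (a, b) ∈ Np ψ := hsub (by
      simp only [Np, Finset.mem_filter, Finset.mem_univ, true_and, LinearMap.comp_apply]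
      rw [Rot_S hab hac hbc, map_add, map_smul, map_smul, e1, smul_zero, zero_add]
      exact smul_ne_zero (Real.sin_pos_of_pos_of_lt_pi ht2.1 ht2.2).ne' e2)
    simp [Np, e1] at this

lemma generic (hψ : Good ψ) (hev : Even (Fintype.card ι)) (h4 : 4 ≤ Fintype.card ι) :
    ∃ U : Matrix ι ι ℂ, Uᴴ * U = 1 ∧ ∀ i j, i ≠ j → (ψ ∘ₗ Ad U) (Sm i j 1) ≠ 0 := by
  by_contra hcon
  have : ∀ n : ℕ, ∃ U : Matrix ι ι ℂ, Uᴴ * U = 1 ∧ n ≤ (Np (ψ ∘ₗ Ad U)).card := by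
    intro n
    induction n with
    | zero => exact ⟨1, by simp, by simp⟩
    | succ n ih =>
      obtain ⟨U, hU, hn⟩ := ih
      have : ∃ i j, i ≠ j ∧ (ψ ∘ₗ Ad U) (Sm i j 1) = 0 := by
        by_contra h
        push Not at h
        exact hcon ⟨U, hU, h⟩
      obtain ⟨R, hR, hlt⟩ := improve (hψ.comp_Ad hU) hev h4 this
      refine ⟨U * R, ?_, ?_⟩
      · rw [Matrix.conjTranspose_mul, show Rᴴ * Uᴴ * (U * R) = Rᴴ * (Uᴴ * U) * R by noncomm_ring, hU, mul_one, hR]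
      · rw [Ad_mul, ← LinearMap.comp_assoc]; omega
  obtain ⟨U, -, h⟩ := this ((Finset.univ : Finset (ι × ι)).card + 1)
  have := Finset.card_le_univ (Np (ψ ∘ₗ Ad U))
  simp only [Finset.card_univ] at h
  omega

end Generic

section Proj

variable {ι : Type} [Fintype ι] [DecidableEq ι]
variable {ψ : Matrix ι ι ℂ →ₗ[ℝ] Matrix ι ι ℂ}

lemma exists_unit_vec (L : Matrix ι ι ℂ) (h1 : L * L = L) (h0 : L ≠ 0) :
    ∃ u : ι → ℂ, L *ᵥ u = u ∧ star u ⬝ᵥ u = 1 := by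
  obtain ⟨v, hv⟩ : ∃ v, L *ᵥ v ≠ 0 := by
    by_contra h
    push Not at h
    exact h0 (Matrix.ext_of_mulVec_single (fun i => by rw [h, Matrix.zero_mulVec]))
  have hs : star (L *ᵥ v) ⬝ᵥ (L *ᵥ v) = ((∑ i, Complex.normSq ((L *ᵥ v) i) : ℝ) : ℂ) := by
    simp only [dotProduct, Pi.star_apply, Complex.ofReal_sum]
    refine Finset.sum_congr rfl (fun i _ => ?_)
    rw [Complex.normSq_eq_conj_mul_self]; rfl
  set r := ∑ i, Complex.normSq ((L *ᵥ v) i) with hr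
  have hr0 : 0 < r := by
    refine lt_of_le_of_ne (Finset.sum_nonneg (fun i _ => Complex.normSq_nonneg _)) (fun h => hv ?_)
    have := (Finset.sum_eq_zero_iff_of_nonneg (fun i _ => Complex.normSq_nonneg ((L *ᵥ v) i))).1 h.symm
    ext i
    simpa using this i (Finset.mem_univ _)
  refine ⟨(((Real.sqrt r)⁻¹ : ℝ) : ℂ) • (L *ᵥ v), ?_, ?_⟩
  · rw [Matrix.mulVec_smul, Matrix.mulVec_mulVec, h1]
  · rw [star_smul, smul_dotProduct, dotProduct_smul, hs, Complex.star_def, Complex.conj_ofReal, smul_eq_mul, smul_eq_mul,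
      ← Complex.ofReal_mul, ← Complex.ofReal_mul]
    rw [show (Real.sqrt r)⁻¹ * ((Real.sqrt r)⁻¹ * r) = 1 by
      have : Real.sqrt r * Real.sqrt r = r := Real.mul_self_sqrt hr0.le
      have h' : Real.sqrt r ≠ 0 := (Real.sqrt_pos.2 hr0).ne'
      field_simp
      nlinarith]
    simp

lemma exists_V (L : ι → Matrix ι ι ℂ) (hh : ∀ i, (L i)ᴴ = L i) (hi : ∀ i, L i * L i = L i)
    (ho : ∀ i j, i ≠ j → L i * L j = 0) (h0 : ∀ i, L i ≠ 0) :
    ∃ V : Matrix ι ι ℂ, Vᴴ * V = 1 ∧ ∀ i, Vᴴ * L i * V = Matrix.single i i 1 := by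
  choose u hu hn using fun i => exists_unit_vec (L i) (hi i) (h0 i)
  have huo : ∀ i j, i ≠ j → L i *ᵥ u j = 0 := by
    intro i j hij
    rw [← hu j, Matrix.mulVec_mulVec, ho i j hij, Matrix.zero_mulVec]
  let V : Matrix ι ι ℂ := Matrix.of (fun a i => u i a)
  have hV : Vᴴ * V = 1 := by
    ext i j
    have e : (Vᴴ * V) i j = star (u i) ⬝ᵥ u j := rfl
    rw [e, Matrix.one_apply]
    split_ifs with h
    · subst h; exact hn i
    · rw [← hu i, Matrix.star_mulVec, ← Matrix.dotProduct_mulVec, hh, huo i j h, dotProduct_zero]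
  refine ⟨V, hV, fun i => ?_⟩
  have : L i * V = V * Matrix.single i i 1 := by
    ext a b
    have e : (L i * V) a b = (L i *ᵥ u b) a := rfl
    rw [e]
    by_cases hb : i = b
    · subst hb; rw [hu, Matrix.mul_single_apply_same, mul_one]; rfl
    · rw [huo i b hb, Matrix.mul_single_apply_of_ne _ _ _ _ _ (Ne.symm hb)]; rfl
  rw [mul_assoc, this, ← mul_assoc, hV, one_mul]

lemma pm_D {i j : ι} (hij : i ≠ j) {x : Matrix ι ι ℂ} (hh : xᴴ = x) (ht : Matrix.trace x = 0) (hs : x * x = Pm i j)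
    (hc : x * Matrix.single i i 1 = Matrix.single i i 1 * x) : x = Dm i j ∨ x = - Dm i j := by
  have hP : Pm i j * x = x := by
    have := herm_cancel (a := x) (B := Pm i j - 1) hh (by
      rw [hs, sub_mul, one_mul, ← (isSph_D hij).sq, ← mul_assoc, (isSph_D hij).sq, (isSph_D hij).supp, (isSph_D hij).sq, sub_self])
    rwa [sub_mul, one_mul, sub_eq_zero] at this
  have hP' : x * Pm i j = x := by
    have := congrArg Matrix.conjTranspose hP
    rwa [Matrix.conjTranspose_mul, hh, Pm_herm] at this
  have hcj : x * Matrix.single j j 1 = Matrix.single j j 1 * x := by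
    have : Matrix.single j j (1:ℂ) = Pm i j - Matrix.single i i 1 := by rw [Pm]; abel
    rw [this, mul_sub, sub_mul, hP, hP', hc]
  have e1 : x = Matrix.single i i (x i i) + Matrix.single j j (x j j) := by
    have a1 : ∀ a, Matrix.single a a (1:ℂ) * x * Matrix.single a a 1 = Matrix.single a a (x a a) := by
      intro a; rw [Matrix.single_mul_mul_single]; simp
    calc x = x * Pm i j := hP'.symm
      _ = x * (Matrix.single i i 1 * Matrix.single i i 1) + x * (Matrix.single j j 1 * Matrix.single j j 1) := by
        rw [Pm, mul_add, Matrix.single_mul_single_same, Matrix.single_mul_single_same, mul_one]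
      _ = _ := by rw [← mul_assoc, ← mul_assoc, hc, hcj, a1, a1]
  have e2 : x j j = - x i i := by
    rw [e1, Matrix.trace_add, Matrix.trace_single_eq_same, Matrix.trace_single_eq_same] at ht
    linear_combination ht
  have e3 : x i i * x i i = 1 := by
    have := congrFun (congrFun hs i) i
    rw [e1] at this
    simpa [add_mul, mul_add, Pm, hij, hij.symm] using this
  have e4 : x i i = 1 ∨ x i i = -1 := mul_self_eq_one_iff.1 e3
  rw [e2] at e1
  rcases e4 with h | h <;> rw [h] at e1
  · left; rw [e1, Dm, ← Matrix.single_neg]; abel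
  · right; rw [e1, Dm, ← Matrix.single_neg, neg_neg]; abel

lemma Dm_symm (i j : ι) : Dm j i = -Dm i j := by simp [Dm]
lemma Dm_trans (i j k : ι) : Dm i k = Dm i j + Dm j k := by simp [Dm]

lemma exists_third (h4 : 4 ≤ Fintype.card ι) (i j k : ι) : ∃ l, i ≠ l ∧ j ≠ l ∧ k ≠ l := by
  have h1 : 0 < (({i, j, k} : Finset ι)ᶜ).card := by
    rw [Finset.card_compl]
    have := Finset.card_le_three (a := i) (b := j) (c := k)
    omega
  obtain ⟨l, hl⟩ := Finset.card_pos.1 h1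
  simp only [Finset.mem_compl, Finset.mem_insert, Finset.mem_singleton, not_or] at hl
  exact ⟨l, Ne.symm hl.1, Ne.symm hl.2.1, Ne.symm hl.2.2⟩

lemma exists_L (hψ : Good ψ) {r : ℕ} (hc : Fintype.card ι = 2 * (r + 2))
    (hgen : ∀ i j, i ≠ j → ψ (Sm i j 1) ≠ 0) :
    ∃ L : ι → Matrix ι ι ℂ, (∀ i j k, i ≠ j → i ≠ k → j ≠ k → ψ (Dm i j) * ψ (Dm i k) = L i) ∧
      (∀ i j, i ≠ j → ψ (Dm i j) * ψ (Dm i j) = L i + L j) ∧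
      (∀ i, (L i)ᴴ = L i) ∧ (∀ i, L i * L i = L i) ∧ (∀ i j, i ≠ j → L i * L j = 0) ∧ (∀ i, L i ≠ 0) := by
  have h4 : 4 ≤ Fintype.card ι := by omega
  have z : ∀ i j k l, i ≠ j → k ≠ l → i ≠ k → i ≠ l → j ≠ k → j ≠ l → ψ (Dm i j) * ψ (Dm k l) = 0 := by
    intro i j k l hij hkl hik hil hjk hjl
    have h1 := (frame_rel hψ hc hgen hkl hij hik.symm hjk.symm hil.symm hjl.symm).1
    have h2 := herm_cancel (hψ.herm _) h1
    have h3 := congrArg Matrix.conjTranspose h2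
    rw [Matrix.conjTranspose_mul, Matrix.conjTranspose_mul, hψ.herm, hψ.herm, Matrix.conjTranspose_zero] at h3
    exact herm_cancel (hψ.herm _) h3
  have m1 : ∀ i j k l, i ≠ j → i ≠ k → i ≠ l → j ≠ k → j ≠ l → k ≠ l →
      ψ (Dm i j) * ψ (Dm i k) = ψ (Dm i j) * ψ (Dm i l) := by
    intro i j k l hij hik hil hjk hjl hkl
    rw [Dm_trans i k l, map_add, mul_add, z i j k l hij hkl hik hil hjk hjl, add_zero]
  have m2 : ∀ i j k l, i ≠ j → i ≠ k → i ≠ l → j ≠ k → j ≠ l → k ≠ l →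
      ψ (Dm i k) * ψ (Dm i j) = ψ (Dm i l) * ψ (Dm i j) := by
    intro i j k l hij hik hil hjk hjl hkl
    rw [Dm_trans i k l, map_add, add_mul, z k l i j hkl hij hik.symm hjk.symm hil.symm hjl.symm, add_zero]
  have cm : ∀ i j k, i ≠ j → i ≠ k → j ≠ k → ψ (Dm i j) * ψ (Dm i k) = ψ (Dm i k) * ψ (Dm i j) := by
    intro i j k hij hik hjk
    obtain ⟨l, hil, hjl, hkl⟩ := exists_third h4 i j k
    rw [m2 i k j l hik hij hil hjk.symm hkl hjl, m1 i l k j hil hik hij hkl.symm hjl.symm hjk.symm,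
      m2 i j l k hij hil hik hjl hjk hkl.symm]
  have m1' : ∀ i j k l, i ≠ j → i ≠ k → i ≠ l → j ≠ k → j ≠ l →
      ψ (Dm i j) * ψ (Dm i k) = ψ (Dm i j) * ψ (Dm i l) := by
    intro i j k l hij hik hil hjk hjl
    by_cases hkl : k = l
    · rw [hkl]
    · exact m1 i j k l hij hik hil hjk hjl hkl
  have all : ∀ i j k j' k', i ≠ j → i ≠ k → j ≠ k → i ≠ j' → i ≠ k' → j' ≠ k' →
      ψ (Dm i j) * ψ (Dm i k) = ψ (Dm i j') * ψ (Dm i k') := by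
    intro i j k j' k' hij hik hjk hij' hik' hjk'
    by_cases h : j' = k
    · subst h
      rw [cm i j j' hij hij' hjk]
      exact m1' i j' j k' hij' hij hik' hjk.symm hjk'
    · rw [cm i j k hij hik hjk, m1' i k j j' hik hij hij' hjk.symm (Ne.symm h), cm i k j' hik hij' (Ne.symm h)]
      exact m1' i j' k k' hij' hik hik' h hjk'
  have hp : ∀ i : ι, ∃ p : ι × ι, i ≠ p.1 ∧ i ≠ p.2 ∧ p.1 ≠ p.2 := by
    intro i
    obtain ⟨k, l, hkl, hik, hil, -, -⟩ := exists_two_more h4 i i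
    exact ⟨(k, l), hik, hil, hkl⟩
  choose p hp1 hp2 hp3 using hp
  have hL : ∀ i j k, i ≠ j → i ≠ k → j ≠ k → ψ (Dm i j) * ψ (Dm i k) = ψ (Dm i (p i).1) * ψ (Dm i (p i).2) :=
    fun i j k a b c => all i j k _ _ a b c (hp1 i) (hp2 i) (hp3 i)
  generalize hLdef : (fun i => ψ (Dm i (p i).1) * ψ (Dm i (p i).2)) = L at *
  replace hL : ∀ i j k, i ≠ j → i ≠ k → j ≠ k → ψ (Dm i j) * ψ (Dm i k) = L i := by
    intro i j k a b c; rw [hL i j k a b c, ← hLdef]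
  have hQ : ∀ i j, i ≠ j → ψ (Dm i j) * ψ (Dm i j) = L i + L j := by
    intro i j hij
    obtain ⟨k, -, -, hik, -, hjk, -⟩ := exists_two_more h4 i j
    rw [← hL i j k hij hik hjk, ← hL j i k hij.symm hjk hik]
    conv_lhs => rw [show ψ (Dm i j) * ψ (Dm i j) = ψ (Dm i j) * ψ (Dm i k) + ψ (Dm i j) * ψ (Dm k j) by
      rw [← mul_add, ← map_add, ← Dm_trans]]
    rw [Dm_symm i j, Dm_symm k j]
    congr 1
    simp only [map_neg, neg_mul, mul_neg]
    rw [Dm_symm j k]; simp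
  have ho : ∀ i j, i ≠ j → L i * L j = 0 := by
    intro i j hij
    obtain ⟨k, l, hkl, hik, hil, hjk, hjl⟩ := exists_two_more h4 i j
    rw [← hL i j k hij hik hjk, ← hL j l i hjl hij.symm hil.symm,
      show ψ (Dm i j) * ψ (Dm i k) * (ψ (Dm j l) * ψ (Dm j i)) = ψ (Dm i j) * (ψ (Dm i k) * ψ (Dm j l)) * ψ (Dm j i) by noncomm_ring,
      z i k j l hik hjl hij hil hjk.symm hkl, mul_zero, zero_mul]
  have hid : ∀ i j, i ≠ j → L i * L i - L i = -(L j * L j - L j) := by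
    intro i j hij
    obtain ⟨k, l, hkl, hik, hil, hjk, hjl⟩ := exists_two_more h4 i j
    have := (frame_rel hψ hc hgen hij hkl hik hil hjk hjl).2.1
    rw [hQ i j hij, add_mul, mul_add, mul_add, ho i j hij, ho j i hij.symm] at this
    linear_combination (norm := module) this
  have htr : ∀ i j, i ≠ j → (Matrix.trace (L i)).re = 2 - (Matrix.trace (L j)).re := by
    intro i j hij
    obtain ⟨k, l, hkl, hik, hil, hjk, hjl⟩ := exists_two_more h4 i j
    have := (frame_rel hψ hc hgen hij hkl hik hil hjk hjl).2.2
    rw [hQ i j hij, Matrix.trace_add, Complex.add_re] at this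
    linarith
  refine ⟨L, hL, hQ, ?_, ?_, ho, ?_⟩
  · intro i
    obtain ⟨j, k, hjk, hij, hik, -, -⟩ := exists_two_more h4 i i
    rw [← hL i j k hij hik hjk, Matrix.conjTranspose_mul, hψ.herm, hψ.herm, cm i j k hij hik hjk]
  · intro i
    obtain ⟨j, k, hjk, hij, hik, -, -⟩ := exists_two_more h4 i i
    have e1 := hid i j hij
    have e2 := hid i k hik
    have e3 := hid j k hjk
    rw [← sub_eq_zero]
    linear_combination (norm := module) (1/2 : ℝ) • e1 + (1/2 : ℝ) • e2 - (1/2 : ℝ) • e3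
  · intro i h0
    obtain ⟨j, k, hjk, hij, hik, -, -⟩ := exists_two_more h4 i i
    have e1 := htr i j hij
    have e2 := htr i k hik
    have e3 := htr j k hjk
    rw [h0, Matrix.trace_zero, Complex.zero_re] at e1 e2
    linarith

lemma Dm_mul {i j k : ι} (hij : i ≠ j) (hik : i ≠ k) (hjk : j ≠ k) : Dm i j * Dm i k = Matrix.single i i 1 := by
  simp [Dm, mul_sub, sub_mul, hij, hik, hjk, hij.symm]

lemma Good.smul (h : Good ψ) {s : ℝ} (hs : s = 1 ∨ s = -1) : Good (s • ψ) := by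
  rcases hs with rfl | rfl
  · simpa using h
  · refine ⟨fun X => ?_, fun X => ?_, fun X h1 h2 h3 => ?_⟩
    · simp [h.herm]
    · simp [h.tr]
    · simp [h.sq X h1 h2 h3]

/-- diagonal stage -/
lemma diag_stage (hψ : Good ψ) {r : ℕ} (hc : Fintype.card ι = 2 * (r + 2)) :
    ∃ (U V : Matrix ι ι ℂ) (s : ℝ), Uᴴ * U = 1 ∧ Vᴴ * V = 1 ∧ (s = 1 ∨ s = -1) ∧
      Good (s • (Ad Vᴴ ∘ₗ ψ ∘ₗ Ad U)) ∧ ∀ i j, i ≠ j → (s • (Ad Vᴴ ∘ₗ ψ ∘ₗ Ad U)) (Dm i j) = Dm i j := by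
  have h4 : 4 ≤ Fintype.card ι := by omega
  obtain ⟨U, hU, hgen⟩ := generic hψ (by rw [hc]; simp) h4
  have hg1 := hψ.comp_Ad hU
  obtain ⟨L, hL1, hL2, hL3, hL4, hL5, hL6⟩ := exists_L hg1 hc hgen
  obtain ⟨V, hV, hV2⟩ := exists_V L hL3 hL4 hL5 hL6
  have hV' := mul_eq_one_comm.1 hV
  have hg2 : Good (Ad Vᴴ ∘ₗ ψ ∘ₗ Ad U) := hg1.Ad_comp (by rw [Matrix.conjTranspose_conjTranspose]; exact hV')
  set χ := Ad Vᴴ ∘ₗ ψ ∘ₗ Ad U with hχ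
  have hmul : ∀ X Y, χ X * χ Y = Vᴴ * ((ψ ∘ₗ Ad U) X * (ψ ∘ₗ Ad U) Y) * V := by
    intro X Y
    show Ad Vᴴ ((ψ ∘ₗ Ad U) X) * Ad Vᴴ ((ψ ∘ₗ Ad U) Y) = _
    rw [Ad_apply, Ad_apply, Matrix.conjTranspose_conjTranspose]
    generalize (ψ ∘ₗ Ad U) X = x
    generalize (ψ ∘ₗ Ad U) Y = y
    rw [show Vᴴ * x * V * (Vᴴ * y * V) = Vᴴ * x * (V * Vᴴ) * y * V by noncomm_ring, hV', mul_one, mul_assoc Vᴴ]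
  have x1 : ∀ i j k, i ≠ j → i ≠ k → j ≠ k → χ (Dm i j) * χ (Dm i k) = Matrix.single i i 1 := by
    intro i j k a b c
    rw [hmul, hL1 i j k a b c, hV2]
  have x2 : ∀ i j, i ≠ j → χ (Dm i j) * χ (Dm i j) = Pm i j := by
    intro i j a
    rw [hmul, hL2 i j a, mul_add, add_mul, hV2, hV2, Pm]
  have x3 : ∀ i j, i ≠ j → ∃ s : ℝ, (s = 1 ∨ s = -1) ∧ χ (Dm i j) = s • Dm i j := by
    intro i j hij
    obtain ⟨k, -, -, hik, -, hjk, -⟩ := exists_two_more h4 i j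
    rcases pm_D hij (hg2.herm _) (hg2.tr _) (x2 i j hij) (by
      conv_lhs => rw [← x1 i k j hik hij hjk.symm]
      rw [← x1 i j k hij hik hjk, mul_assoc]) with h | h
    · exact ⟨1, Or.inl rfl, by rw [h, one_smul]⟩
    · exact ⟨-1, Or.inr rfl, by rw [h]; simp⟩
  have pr : ∀ (s : ℝ) i j k, (s = 1 ∨ s = -1) → i ≠ j → i ≠ k → χ (Dm i j) = s • Dm i j → χ (Dm i k) = s • Dm i k := by
    intro s i j k hs hij hik h
    by_cases hjk : j = k
    · rw [← hjk, h]
    obtain ⟨t, ht, h'⟩ := x3 i k hik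
    have := x1 i j k hij hik hjk
    rw [h, h', smul_mul_assoc, mul_smul_comm, Dm_mul hij hik hjk] at this
    have := congrFun (congrFun this i) i
    simp at this
    have h2 : s * t = 1 := by exact_mod_cast this
    rw [h']
    congr 1
    rcases hs with rfl | rfl <;> rcases ht with rfl | rfl <;> linarith
  have sy : ∀ (s : ℝ) i j, χ (Dm i j) = s • Dm i j → χ (Dm j i) = s • Dm j i := by
    intro s i j h
    rw [Dm_symm i j, map_neg, h, smul_neg]
  obtain ⟨o⟩ : Nonempty ι := Fintype.card_pos_iff.1 (by omega)
  obtain ⟨q, -, -, hoq, -⟩ := exists_two_more h4 o o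
  obtain ⟨s, hs, hso⟩ := x3 o q hoq
  refine ⟨U, V, s, hU, hV, hs, hg2.smul hs, fun i j hij => ?_⟩
  have hij2 : χ (Dm i j) = s • Dm i j := by
    by_cases hi : o = i
    · subst hi; exact pr s o q j hs hoq hij hso
    · exact pr s i o j hs (Ne.symm hi) hij (sy s o i (pr s o q i hs hoq hi hso))
  rw [LinearMap.smul_apply, hij2, smul_smul]
  rcases hs with rfl | rfl <;> norm_num

/-- diagonal stage, size two -/
lemma diag_stage_two (hψ : Good ψ) (hc : Fintype.card ι = 2) :
    ∃ (U V : Matrix ι ι ℂ) (s : ℝ), Uᴴ * U = 1 ∧ Vᴴ * V = 1 ∧ (s = 1 ∨ s = -1) ∧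
      Good (s • (Ad Vᴴ ∘ₗ ψ ∘ₗ Ad U)) ∧ ∀ i j, i ≠ j → (s • (Ad Vᴴ ∘ₗ ψ ∘ₗ Ad U)) (Dm i j) = Dm i j := by
  obtain ⟨p, q, hpq, huniv⟩ := Finset.card_eq_two.1 (show (Finset.univ : Finset ι).card = 2 from hc)
  have hP : Pm p q = (1 : Matrix ι ι ℂ) := by
    rw [← Matrix.sum_single_one, huniv, Finset.sum_pair hpq, Pm]
  have two : ∀ i, i = p ∨ i = q := by
    intro i
    have := Finset.mem_univ i
    rw [huniv] at this
    simpa using this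
  have hsq := hψ.sq (Dm p q) (isSph_D hpq).herm (isSph_D hpq).tr ((isSph_D hpq).sq.trans hP)
  have htr := hψ.tr (Dm p q)
  have hhe := hψ.herm (Dm p q)
  have hψ1 : Ad (1 : Matrix ι ι ℂ) = LinearMap.id := by ext1 X; simp [Ad_apply]
  set x := ψ (Dm p q) with hx
  have h1n : (1 : Matrix ι ι ℂ) ≠ 0 := by
    intro h
    have := congrFun (congrFun h p) p
    simp at this
  have hxr : ∀ r : ℝ, x ≠ r • 1 := by
    intro r h
    rw [h, Matrix.trace_smul, Matrix.trace_one, hc] at htr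
    have hr : r = 0 := by simpa using htr
    rw [h, hr] at hsq
    simp at hsq
    exact h1n hsq.symm
  let L : ι → Matrix ι ι ℂ := fun i => if i = p then (1/2 : ℝ) • (1 + x) else (1/2 : ℝ) • (1 - x)
  have Lp : L p = (1/2 : ℝ) • (1 + x) := if_pos rfl
  have Lq : L q = (1/2 : ℝ) • (1 - x) := if_neg hpq.symm
  obtain ⟨V, hV, hV2⟩ := exists_V L (by
      intro i; rcases two i with rfl | rfl
      · rw [Lp]; simp [hhe]
      · rw [Lq]; simp [hhe]) (by
      intro i; rcases two i with rfl | rfl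
      · rw [Lp]; simp only [smul_mul_assoc, mul_smul_comm, add_mul, mul_add, one_mul, mul_one, hsq]; module
      · rw [Lq]; simp only [smul_mul_assoc, mul_smul_comm, sub_mul, mul_sub, one_mul, mul_one, hsq]; module) (by
      intro i j hij
      rcases two i with rfl | rfl <;> rcases two j with rfl | rfl
      · exact absurd rfl hij
      · rw [Lp, Lq]; simp only [smul_mul_assoc, mul_smul_comm, add_mul, mul_sub, one_mul, mul_one, hsq]; module
      · rw [Lp, Lq]; simp only [smul_mul_assoc, mul_smul_comm, sub_mul, mul_add, one_mul, mul_one, hsq]; module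
      · exact absurd rfl hij) (by
      intro i h; rcases two i with rfl | rfl
      · rw [Lp] at h
        refine hxr (-1) ?_
        linear_combination (norm := module) (2 : ℝ) • h
      · rw [Lq] at h
        refine hxr 1 ?_
        linear_combination (norm := module) (-2 : ℝ) • h)
  have hV' := mul_eq_one_comm.1 hV
  have hg2 : Good (Ad Vᴴ ∘ₗ ψ ∘ₗ Ad (1 : Matrix ι ι ℂ)) := by
    rw [hψ1, LinearMap.comp_id]
    exact hψ.Ad_comp (by rw [Matrix.conjTranspose_conjTranspose]; exact hV')
  refine ⟨1, V, 1, by simp, hV, Or.inl rfl, hg2.smul (Or.inl rfl), ?_⟩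
  rw [hψ1, LinearMap.comp_id, one_smul]
  have main : Vᴴ * x * V = Dm p q := by
    have : x = L p - L q := by rw [Lp, Lq]; module
    rw [this, mul_sub, sub_mul, hV2, hV2, Dm]
  have main' : (Ad Vᴴ ∘ₗ ψ) (Dm p q) = Dm p q := by
    rw [LinearMap.comp_apply, Ad_apply, Matrix.conjTranspose_conjTranspose]; exact main
  intro i j hij
  rcases two i with rfl | rfl <;> rcases two j with rfl | rfl
  · exact absurd rfl hij
  · exact main'
  · rw [Dm_symm, map_neg, main']
  · exact absurd rfl hij

end Proj

section Off

variable {ι : Type} [Fintype ι] [DecidableEq ι]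
variable {χ : Matrix ι ι ℂ →ₗ[ℝ] Matrix ι ι ℂ}

lemma Sm_apply {i j : ι} (hij : i ≠ j) (z : ℂ) : Sm i j z i j = z := by
  simp [Sm, hij, hij.symm]

lemma off_unit (hg : Good χ) (hq : QC χ) (hD : ∀ i j, i ≠ j → χ (Dm i j) = Dm i j) {i j : ι} (hij : i ≠ j)
    (z : ℂ) (hz : Complex.normSq z = 1) :
    χ (Sm i j z) = Sm i j (χ (Sm i j z) i j) ∧ χ (Sm i j z) i j * star (χ (Sm i j z) i j) = 1 := by
  have h1 : χ (Sm i j z) * χ (Sm i j z) = Pm i j := by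
    rw [hq i j _ _ hij (isSph_S hij z hz) (isSph_D hij), hD i j hij, (isSph_D hij).sq]
  have h2 := hq.anti_DS hij z hz
  rw [hD i j hij] at h2
  have h3 := hg.herm (Sm i j z)
  generalize χ (Sm i j z) = N at *
  have hP : Pm i j * N = N := by
    have := herm_cancel (a := N) (B := Pm i j - 1) h3 (by
      rw [h1, sub_mul, one_mul, ← (isSph_D hij).sq, ← mul_assoc, (isSph_D hij).sq, (isSph_D hij).supp, (isSph_D hij).sq, sub_self])
    rwa [sub_mul, one_mul, sub_eq_zero] at this
  have hP' : N * Pm i j = N := by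
    have := congrArg Matrix.conjTranspose hP
    rwa [Matrix.conjTranspose_mul, h3, Pm_herm] at this
  have a1 : ∀ a b, Matrix.single a a (1:ℂ) * N * Matrix.single b b 1 = Matrix.single a b (N a b) := by
    intro a b; rw [Matrix.single_mul_mul_single]; simp
  have e0 : N = Matrix.single i i (N i i) + Matrix.single i j (N i j) + Matrix.single j i (N j i) + Matrix.single j j (N j j) := by
    calc N = Pm i j * N * Pm i j := by rw [hP, hP']
      _ = _ := by rw [Pm]; simp only [add_mul, mul_add, a1]; abel
  have hii : N i i = 0 := by
    have := congrFun (congrFun h2 i) i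
    rw [e0] at this
    simp [Dm, add_mul, mul_add, sub_mul, mul_sub, hij, hij.symm] at this
    exact this
  have hjj : N j j = 0 := by
    have := congrFun (congrFun h2 j) j
    rw [e0] at this
    simp [Dm, add_mul, mul_add, sub_mul, mul_sub, hij, hij.symm] at this
    exact this
  have hji : N j i = star (N i j) := by
    have := congrFun (congrFun h3 j) i
    rw [Matrix.conjTranspose_apply] at this
    exact this.symm
  rw [hii, hjj, hji] at e0
  have e1 : N = Sm i j (N i j) := by rw [Sm]; simpa using e0
  refine ⟨e1, ?_⟩
  have := congrFun (congrFun h1 i) i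
  rw [e1] at this
  simpa [Sm, Pm, add_mul, mul_add, hij, hij.symm] using this

lemma Rot_S' {a b c : ι} (hab : a ≠ b) (hac : a ≠ c) (hbc : b ≠ c) (x y : ℝ) :
    Ad (Rot b c x y) (Sm a c 1) = -y • Sm a b 1 + x • Sm a c 1 := by
  rw [Ad_apply, Rot_star, Rot, Rot, Sm, Sm]
  simp only [add_mul, mul_add, sub_mul, mul_sub, one_mul, mul_one, smul_mul_assoc, mul_smul_comm, star_one,
    Matrix.single_mul_single_same, Matrix.single_mul_single_of_ne _ _ _ _ hbc, Matrix.single_mul_single_of_ne _ _ _ _ hbc.symm,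
    Matrix.single_mul_single_of_ne _ _ _ _ hab, Matrix.single_mul_single_of_ne _ _ _ _ hab.symm,
    Matrix.single_mul_single_of_ne _ _ _ _ hac, Matrix.single_mul_single_of_ne _ _ _ _ hac.symm, zero_mul]
  module

lemma Rot_D {a b c : ι} (hab : a ≠ b) (hac : a ≠ c) (hbc : b ≠ c) (x y : ℝ) (h : x ^ 2 + y ^ 2 = 1) :
    Ad (Rot b c x y) (Dm b a) = x ^ 2 • Dm b a + y ^ 2 • Dm c a + (x * y) • Sm b c 1 := by
  rw [Ad_apply, Rot_star, Rot, Rot, Sm, Dm, Dm]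
  simp only [add_mul, mul_add, sub_mul, mul_sub, one_mul, mul_one, smul_mul_assoc, mul_smul_comm, star_one,
    Matrix.single_mul_single_same, Matrix.single_mul_single_of_ne _ _ _ _ hbc, Matrix.single_mul_single_of_ne _ _ _ _ hbc.symm,
    Matrix.single_mul_single_of_ne _ _ _ _ hab, Matrix.single_mul_single_of_ne _ _ _ _ hab.symm,
    Matrix.single_mul_single_of_ne _ _ _ _ hac, Matrix.single_mul_single_of_ne _ _ _ _ hac.symm, zero_mul]
  match_scalars <;> linarith

lemma Rot_D' {a b c : ι} (hab : a ≠ b) (hac : a ≠ c) (hbc : b ≠ c) (x y : ℝ) (h : x ^ 2 + y ^ 2 = 1) :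
    Ad (Rot b c x y) (Dm c a) = y ^ 2 • Dm b a + x ^ 2 • Dm c a - (x * y) • Sm b c 1 := by
  rw [Ad_apply, Rot_star, Rot, Rot, Sm, Dm, Dm]
  simp only [add_mul, mul_add, sub_mul, mul_sub, one_mul, mul_one, smul_mul_assoc, mul_smul_comm, star_one,
    Matrix.single_mul_single_same, Matrix.single_mul_single_of_ne _ _ _ _ hbc, Matrix.single_mul_single_of_ne _ _ _ _ hbc.symm,
    Matrix.single_mul_single_of_ne _ _ _ _ hab, Matrix.single_mul_single_of_ne _ _ _ _ hab.symm,
    Matrix.single_mul_single_of_ne _ _ _ _ hac, Matrix.single_mul_single_of_ne _ _ _ _ hac.symm, zero_mul]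
  match_scalars <;> linarith

/-- triangle relation -/
lemma triangle (hg : Good χ) (hev : Even (Fintype.card ι)) (h4 : 4 ≤ Fintype.card ι) {a b c : ι}
    (hab : a ≠ b) (hac : a ≠ c) (hbc : b ≠ c) :
    χ (Sm a b 1) * χ (Sm a c 1) + χ (Sm a c 1) * χ (Sm a b 1) =
      χ (Sm b c 1) * χ (Dm b a) + χ (Dm b a) * χ (Sm b c 1) := by
  have hsym : ∀ i j : ι, Sm i j 1 = Sm j i 1 := fun i j => by rw [Sm_symm, star_one]
  have hxy : ((3/5 : ℝ)) ^ 2 + (4/5 : ℝ) ^ 2 = 1 := by norm_num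
  have hg' := hg.comp_Ad (Rot_mul hbc _ _ hxy)
  have hq := qc_of_four hg hev h4
  have hq' := qc_of_four hg' hev h4
  have sS : ∀ {i j : ι}, i ≠ j → IsSph i j (Sm i j 1) := fun h => isSph_S h 1 (by simp)
  have A1 := hq b a _ _ hab.symm (sS hab.symm) (isSph_D hab.symm)
  have A2 := hq c a _ _ hac.symm (sS hac.symm) (isSph_D hac.symm)
  have B1 := hq' b a _ _ hab.symm (sS hab.symm) (isSph_D hab.symm)
  have B2 := hq' c a _ _ hac.symm (sS hac.symm) (isSph_D hac.symm)
  have C := hq.anti_DS hbc 1 (by simp)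
  rw [show Dm b c = Dm b a - Dm c a by simp [Dm]] at C
  rw [hsym b a] at A1 B1
  rw [hsym c a] at A2 B2
  simp only [LinearMap.comp_apply, Rot_S hab hac hbc, Rot_S' hab hac hbc, Rot_D hab hac hbc _ _ hxy,
    Rot_D' hab hac hbc _ _ hxy, map_add, map_smul, map_sub, add_mul, mul_add, sub_mul, mul_sub, smul_mul_assoc,
    mul_smul_comm] at B1 B2 C
  generalize χ (Sm a b 1) = p at *
  generalize χ (Sm a c 1) = q at *
  generalize χ (Sm b c 1) = σ at *
  generalize χ (Dm b a) = d at *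
  generalize χ (Dm c a) = e at *
  linear_combination (norm := module) (25/24 : ℝ) • B1 - (25/24 : ℝ) • B2 + (7/24 : ℝ) • A1 - (7/24 : ℝ) • A2 - (1/2 : ℝ) • C

lemma Ad_diag_S (t : ι → ℂ) (i j : ι) (z : ℂ) :
    Ad (Matrix.diagonal t) (Sm i j z) = Sm i j (t i * z * star (t j)) := by
  rw [Ad_apply, Matrix.diagonal_conjTranspose, Sm, Sm, mul_add, add_mul]
  congr 1
  · ext a b
    rw [Matrix.mul_diagonal, Matrix.diagonal_mul, Matrix.single_apply, Matrix.single_apply]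
    split_ifs with h
    · rw [← h.1, ← h.2]; rfl
    · simp
  · ext a b
    rw [Matrix.mul_diagonal, Matrix.diagonal_mul, Matrix.single_apply, Matrix.single_apply]
    split_ifs with h
    · rw [← h.1, ← h.2]; simp only [Pi.star_apply, star_mul', star_star]; ring
    · simp

lemma Ad_diag_D (t : ι → ℂ) (ht : ∀ i, t i * star (t i) = 1) (i j : ι) :
    Ad (Matrix.diagonal t) (Dm i j) = Dm i j := by
  rw [Ad_apply, Matrix.diagonal_conjTranspose, Dm, mul_sub, sub_mul]
  have : ∀ i, Matrix.diagonal t * Matrix.single i i 1 * Matrix.diagonal (star t) = Matrix.single i i 1 := by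
    intro i
    ext a b
    rw [Matrix.mul_diagonal, Matrix.diagonal_mul, Matrix.single_apply]
    split_ifs with h
    · rw [← h.1, ← h.2, mul_one]; exact ht i
    · simp
  rw [this, this]

lemma diag_unitary (t : ι → ℂ) (ht : ∀ i, t i * star (t i) = 1) : (Matrix.diagonal t)ᴴ * Matrix.diagonal t = 1 := by
  rw [Matrix.diagonal_conjTranspose, Matrix.diagonal_mul_diagonal, ← Matrix.diagonal_one]
  congr 1; ext i; rw [mul_comm]; exact ht i

noncomputable def fo (χ : Matrix ι ι ℂ →ₗ[ℝ] Matrix ι ι ℂ) (i j : ι) (z : ℂ) : ℂ := χ (Sm i j z) i j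

lemma fo_mul (hg : Good χ) (hev : Even (Fintype.card ι)) (h4 : 4 ≤ Fintype.card ι)
    (hD : ∀ i j, i ≠ j → χ (Dm i j) = Dm i j) {i j k : ι} (hij : i ≠ j) (hik : i ≠ k) (hjk : j ≠ k) (z w : ℂ)
    (hz : Complex.normSq z = 1) (hw : Complex.normSq w = 1) : fo χ i k (z * w) = fo χ i j z * fo χ j k w := by
  have hq := qc_of_four hg hev h4
  let t : ι → ℂ := fun a => if a = i then z else if a = k then star w else 1
  have ti : t i = z := by simp [t]
  have tj : t j = 1 := by simp [t, hij.symm, hjk]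
  have tk : t k = star w := by simp [t, hik.symm]
  have hz' : z * star z = 1 := by rw [Complex.star_def, Complex.mul_conj, hz]; simp
  have hw' : star w * w = 1 := by rw [mul_comm, Complex.star_def, Complex.mul_conj, hw]; simp
  have ht : ∀ a, t a * star (t a) = 1 := by
    intro a
    simp only [t]
    split_ifs
    · exact hz'
    · rw [star_star, hw']
    · simp
  have := triangle (hg.comp_Ad (diag_unitary t ht)) hev h4 hij.symm hjk hik
  rw [show Sm j i (1:ℂ) = Sm i j 1 by rw [Sm_symm, star_one]] at this
  simp only [LinearMap.comp_apply, Ad_diag_S, Ad_diag_D t ht, ti, tj, tk, star_star, star_one, mul_one, one_mul] at this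
  rw [hD i j hij, (off_unit hg hq hD hij z hz).1, (off_unit hg hq hD hjk w hw).1,
    (off_unit hg hq hD hik (z * w) (by rw [Complex.normSq_mul, hz, hw, one_mul])).1] at this
  unfold fo
  generalize χ (Sm i j z) i j = A at this ⊢
  generalize χ (Sm j k w) j k = B at this ⊢
  generalize χ (Sm i k (z * w)) i k = C at this ⊢
  have h2 := congrFun (congrFun this i) k
  simp [Sm, Dm, add_mul, mul_add, sub_mul, mul_sub, hij, hik, hjk, hij.symm, hik.symm, hjk.symm] at h2
  exact h2.symm

noncomputable def cj : Matrix ι ι ℂ →ₗ[ℝ] Matrix ι ι ℂ where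
  toFun X := X.map (starRingEnd ℂ)
  map_add' X Y := by ext; simp
  map_smul' r X := by ext; simp

lemma cj_S (i j : ι) (z : ℂ) : cj (Sm i j z) = Sm i j (star z) := by
  show (Sm i j z).map (starRingEnd ℂ) = _
  ext a b
  simp only [Sm, Matrix.map_apply, Matrix.add_apply, Matrix.single_apply, map_add]
  congr 1 <;> split_ifs <;> simp

lemma cj_D (i j : ι) : cj (Dm i j) = Dm i j := by
  show (Dm i j).map (starRingEnd ℂ) = _
  ext a b
  simp only [Dm, Matrix.map_apply, Matrix.sub_apply, Matrix.single_apply, map_sub]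
  congr 1 <;> split_ifs <;> simp

lemma off_finish (hD : ∀ i j, i ≠ j → χ (Dm i j) = Dm i j) (t : ι → ℂ) (ht : ∀ i, t i * star (t i) = 1) (ρ : ℂ)
    (hρ : ρ * ρ = -1) (h1 : ∀ i j, i ≠ j → χ (Sm i j 1) = Sm i j (t i * star (t j)))
    (hI : ∀ i j, i ≠ j → χ (Sm i j Complex.I) = Sm i j (ρ * (t i * star (t j)))) :
    ∃ T : Matrix ι ι ℂ, Tᴴ * T = 1 ∧ ((∀ X : Matrix ι ι ℂ, Xᴴ = X → Matrix.trace X = 0 → χ X = Ad T X) ∨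
      (∀ X : Matrix ι ι ℂ, Xᴴ = X → Matrix.trace X = 0 → χ X = (Ad T ∘ₗ cj) X)) := by
  have hρ' : ρ = Complex.I ∨ ρ = -Complex.I := by
    have : (ρ - Complex.I) * (ρ + Complex.I) = 0 := by linear_combination hρ - Complex.I_mul_I
    rcases mul_eq_zero.1 this with h | h
    · left; linear_combination h
    · right; linear_combination h
  refine ⟨Matrix.diagonal t, diag_unitary t ht, ?_⟩
  rcases hρ' with rfl | rfl
  · left
    refine ext_lin ?_ ?_ ?_
    · intro i j hij; rw [hD i j hij, Ad_diag_D t ht]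
    · intro i j hij; rw [h1 i j hij, Ad_diag_S, mul_one]
    · intro i j hij; rw [hI i j hij, Ad_diag_S]; congr 1; ring
  · right
    refine ext_lin ?_ ?_ ?_
    · intro i j hij; rw [hD i j hij, LinearMap.comp_apply, cj_D, Ad_diag_D t ht]
    · intro i j hij; rw [h1 i j hij, LinearMap.comp_apply, cj_S, Ad_diag_S, star_one, mul_one]
    · intro i j hij; rw [hI i j hij, LinearMap.comp_apply, cj_S, Ad_diag_S]; congr 1; simp; ring

lemma fo_symm (hg : Good χ) (i j : ι) (z : ℂ) : fo χ j i z = star (fo χ i j (star z)) := by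
  unfold fo
  rw [Sm_symm j i]
  have := congrFun (congrFun (hg.herm (Sm i j (star z))) j) i
  rw [Matrix.conjTranspose_apply] at this
  exact this.symm

lemma fo_neg (i j : ι) (z : ℂ) : fo χ i j (-z) = - fo χ i j z := by
  unfold fo
  rw [show Sm i j (-z) = - Sm i j z by simp [Sm, Matrix.single_neg]; abel, map_neg, Matrix.neg_apply]

lemma off_stage (hg : Good χ) (hev : Even (Fintype.card ι)) (h4 : 4 ≤ Fintype.card ι)
    (hD : ∀ i j, i ≠ j → χ (Dm i j) = Dm i j) :
    ∃ T : Matrix ι ι ℂ, Tᴴ * T = 1 ∧ ((∀ X : Matrix ι ι ℂ, Xᴴ = X → Matrix.trace X = 0 → χ X = Ad T X) ∨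
      (∀ X : Matrix ι ι ℂ, Xᴴ = X → Matrix.trace X = 0 → χ X = (Ad T ∘ₗ cj) X)) := by
  have hq := qc_of_four hg hev h4
  have n1 : Complex.normSq 1 = 1 := by simp
  have nI : Complex.normSq Complex.I = 1 := by simp
  have hu : ∀ i j, i ≠ j → fo χ i j 1 * star (fo χ i j 1) = 1 := fun i j h => (off_unit hg hq hD h 1 n1).2
  have hu0 : ∀ i j, i ≠ j → fo χ i j 1 ≠ 0 := fun i j h h0 => by
    have := hu i j h; rw [h0, zero_mul] at this; exact zero_ne_one this
  have m11 : ∀ i j k, i ≠ j → i ≠ k → j ≠ k → fo χ i k 1 = fo χ i j 1 * fo χ j k 1 := by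
    intro i j k a b c
    have := fo_mul hg hev h4 hD a b c 1 1 n1 n1
    rwa [mul_one] at this
  have mI1 : ∀ i j k, i ≠ j → i ≠ k → j ≠ k → fo χ i k Complex.I = fo χ i j Complex.I * fo χ j k 1 := by
    intro i j k a b c
    have := fo_mul hg hev h4 hD a b c Complex.I 1 nI n1
    rwa [mul_one] at this
  have m1I : ∀ i j k, i ≠ j → i ≠ k → j ≠ k → fo χ i k Complex.I = fo χ i j 1 * fo χ j k Complex.I := by
    intro i j k a b c
    have := fo_mul hg hev h4 hD a b c 1 Complex.I n1 nI
    rwa [one_mul] at this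
  obtain ⟨o⟩ : Nonempty ι := Fintype.card_pos_iff.1 (by omega)
  obtain ⟨q, -, -, hoq, -⟩ := exists_two_more h4 o o
  let ρ := fo χ o q Complex.I / fo χ o q 1
  have P0 : fo χ o q Complex.I = ρ * fo χ o q 1 := (div_mul_cancel₀ _ (hu0 o q hoq)).symm
  have mv1 : ∀ i j k, i ≠ j → i ≠ k → fo χ i j Complex.I = ρ * fo χ i j 1 → fo χ i k Complex.I = ρ * fo χ i k 1 := by
    intro i j k hij hik h
    by_cases hjk : j = k
    · rw [← hjk, h]
    rw [mI1 i j k hij hik hjk, m11 i j k hij hik hjk, h, mul_assoc]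
  have mv2 : ∀ i j k, i ≠ k → j ≠ k → fo χ i k Complex.I = ρ * fo χ i k 1 → fo χ j k Complex.I = ρ * fo χ j k 1 := by
    intro i j k hik hjk h
    by_cases hij : i = j
    · rw [← hij, h]
    rw [m1I i j k hij hik hjk, m11 i j k hij hik hjk] at h
    refine mul_left_cancel₀ (hu0 i j hij) ?_
    rw [h]; ring
  have P : ∀ i j, i ≠ j → fo χ i j Complex.I = ρ * fo χ i j 1 := by
    intro i j hij
    by_cases hj : o = j
    · obtain ⟨m, -, -, hom, -, him, -⟩ := exists_two_more h4 o i
      exact mv1 i m j him hij (mv2 o i m hom him (mv1 o q m hoq hom P0))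
    · exact mv2 o i j hj hij (mv1 o q j hoq hj P0)
  have hρ : ρ * ρ = -1 := by
    obtain ⟨m, -, -, hom, -, hqm, -⟩ := exists_two_more h4 o q
    have := fo_mul hg hev h4 hD hoq hom hqm Complex.I Complex.I nI nI
    rw [Complex.I_mul_I, fo_neg, P o q hoq, P q m hqm, m11 o q m hoq hom hqm] at this
    have h0 := mul_ne_zero (hu0 o q hoq) (hu0 q m hqm)
    refine mul_right_cancel₀ h0 ?_
    linear_combination -this
  let t : ι → ℂ := fun i => if i = o then 1 else fo χ i o 1
  have htt : ∀ i j, i ≠ j → fo χ i j 1 = t i * star (t j) := by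
    intro i j hij
    have sy : ∀ j, fo χ o j 1 = star (fo χ j o 1) := fun j => by rw [fo_symm hg, star_one]
    by_cases hi : i = o
    · subst hi
      simp only [t, if_true, if_neg hij.symm, one_mul]; exact sy j
    · by_cases hj : j = o
      · subst hj; simp [t, hi]
      · simp only [t, if_neg hi, if_neg hj]
        rw [m11 i o j hi hij (Ne.symm hj), sy]
  refine off_finish hD t ?_ ρ hρ ?_ ?_
  · intro i
    simp only [t]
    split_ifs with h
    · simp
    · exact hu i o h
  · intro i j hij
    rw [(off_unit hg hq hD hij 1 n1).1]
    congr 1; exact htt i j hij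
  · intro i j hij
    rw [(off_unit hg hq hD hij _ nI).1]
    congr 1; rw [← htt i j hij]; exact P i j hij

lemma off_stage_two (hg : Good χ) (hc : Fintype.card ι = 2)
    (hD : ∀ i j, i ≠ j → χ (Dm i j) = Dm i j) :
    ∃ T : Matrix ι ι ℂ, Tᴴ * T = 1 ∧ ((∀ X : Matrix ι ι ℂ, Xᴴ = X → Matrix.trace X = 0 → χ X = Ad T X) ∨
      (∀ X : Matrix ι ι ℂ, Xᴴ = X → Matrix.trace X = 0 → χ X = (Ad T ∘ₗ cj) X)) := by
  have hq := qc_of_two hg hc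
  obtain ⟨p, q, hpq, huniv⟩ := Finset.card_eq_two.1 (show (Finset.univ : Finset ι).card = 2 from hc)
  have two : ∀ i, i = p ∨ i = q := by
    intro i
    have := Finset.mem_univ i
    rw [huniv] at this
    simpa using this
  have n1 : Complex.normSq 1 = 1 := by simp
  have nI : Complex.normSq Complex.I = 1 := by simp
  obtain ⟨u1, u2⟩ := off_unit hg hq hD hpq 1 n1
  obtain ⟨v1, v2⟩ := off_unit hg hq hD hpq _ nI
  have an := hq.anti_SS hpq
  rw [u1, v1] at an
  set u := χ (Sm p q 1) p q with hu
  set v := χ (Sm p q Complex.I) p q with hv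
  have an' : u * star v + v * star u = 0 := by
    have := congrFun (congrFun an p) p
    simpa [Sm, add_mul, mul_add, hpq, hpq.symm] using this
  let ρ := v * star u
  have hρ : ρ * ρ = -1 := by
    show v * star u * (v * star u) = -1
    linear_combination (v * star u) * an' - u2 * v * star v - v2
  have hvu : v = ρ * u := by
    show v = v * star u * u
    linear_combination -v * u2
  have hρs : star ρ = -ρ := by
    show star (v * star u) = -(v * star u)
    rw [star_mul', star_star]
    linear_combination an'
  have sy : ∀ z, χ (Sm q p z) = χ (Sm p q (star z)) := fun z => by rw [Sm_symm]
  let t : ι → ℂ := fun i => if i = p then u else 1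
  have tp : t p = u := by simp [t]
  have tq : t q = 1 := by simp [t, hpq.symm]
  refine off_finish hD t ?_ ρ hρ ?_ ?_
  · intro i
    rcases two i with rfl | rfl
    · rw [tp, u2]
    · rw [tq]; simp
  · intro i j hij
    rcases two i with rfl | rfl <;> rcases two j with rfl | rfl
    · exact absurd rfl hij
    · rw [u1, tp, tq]; simp
    · rw [Sm_symm, star_one, u1, Sm_symm, tp, tq]; simp
    · exact absurd rfl hij
  · intro i j hij
    rcases two i with rfl | rfl <;> rcases two j with rfl | rfl
    · exact absurd rfl hij
    · rw [v1, tp, tq, hvu]; simp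
    · have e : Sm j i (star Complex.I) = - Sm j i Complex.I := by
        rw [Complex.star_def, Complex.conj_I]; simp [Sm, Matrix.single_neg]; exact add_comm _ _
      rw [Sm_symm, e, map_neg, v1, Sm_symm i j (ρ * _), tp, tq, hvu, star_mul', hρs]
      simp [Sm, Matrix.single_neg]
      first | done | abel
    · exact absurd rfl hij

end Off

section Final

lemma final_algebra {ι : Type} [Fintype ι] [DecidableEq ι] {ψ χ : Matrix ι ι ℂ →ₗ[ℝ] Matrix ι ι ℂ}
    {U V T : Matrix ι ι ℂ} {s : ℝ} (hs : s = 1 ∨ s = -1)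
    (hU : Uᴴ * U = 1) (hV : Vᴴ * V = 1) (hT : Tᴴ * T = 1) (hχ : χ = s • (Ad Vᴴ ∘ₗ ψ ∘ₗ Ad U))
    (h : (∀ X, Xᴴ = X → Matrix.trace X = 0 → χ X = Ad T X) ∨
      (∀ X, Xᴴ = X → Matrix.trace X = 0 → χ X = (Ad T ∘ₗ cj) X)) :
    ∃ W : Matrix ι ι ℂ, W ∈ Matrix.unitaryGroup ι ℂ ∧
      ((∀ A, Aᴴ = A → Matrix.trace A = 0 → ψ A = s • (W * A * Wᴴ)) ∨
       (∀ A, Aᴴ = A → Matrix.trace A = 0 → ψ A = s • (W * A.map (starRingEnd ℂ) * Wᴴ))) := by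
  have hU' := mul_eq_one_comm.1 hU
  have hV' := mul_eq_one_comm.1 hV
  have hss : s * s = 1 := by rcases hs with rfl | rfl <;> norm_num
  have key : ∀ A, ψ A = s • (V * χ (Uᴴ * A * U) * Vᴴ) := by
    intro A
    have e : U * (Uᴴ * A * U) * Uᴴ = A := by
      calc _ = (U * Uᴴ) * A * (U * Uᴴ) := by simp only [Matrix.mul_assoc]
        _ = A := by rw [hU', Matrix.one_mul, Matrix.mul_one]
    rw [hχ]
    simp only [LinearMap.smul_apply, LinearMap.comp_apply, Ad_apply, e, Matrix.conjTranspose_conjTranspose]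
    rw [Matrix.mul_smul, Matrix.smul_mul, smul_smul, hss, one_smul]
    calc ψ A = (V * Vᴴ) * ψ A * (V * Vᴴ) := by rw [hV', Matrix.one_mul, Matrix.mul_one]
      _ = _ := by simp only [Matrix.mul_assoc]
  have hh : ∀ A : Matrix ι ι ℂ, Aᴴ = A → (Uᴴ * A * U)ᴴ = Uᴴ * A * U := by
    intro A hA
    simp [Matrix.conjTranspose_mul, hA, Matrix.mul_assoc]
  have ht : ∀ A : Matrix ι ι ℂ, Matrix.trace A = 0 → Matrix.trace (Uᴴ * A * U) = 0 := by
    intro A hA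
    rw [Matrix.trace_mul_comm, ← Matrix.mul_assoc, hU', Matrix.one_mul, hA]
  rcases h with h | h
  · refine ⟨V * T * Uᴴ, ?_, Or.inl ?_⟩
    · rw [Matrix.mem_unitaryGroup_iff', Matrix.star_eq_conjTranspose]
      simp only [Matrix.conjTranspose_mul, Matrix.conjTranspose_conjTranspose]
      calc _ = U * (Tᴴ * ((Vᴴ * V) * T)) * Uᴴ := by simp only [Matrix.mul_assoc]
        _ = 1 := by rw [hV, Matrix.one_mul, hT, Matrix.mul_one, hU']
    · intro A h1 h2
      rw [key, h _ (hh A h1) (ht A h2), Ad_apply]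
      simp only [Matrix.conjTranspose_mul, Matrix.conjTranspose_conjTranspose, Matrix.mul_assoc]
  · have hUt : Uᵀ * Uᵀᴴ = 1 := by
      have := congrArg Matrix.transpose hU
      rw [Matrix.transpose_mul, Matrix.transpose_one] at this
      exact this
    refine ⟨V * T * Uᵀ, ?_, Or.inr ?_⟩
    · have hUt' := mul_eq_one_comm.1 hUt
      rw [Matrix.mem_unitaryGroup_iff', Matrix.star_eq_conjTranspose]
      simp only [Matrix.conjTranspose_mul]
      calc _ = Uᵀᴴ * (Tᴴ * ((Vᴴ * V) * T)) * Uᵀ := by simp only [Matrix.mul_assoc]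
        _ = 1 := by rw [hV, Matrix.one_mul, hT, Matrix.mul_one, hUt']
    · intro A h1 h2
      have e : cj (Uᴴ * A * U) = Uᵀ * A.map (starRingEnd ℂ) * Uᵀᴴ := by
        show (Uᴴ * A * U).map (starRingEnd ℂ) = _
        rw [Matrix.map_mul, Matrix.map_mul]
        congr 2
        ext i j; simp [Matrix.conjTranspose_apply]
      rw [key, h _ (hh A h1) (ht A h2), LinearMap.comp_apply, Ad_apply, e]
      simp only [Matrix.conjTranspose_mul, Matrix.mul_assoc]

lemma conj_two (A : Matrix (Fin 2) (Fin 2) ℂ) (h : Aᴴ = A) (ht : Matrix.trace A = 0) :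
    A.map (starRingEnd ℂ) = - (!![0, 1; -1, 0] * A * (!![0, 1; -1, 0] : Matrix (Fin 2) (Fin 2) ℂ)ᴴ) := by
  have h00 := congrFun (congrFun h 0) 0
  have h01 := congrFun (congrFun h 0) 1
  have h10 := congrFun (congrFun h 1) 0
  have h11 := congrFun (congrFun h 1) 1
  simp only [Matrix.conjTranspose_apply, Complex.star_def] at h00 h01 h10 h11
  rw [Matrix.trace_fin_two] at ht
  generalize hσ : (!![0, 1; -1, 0] : Matrix (Fin 2) (Fin 2) ℂ) = σ
  have s00 : σ 0 0 = 0 := by rw [← hσ]; rfl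
  have s01 : σ 0 1 = 1 := by rw [← hσ]; rfl
  have s10 : σ 1 0 = -1 := by rw [← hσ]; rfl
  have s11 : σ 1 1 = 0 := by rw [← hσ]; rfl
  have h3 : A 1 1 = - A 0 0 := by linear_combination ht
  ext i j
  fin_cases i <;> fin_cases j <;>
    simp [Matrix.mul_apply, Fin.sum_univ_two, Matrix.conjTranspose_apply, h00, h01, h10, h3, s00, s01, s10, s11]

lemma conj_sigma_unitary : (!![0, 1; -1, 0] : Matrix (Fin 2) (Fin 2) ℂ) ∈ Matrix.unitaryGroup (Fin 2) ℂ := by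
  rw [Matrix.mem_unitaryGroup_iff, Matrix.star_eq_conjTranspose]
  ext i j
  fin_cases i <;> fin_cases j <;> simp [Matrix.mul_apply, Fin.sum_univ_two, Matrix.conjTranspose_apply]

lemma forward (k : ℕ) (hk : 0 < k) (φ : H0S (2 * k) → H0S (2 * k)) (hl : IsLinearMap ℝ φ)
    (hu : ∀ A : H0S (2 * k),
        (A : Mat (2 * k)) ∈ Matrix.unitaryGroup (Fin (2 * k)) ℂ →
        (φ A : Mat (2 * k)) ∈ Matrix.unitaryGroup (Fin (2 * k)) ℂ) :
    (∃ U : Mat (2 * k), U ∈ Matrix.unitaryGroup (Fin (2 * k)) ℂ ∧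
      ∃ s : ℝ, (s = 1 ∨ s = -1) ∧
        ((∀ A : H0S (2 * k), (φ A : Mat (2 * k)) = s • (U * (A : Mat (2 * k)) * Uᴴ)) ∨
         (2 ≤ k ∧ ∀ A : H0S (2 * k),
            (φ A : Mat (2 * k)) = s • (U * (A : Mat (2 * k)).map (starRingEnd ℂ) * Uᴴ)))) := by
  obtain ⟨p, hp⟩ := LinearMap.exists_leftInverse_of_injective (H0S (2 * k)).subtype (Submodule.ker_subtype _)
  let ψ : Mat (2 * k) →ₗ[ℝ] Mat (2 * k) := (H0S (2 * k)).subtype ∘ₗ (hl.mk' φ) ∘ₗ p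
  have hpA : ∀ A : H0S (2 * k), p (A : Mat (2 * k)) = A := fun A => LinearMap.congr_fun hp A
  have hψA : ∀ A : H0S (2 * k), ψ (A : Mat (2 * k)) = (φ A : Mat (2 * k)) := by
    intro A
    show ((φ (p (A : Mat (2 * k))) : H0S (2 * k)) : Mat (2 * k)) = _
    rw [hpA]
  have hg : Good ψ := by
    refine ⟨fun X => (φ (p X)).2.1, fun X => (φ (p X)).2.2, ?_⟩
    intro X h1 h2 h3
    have := hu ⟨X, h1, h2⟩ (by
      rw [Matrix.mem_unitaryGroup_iff, Matrix.star_eq_conjTranspose]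
      show X * Xᴴ = 1
      rw [h1, h3])
    rw [Matrix.mem_unitaryGroup_iff, Matrix.star_eq_conjTranspose, ← hψA] at this
    have e : (ψ X)ᴴ = ψ X := (φ (p X)).2.1
    change ψ X * (ψ X)ᴴ = 1 at this
    rwa [e] at this
  obtain hk2 | hk1 : 2 ≤ k ∨ k = 1 := by omega
  · obtain ⟨r, rfl⟩ := Nat.exists_eq_add_of_le' hk2
    obtain ⟨U, V, s, hU, hV, hs, hg2, hD⟩ := diag_stage hg (r := r) (by simp)
    obtain ⟨T, hT, hh⟩ := off_stage hg2 (by simp) (by simp; omega) hD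
    obtain ⟨W, hW, hW2⟩ := final_algebra hs hU hV hT rfl hh
    refine ⟨W, hW, s, hs, ?_⟩
    rcases hW2 with h | h
    · left
      intro A
      rw [← hψA]; exact h _ A.2.1 A.2.2
    · right
      refine ⟨hk2, ?_⟩
      intro A
      rw [← hψA]; exact h _ A.2.1 A.2.2
  · subst hk1
    obtain ⟨U, V, s, hU, hV, hs, hg2, hD⟩ := diag_stage_two hg (by simp)
    obtain ⟨T, hT, hh⟩ := off_stage_two hg2 (by simp) hD
    obtain ⟨W, hW, hW2⟩ := final_algebra hs hU hV hT rfl hh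
    rcases hW2 with h | h
    · refine ⟨W, hW, s, hs, Or.inl ?_⟩
      intro A
      rw [← hψA]; exact h _ A.2.1 A.2.2
    · let σ : Mat (2 * 1) := (!![0, 1; -1, 0] : Matrix (Fin 2) (Fin 2) ℂ)
      have hσ : σ ∈ Matrix.unitaryGroup (Fin (2 * 1)) ℂ := conj_sigma_unitary
      refine ⟨W * σ, mul_mem hW hσ, -s, by rcases hs with rfl | rfl <;> simp, Or.inl ?_⟩
      intro A
      have e : (A : Mat (2 * 1)).map (starRingEnd ℂ) = - (σ * (A : Mat (2 * 1)) * σᴴ) :=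
        conj_two (A : Mat (2 * 1)) A.2.1 A.2.2
      rw [← hψA, h _ A.2.1 A.2.2, e]
      simp only [Matrix.conjTranspose_mul, Matrix.mul_assoc, Matrix.mul_neg, Matrix.neg_mul, smul_neg, neg_smul]

lemma conj_map_unitary {n : ℕ} {A : Mat n} (h : A ∈ Matrix.unitaryGroup (Fin n) ℂ) :
    A.map (starRingEnd ℂ) ∈ Matrix.unitaryGroup (Fin n) ℂ := by
  rw [Matrix.mem_unitaryGroup_iff, Matrix.star_eq_conjTranspose] at h ⊢
  have := congrArg (fun X => Matrix.map X (starRingEnd ℂ)) h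
  simp only [Matrix.map_mul] at this
  rw [Matrix.map_one _ (map_zero _) (map_one _)] at this
  convert this using 2
  ext i j; simp [Matrix.conjTranspose_apply]

lemma smul_unitary {n : ℕ} {U A : Mat n} {s : ℝ} (hs : s = 1 ∨ s = -1)
    (hU : U ∈ Matrix.unitaryGroup (Fin n) ℂ) (h : A ∈ Matrix.unitaryGroup (Fin n) ℂ) :
    s • (U * A * Uᴴ) ∈ Matrix.unitaryGroup (Fin n) ℂ := by
  have h1 : U * A * Uᴴ ∈ Matrix.unitaryGroup (Fin n) ℂ :=
    mul_mem (mul_mem hU h) (by rw [← Matrix.star_eq_conjTranspose]; exact Unitary.star_mem hU)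
  rcases hs with rfl | rfl
  · rwa [one_smul]
  · rw [neg_smul, one_smul]
    rw [Matrix.mem_unitaryGroup_iff] at h1 ⊢
    rw [star_neg, neg_mul_neg, h1]

end Final

/-- Theorem `iho`. -/
theorem stmt1 (k : ℕ) (hk : 0 < k) (φ : H0S (2 * k) → H0S (2 * k)) :
    (IsLinearMap ℝ φ ∧ ∀ A : H0S (2 * k),
        (A : Mat (2 * k)) ∈ Matrix.unitaryGroup (Fin (2 * k)) ℂ →
        (φ A : Mat (2 * k)) ∈ Matrix.unitaryGroup (Fin (2 * k)) ℂ) ↔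
    (∃ U : Mat (2 * k), U ∈ Matrix.unitaryGroup (Fin (2 * k)) ℂ ∧
      ∃ s : ℝ, (s = 1 ∨ s = -1) ∧
        ((∀ A : H0S (2 * k), (φ A : Mat (2 * k)) = s • (U * (A : Mat (2 * k)) * Uᴴ)) ∨
         (2 ≤ k ∧ ∀ A : H0S (2 * k),
            (φ A : Mat (2 * k)) = s • (U * (A : Mat (2 * k)).map (starRingEnd ℂ) * Uᴴ)))) := by
  constructor
  · rintro ⟨hl, hu⟩
    exact forward k hk φ hl hu
  · rintro ⟨U, hU, s, hs, h | ⟨-, h⟩⟩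
    · refine ⟨⟨?_, ?_⟩, ?_⟩
      · intro A B
        apply Subtype.ext
        rw [Submodule.coe_add, h, h, h, Submodule.coe_add, Matrix.mul_add, Matrix.add_mul, smul_add]
      · intro c A
        apply Subtype.ext
        rw [Submodule.coe_smul, h, h, Submodule.coe_smul, Matrix.mul_smul, Matrix.smul_mul, smul_comm]
      · intro A hA
        rw [h]
        exact smul_unitary hs hU hA
    · refine ⟨⟨?_, ?_⟩, ?_⟩
      · intro A B
        apply Subtype.ext
        have e : ((A : Mat (2 * k)) + (B : Mat (2 * k))).map (starRingEnd ℂ)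
            = (A : Mat (2 * k)).map (starRingEnd ℂ) + (B : Mat (2 * k)).map (starRingEnd ℂ) := map_add cj _ _
        rw [Submodule.coe_add, h, h, h, Submodule.coe_add, e, Matrix.mul_add, Matrix.add_mul, smul_add]
      · intro c A
        apply Subtype.ext
        have e : (c • (A : Mat (2 * k))).map (starRingEnd ℂ)
            = c • (A : Mat (2 * k)).map (starRingEnd ℂ) := map_smul cj _ _
        rw [Submodule.coe_smul, h, h, Submodule.coe_smul, e, Matrix.mul_smul, Matrix.smul_mul, smul_comm]
      · intro A hA
        rw [h]
        exact smul_unitary hs hU (conj_map_unitary hA)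
end

section
/- Let H and K be complex Hilbert spaces, let k be a positive integer with k < dim H, and let φ : F_s(H) → F_s(K) be a real-linear map such that φ(𝒫_k(H)) ⊆ 𝒫_f(K). Then there exists m ∈ ℕ ∪ {0} with m ≤ dim K such that φ(𝒫_k(H)) ⊆ 𝒫_m(K); that is, φ maps all rank-k projections to projections of one fixed rank m. -/
noncomputable section

/-- The trace of a finite-rank bounded operator, computed as the trace of its
restriction to its (invariant) range. -/
def opTrace {H : Type*} [NormedAddCommGroup H] [InnerProductSpace ℂ H]
    (T : H →L[ℂ] H) : ℂ :=
  LinearMap.trace ℂ (LinearMap.range (T : H →ₗ[ℂ] H))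
    ((T : H →ₗ[ℂ] H).restrict (p := LinearMap.range (T : H →ₗ[ℂ] H))
      (q := LinearMap.range (T : H →ₗ[ℂ] H))
      (fun x _ => LinearMap.mem_range_self _ x))

/-- A bounded operator has finite rank if its range is finite-dimensional. -/
def FinRk {H : Type*} [NormedAddCommGroup H] [InnerProductSpace ℂ H]
    (T : H →L[ℂ] H) : Prop :=
  FiniteDimensional ℂ (LinearMap.range (T : H →ₗ[ℂ] H))

/-- `IsProjFR T` means that `T` is a finite-rank projection:
a self-adjoint idempotent bounded operator with finite-dimensional range. -/
def IsProjFR {H : Type*} [NormedAddCommGroup H] [InnerProductSpace ℂ H] [CompleteSpace H]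
    (T : H →L[ℂ] H) : Prop :=
  IsSelfAdjoint T ∧ T ∘L T = T ∧ FinRk T

/-- `IsProjR T k` means that `T` is a projection of rank `k`. -/
def IsProjR {H : Type*} [NormedAddCommGroup H] [InnerProductSpace ℂ H] [CompleteSpace H]
    (T : H →L[ℂ] H) (k : ℕ) : Prop :=
  IsProjFR T ∧ Module.finrank ℂ (LinearMap.range (T : H →ₗ[ℂ] H)) = k

/-- The real vector space `F_s(H)` of finite-rank bounded self-adjoint operators on `H`. -/
def FsS (H : Type*) [NormedAddCommGroup H] [InnerProductSpace ℂ H] [CompleteSpace H] :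
    Submodule ℝ (H →L[ℂ] H) where
  carrier := {T | IsSelfAdjoint T ∧ FinRk T}
  add_mem' := by
    rintro S T ⟨hS, hSf⟩ ⟨hT, hTf⟩
    refine ⟨hS.add hT, ?_⟩
    haveI : FiniteDimensional ℂ (LinearMap.range (S : H →ₗ[ℂ] H)) := hSf
    haveI : FiniteDimensional ℂ (LinearMap.range (T : H →ₗ[ℂ] H)) := hTf
    have hle : LinearMap.range ((S + T : H →L[ℂ] H) : H →ₗ[ℂ] H) ≤
        LinearMap.range (S : H →ₗ[ℂ] H) ⊔ LinearMap.range (T : H →ₗ[ℂ] H) := by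
      rintro x ⟨y, rfl⟩
      exact Submodule.add_mem_sup (LinearMap.mem_range_self _ y) (LinearMap.mem_range_self _ y)
    exact Submodule.finiteDimensional_of_le hle
  zero_mem' := by
    refine ⟨(IsSelfAdjoint.zero _), ?_⟩
    have : LinearMap.range ((0 : H →L[ℂ] H) : H →ₗ[ℂ] H) = ⊥ := LinearMap.range_eq_bot.2 rfl
    rw [FinRk, this]
    infer_instance
  smul_mem' := by
    rintro r T ⟨hT, hTf⟩
    refine ⟨(IsSelfAdjoint.all r).smul hT, ?_⟩
    haveI : FiniteDimensional ℂ (LinearMap.range (T : H →ₗ[ℂ] H)) := hTf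
    have hle : LinearMap.range ((r • T : H →L[ℂ] H) : H →ₗ[ℂ] H) ≤
        LinearMap.range (T : H →ₗ[ℂ] H) := by
      rintro x ⟨y, rfl⟩
      show (r • T) y ∈ _
      rw [ContinuousLinearMap.smul_apply]
      exact Submodule.smul_of_tower_mem _ r (LinearMap.mem_range_self _ y)
    exact Submodule.finiteDimensional_of_le hle

/-- The real vector space `S(H)` of bounded self-adjoint operators on `H`. -/
def SaS (H : Type*) [NormedAddCommGroup H] [InnerProductSpace ℂ H] [CompleteSpace H] :
    Submodule ℝ (H →L[ℂ] H) where
  carrier := {T | IsSelfAdjoint T}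
  add_mem' := fun hS hT => hS.add hT
  zero_mem' := (IsSelfAdjoint.zero _)
  smul_mem' := fun r _T hT => (IsSelfAdjoint.all r).smul hT

/-- `IsConjBy U A B` expresses that `B = U A U*` for an isometry `U` (linear or
conjugate-linear): `B` agrees with `U ∘ A` on the image of `U` and vanishes on its
orthogonal complement. -/
def IsConjBy {H K : Type*} [NormedAddCommGroup H] [InnerProductSpace ℂ H]
    [NormedAddCommGroup K] [InnerProductSpace ℂ K]
    (U : H → K) (A : H →L[ℂ] H) (B : K →L[ℂ] K) : Prop :=
  (∀ x : H, B (U x) = U (A x)) ∧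
  ∀ y : K, (∀ x : H, (inner ℂ (U x) y : ℂ) = 0) → B y = 0

/-- The orthogonal projection onto a subspace, as an operator `H →L[ℂ] H`
(defined to be `0` if the subspace is not finite-dimensional). -/
def Pj {H : Type*} [NormedAddCommGroup H] [InnerProductSpace ℂ H]
    (X : Submodule ℂ H) : H →L[ℂ] H := by
  classical
  exact if h : FiniteDimensional ℂ X then
    haveI := h
    haveI : CompleteSpace X := FiniteDimensional.complete ℂ X
    X.subtypeL ∘L Submodule.orthogonalProjectionOnto X
  else 0

/-- The set `H_a(X, Y)` of all finite-dimensional subspaces `Z` such that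
`a(P_X + P_Y) + (1 - 2a) P_Z` is a projection. -/
def Hol {H : Type*} [NormedAddCommGroup H] [InnerProductSpace ℂ H] [CompleteSpace H]
    (a : ℝ) (X Y : Submodule ℂ H) : Set (Submodule ℂ H) :=
  {Z | FiniteDimensional ℂ Z ∧
    IsSelfAdjoint (a • (Pj X + Pj Y) + (1 - 2*a) • Pj Z) ∧
    (a • (Pj X + Pj Y) + (1 - 2*a) • Pj Z) ∘L (a • (Pj X + Pj Y) + (1 - 2*a) • Pj Z) =
      a • (Pj X + Pj Y) + (1 - 2*a) • Pj Z}

/-- The matrix of an operator `T` with respect to an orthonormal basis `b` of a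
(`T`-invariant) finite-dimensional subspace `Z`. -/
def matOf {H : Type*} [NormedAddCommGroup H] [InnerProductSpace ℂ H]
    {Z : Submodule ℂ H} {N : ℕ} (b : OrthonormalBasis (Fin N) ℂ Z) (T : H →L[ℂ] H) :
    Matrix (Fin N) (Fin N) ℂ :=
  Matrix.of fun i j => (inner ℂ ((b i : H)) (T (b j : H)) : ℂ)

/-- Restriction of a bounded operator to an invariant subspace. -/
def clmRestrict {H : Type*} [NormedAddCommGroup H] [InnerProductSpace ℂ H]
    (T : H →L[ℂ] H) (M : Submodule ℂ H) (h : ∀ x ∈ M, T x ∈ M) : M →L[ℂ] M :=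
  ContinuousLinearMap.codRestrict (T ∘L M.subtypeL) M (fun x => h x x.2)

end


section aux
open InnerProductSpace

variable {H : Type*} [NormedAddCommGroup H] [InnerProductSpace ℂ H]

theorem aux_opTrace_eq (T : H →L[ℂ] H) (hT : FinRk T) (F : Submodule ℂ H)
    [FiniteDimensional ℂ F] (h : LinearMap.range (T : H →ₗ[ℂ] H) ≤ F) :
    opTrace T = LinearMap.trace ℂ F ((T : H →ₗ[ℂ] H).restrict (p := F) (q := F)
      (fun x _ => h (LinearMap.mem_range_self _ x))) := by
  haveI : FiniteDimensional ℂ (LinearMap.range (T : H →ₗ[ℂ] H)) := hT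
  let j := Submodule.inclusion h
  let T' : F →ₗ[ℂ] LinearMap.range (T : H →ₗ[ℂ] H) :=
    (T : H →ₗ[ℂ] H).rangeRestrict ∘ₗ F.subtype
  have := LinearMap.trace_comp_comm' j T'
  exact this

theorem aux_opTrace_add (S T : H →L[ℂ] H) (hS : FinRk S) (hT : FinRk T) (hST : FinRk (S + T)) :
    opTrace (S + T) = opTrace S + opTrace T := by
  haveI : FiniteDimensional ℂ (LinearMap.range (S : H →ₗ[ℂ] H)) := hS
  haveI : FiniteDimensional ℂ (LinearMap.range (T : H →ₗ[ℂ] H)) := hT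
  have hle : LinearMap.range ((S + T : H →L[ℂ] H) : H →ₗ[ℂ] H) ≤
      LinearMap.range (S : H →ₗ[ℂ] H) ⊔ LinearMap.range (T : H →ₗ[ℂ] H) := by
    rintro x ⟨y, rfl⟩
    exact Submodule.add_mem_sup (LinearMap.mem_range_self _ y) (LinearMap.mem_range_self _ y)
  rw [aux_opTrace_eq _ hST _ hle, aux_opTrace_eq S hS (LinearMap.range (S : H →ₗ[ℂ] H) ⊔ LinearMap.range (T : H →ₗ[ℂ] H)) le_sup_left,
    aux_opTrace_eq T hT (LinearMap.range (S : H →ₗ[ℂ] H) ⊔ LinearMap.range (T : H →ₗ[ℂ] H)) le_sup_right, ← map_add]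
  rfl

theorem aux_opTrace_smul (r : ℝ) (T : H →L[ℂ] H) (hT : FinRk T) (hrT : FinRk (r • T)) :
    opTrace (r • T) = r * opTrace T := by
  haveI : FiniteDimensional ℂ (LinearMap.range (T : H →ₗ[ℂ] H)) := hT
  have hle : LinearMap.range ((r • T : H →L[ℂ] H) : H →ₗ[ℂ] H) ≤
      LinearMap.range (T : H →ₗ[ℂ] H) := by
    rintro x ⟨y, rfl⟩
    show (r • T) y ∈ _
    rw [ContinuousLinearMap.smul_apply]
    exact Submodule.smul_of_tower_mem _ r (LinearMap.mem_range_self _ y)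
  rw [aux_opTrace_eq _ hrT _ hle, aux_opTrace_eq T hT _ le_rfl, ← smul_eq_mul, ← map_smul]
  congr 1

variable [CompleteSpace H]

/-- the real trace functional -/
noncomputable def auxTr : FsS H →ₗ[ℝ] ℝ where
  toFun A := (opTrace (A : H →L[ℂ] H)).re
  map_add' A B := by
    rw [← Complex.add_re, ← aux_opTrace_add _ _ A.2.2 B.2.2 (A + B).2.2]; rfl
  map_smul' r A := by
    have := aux_opTrace_smul r _ A.2.2 (r • A).2.2
    simp only [RingHom.id_apply, smul_eq_mul]
    rw [← Complex.re_ofReal_mul, ← this]; rfl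

theorem auxTr_proj (A : FsS H) (hA : IsProjFR (A : H →L[ℂ] H)) :
    auxTr A = Module.finrank ℂ (LinearMap.range ((A : H →L[ℂ] H) : H →ₗ[ℂ] H)) := by
  haveI : FiniteDimensional ℂ (LinearMap.range ((A : H →L[ℂ] H) : H →ₗ[ℂ] H)) := hA.2.2
  show (opTrace (A : H →L[ℂ] H)).re = _
  have : opTrace (A : H →L[ℂ] H) =
      Module.finrank ℂ (LinearMap.range ((A : H →L[ℂ] H) : H →ₗ[ℂ] H)) := by
    rw [← LinearMap.trace_id, opTrace]
    congr 1
    ext ⟨x, y, rfl⟩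
    exact congrArg (fun T : H →L[ℂ] H => T y) hA.2.1
  rw [this]; simp

/-- rank one self-adjoint operator -/
noncomputable def auxR (x : H) : FsS H :=
  ⟨rankOne ℂ x x, (isPositive_rankOne_self x).isSelfAdjoint, by
    have : LinearMap.range ((rankOne ℂ x x : H →L[ℂ] H) : H →ₗ[ℂ] H) ≤ Submodule.span ℂ {x} := by
      rintro _ ⟨y, rfl⟩
      exact Submodule.smul_mem _ _ (Submodule.mem_span_singleton_self x)
    exact Submodule.finiteDimensional_of_le this⟩

theorem auxR_smul (a : ℝ) (x : H) : auxR (a • x) = (a ^ 2) • auxR x := by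
  ext z
  show inner ℂ (a • x) z • (a • x) = (a ^ 2) • (inner ℂ x z • x)
  simp only [← Complex.coe_smul, inner_smul_left, Complex.conj_ofReal]
  push_cast
  module

theorem auxR_comb (a b : ℝ) (x y : H) : auxR (a • x + b • y) =
    (a ^ 2) • auxR x + (b ^ 2) • auxR y + (a * b) • (auxR (x + y) - auxR x - auxR y) := by
  ext z
  show inner ℂ (a • x + b • y) z • (a • x + b • y) = (a ^ 2) • (inner ℂ x z • x) +
    (b ^ 2) • (inner ℂ y z • y) + (a * b) • (inner ℂ (x + y) z • (x + y) - inner ℂ x z • x -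
      inner ℂ y z • y)
  simp only [← Complex.coe_smul, inner_smul_left, inner_add_left, Complex.conj_ofReal]
  push_cast
  module

theorem aux_sum_proj {n : ℕ} {v : Fin n → H} (hv : Orthonormal ℂ v) :
    IsProjR ((∑ i, auxR (v i) : FsS H) : H →L[ℂ] H) n := by
  let U := Submodule.span ℂ (Set.range v)
  have hb : Orthonormal ℂ (fun i => (⟨v i, Submodule.subset_span ⟨i, rfl⟩⟩ : U)) := by
    rw [← U.subtypeₗᵢ.orthonormal_comp_iff]; exact hv
  let b := OrthonormalBasis.mk hb (by
    rw [← Submodule.map_le_map_iff_of_injective U.injective_subtype, Submodule.map_span,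
      Submodule.map_top, Submodule.range_subtype, ← Set.range_comp]
    exact le_rfl)
  haveI : FiniteDimensional ℂ U := FiniteDimensional.span_of_finite ℂ (Set.finite_range v)
  have h : ((∑ i, auxR (v i) : FsS H) : H →L[ℂ] H) = U.starProjection := by
    rw [b.starProjection_eq_sum_rankOne, AddSubmonoidClass.coe_finsetSum]
    simp [b, auxR]
  have hr : LinearMap.range ((U.starProjection : H →L[ℂ] H) : H →ₗ[ℂ] H) = U :=
    Submodule.range_starProjection U
  rw [h]
  refine ⟨⟨isStarProjection_starProjection.isSelfAdjoint,
    isStarProjection_starProjection.isIdempotentElem, ?_⟩, ?_⟩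
  · rw [FinRk, hr]; infer_instance
  · rw [hr, finrank_span_eq_card hv.linearIndependent]; simp

theorem aux_proj_sum {n : ℕ} (A : FsS H) (hA : IsProjR (A : H →L[ℂ] H) n) :
    ∃ v : Fin n → H, Orthonormal ℂ v ∧ A = ∑ i, auxR (v i) := by
  obtain ⟨⟨h1, h2, h3⟩, h4⟩ := hA
  obtain ⟨_, h5⟩ := isStarProjection_iff_eq_starProjection_range.1
    (⟨h2, h1⟩ : IsStarProjection (A : H →L[ℂ] H))
  haveI : FiniteDimensional ℂ (LinearMap.range ((A : H →L[ℂ] H) : H →ₗ[ℂ] H)) := h3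
  let b := (stdOrthonormalBasis ℂ (LinearMap.range ((A : H →L[ℂ] H) : H →ₗ[ℂ] H))).reindex
    (finCongr h4)
  refine ⟨fun i => (b i : H), ?_, ?_⟩
  · exact b.orthonormal.comp_linearIsometry (Submodule.subtypeₗᵢ _)
  · ext1
    rw [AddSubmonoidClass.coe_finsetSum]
    refine h5.trans ?_
    exact b.starProjection_eq_sum_rankOne

theorem aux_exists (k : ℕ) (hdim : ((k + 1 : ℕ) : Cardinal) < Module.rank ℂ H) (x y : H) :
    ∃ w : Fin k → H, Orthonormal ℂ w ∧ ∀ i, inner ℂ x (w i) = 0 ∧ inner ℂ y (w i) = 0 := by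
  have h2 : ((k + 2 : ℕ) : Cardinal) ≤ Module.rank ℂ H := by
    have := Order.succ_le_of_lt hdim
    rwa [← Cardinal.nat_succ] at this
  obtain ⟨u, hu⟩ := Module.le_rank_iff.1 h2
  let E := Submodule.span ℂ (Set.range u)
  have hE : Module.finrank ℂ E = k + 2 := by
    rw [finrank_span_eq_card hu]; simp
  haveI : FiniteDimensional ℂ E := FiniteDimensional.span_of_finite ℂ (Set.finite_range u)
  let V := Submodule.span ℂ (Set.range ![x, y])
  haveI : FiniteDimensional ℂ V := FiniteDimensional.span_of_finite ℂ (Set.finite_range _)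
  have hV : Module.finrank ℂ V ≤ 2 := by
    have := finrank_range_le_card (R := ℂ) ![x, y]
    rwa [Fintype.card_fin] at this
  have h3 := Submodule.finrank_add_inf_finrank_orthogonal (le_sup_left : V ≤ V ⊔ E)
  have h4 : Module.finrank ℂ E ≤ Module.finrank ℂ (V ⊔ E : Submodule ℂ H) :=
    Submodule.finrank_mono le_sup_right
  have h5 : k ≤ Module.finrank ℂ (Vᗮ ⊓ (V ⊔ E) : Submodule ℂ H) := by omega
  haveI : FiniteDimensional ℂ (Vᗮ ⊓ (V ⊔ E) : Submodule ℂ H) :=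
    Submodule.finiteDimensional_of_le inf_le_right
  let b := stdOrthonormalBasis ℂ (Vᗮ ⊓ (V ⊔ E) : Submodule ℂ H)
  refine ⟨fun i => (b (Fin.castLE h5 i) : H), ?_, fun i => ⟨?_, ?_⟩⟩
  · exact (b.orthonormal.comp_linearIsometry (Submodule.subtypeₗᵢ _)).comp _
      (Fin.castLE_injective h5)
  · exact (b (Fin.castLE h5 i)).2.1 x (Submodule.subset_span ⟨0, rfl⟩)
  · exact (b (Fin.castLE h5 i)).2.1 y (Submodule.subset_span ⟨1, rfl⟩)

theorem aux_const (k : ℕ) (hdim : ((k + 1 : ℕ) : Cardinal) < Module.rank ℂ H)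
    (f : FsS H →ₗ[ℝ] ℝ)
    (hf : ∀ A : FsS H, IsProjR (A : H →L[ℂ] H) (k + 1) → ∃ n : ℤ, f A = n)
    (x y : H) (hx : ‖x‖ = 1) (hy : ‖y‖ = 1) : f (auxR x) = f (auxR y) := by
  by_cases hxy : y = -x
  · have := auxR_smul (-1) x
    simp at this
    rw [hxy, this]
  obtain ⟨w, hw, hw'⟩ := aux_exists k hdim x y
  let l : ℝ → H := fun t => (1 - t) • x + t • y
  have hl : Continuous l := by fun_prop
  have hl0 : ∀ t ∈ Set.Icc (0 : ℝ) 1, l t ≠ 0 := by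
    intro t ht h0
    have h1 : (1 - t) • x = -(t • y) := eq_neg_of_add_eq_zero_left h0
    have h2 := congrArg norm h1
    rw [norm_neg, norm_smul, norm_smul, hx, hy, Real.norm_of_nonneg (by linarith [ht.2]),
      Real.norm_of_nonneg ht.1] at h2
    have h3 : t = 1 / 2 := by linarith
    rw [h3, ← smul_neg] at h1
    have h4 : (1 - 1 / 2 : ℝ) = 1 / 2 := by norm_num
    rw [h4] at h1
    have h5 := smul_right_injective H (by norm_num : (1 / 2 : ℝ) ≠ 0) h1
    exact hxy (by rw [h5, neg_neg])
  let P : FsS H := ∑ i, auxR (w i)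
  let h : ℝ → ℝ := fun t => f (auxR (l t)) / ‖l t‖ ^ 2 + f P
  have hcont : ContinuousOn h (Set.Icc 0 1) := by
    have h1 : Continuous fun t => f (auxR (l t)) := by
      simp only [l, auxR_comb, map_add, map_smul, smul_eq_mul]
      fun_prop
    refine ContinuousOn.add (ContinuousOn.div h1.continuousOn (by fun_prop) ?_) continuousOn_const
    intro t ht
    have := hl0 t ht
    positivity
  have hint : Set.MapsTo h (Set.Icc 0 1) (Set.range ((↑) : ℤ → ℝ)) := by
    intro t ht
    have h0 := norm_ne_zero_iff.2 (hl0 t ht)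
    let u := (‖l t‖⁻¹ : ℝ) • l t
    have hu : ‖u‖ = 1 := by
      simp [u, norm_smul, h0]
    have huw : ∀ i, inner ℂ u (w i) = 0 := by
      intro i
      simp [u, l, hw' i, inner_smul_left_eq_smul]
    have ho : Orthonormal ℂ (Fin.cons u w : Fin (k + 1) → H) := by
      refine ⟨fun i => ?_, fun i j hij => ?_⟩
      · refine Fin.cases ?_ (fun i => ?_) i
        · simpa using hu
        · simpa using hw.1 i
      · revert hij
        refine Fin.cases ?_ (fun i => ?_) i <;> refine Fin.cases ?_ (fun j => ?_) j <;> intro hij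
        · exact absurd rfl hij
        · simpa using huw j
        · simpa using inner_eq_zero_symm.1 (huw i)
        · simpa using hw.2 (fun h => hij (congrArg Fin.succ h))
    obtain ⟨n, hn⟩ := hf _ (aux_sum_proj ho)
    refine ⟨n, hn.symm.trans ?_⟩
    rw [Fin.sum_univ_succ]
    simp [u, auxR_smul, h, P]
    field_simp
  have hdisc : IsDiscrete (Set.range ((↑) : ℤ → ℝ)) :=
    Int.isClosedEmbedding_coe_real.isEmbedding.isDiscrete_range
  obtain ⟨c, -, hc⟩ := (isPreconnected_Icc (a := (0 : ℝ)) (b := 1)).eqOn_const_of_mapsTo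
    (T := Set.range ((↑) : ℤ → ℝ)) hdisc hcont hint ⟨_, 0, rfl⟩
  have e0 := hc (show (0 : ℝ) ∈ Set.Icc (0 : ℝ) 1 by simp)
  have e1 := hc (show (1 : ℝ) ∈ Set.Icc (0 : ℝ) 1 by simp)
  simp [h, l, hx, hy] at e0 e1
  linarith

end aux

/-- Proposition `fkm`. -/
theorem stmt3 {H K : Type*} [NormedAddCommGroup H] [InnerProductSpace ℂ H] [CompleteSpace H]
    [NormedAddCommGroup K] [InnerProductSpace ℂ K] [CompleteSpace K]
    (k : ℕ) (hk : 0 < k) (hdim : (k : Cardinal) < Module.rank ℂ H)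
    (φ : FsS H → FsS K) (hlin : IsLinearMap ℝ φ)
    (hproj : ∀ A : FsS H, IsProjR (A : H →L[ℂ] H) k → IsProjFR (φ A : K →L[ℂ] K)) :
    ∃ m : ℕ, (m : Cardinal) ≤ Module.rank ℂ K ∧
      ∀ A : FsS H, IsProjR (A : H →L[ℂ] H) k → IsProjR (φ A : K →L[ℂ] K) m := by
  obtain ⟨k, rfl⟩ : ∃ j, k = j + 1 := ⟨k - 1, by omega⟩
  let f : FsS H →ₗ[ℝ] ℝ := auxTr ∘ₗ hlin.mk' φ
  have hf : ∀ A : FsS H, IsProjR (A : H →L[ℂ] H) (k + 1) → f A =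
      Module.finrank ℂ (LinearMap.range ((φ A : K →L[ℂ] K) : K →ₗ[ℂ] K)) :=
    fun A hA => auxTr_proj _ (hproj A hA)
  have hc := aux_const k hdim f (fun A hA => ⟨_, (hf A hA).trans (Int.cast_natCast _).symm⟩)
  by_cases hex : ∃ A : FsS H, IsProjR (A : H →L[ℂ] H) (k + 1)
  · obtain ⟨A, hA⟩ := hex
    haveI : FiniteDimensional ℂ (LinearMap.range ((φ A : K →L[ℂ] K) : K →ₗ[ℂ] K)) :=
      (hproj A hA).2.2
    refine ⟨Module.finrank ℂ (LinearMap.range ((φ A : K →L[ℂ] K) : K →ₗ[ℂ] K)), ?_,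
      fun B hB => ⟨hproj B hB, ?_⟩⟩
    · rw [Module.finrank_eq_rank]
      exact Submodule.rank_le _
    · have h1 := hf A hA
      have h2 := hf B hB
      obtain ⟨v, hv, hAv⟩ := aux_proj_sum A hA
      obtain ⟨w, hw, hBw⟩ := aux_proj_sum B hB
      have : f A = f B := by
        rw [hAv, hBw, map_sum, map_sum]
        exact Finset.sum_congr rfl fun i _ => hc _ _ (hv.1 i) (hw.1 i)
      rw [h1, h2] at this
      exact_mod_cast this.symm
  · exact ⟨0, by simp, fun A hA => (hex ⟨A, hA⟩).elim⟩
end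

section
/- Let X and Y be finite-dimensional subspaces of a complex Hilbert space H and let a ∈ (1/2, ∞). Then H_a(X, Y) ≠ ∅ if and only if d(X, Y) ≤ √(2a−1)/a. Moreover, every Z ∈ H_a(X, Y) satisfies X ∩ Y ⊆ Z ⊆ X + Y. -/
theorem alg_fwd {A : Type*} [Ring A] [Algebra ℝ A] (P Q R S : A) (a b : ℝ) (hab : 2 * a = 1 + b)
    (hP : P * P = P) (hQ : Q * Q = Q) (hR : R * R = R) (hS : S * S = S)
    (h : a • (P + Q) = R + b • S) :
    (a^2) • ((P - Q) * (P - Q)) = b • ((R - S) * (R - S)) := by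
  have e1 : (a^2) • ((P - Q) * (P - Q)) =
      (2 * a) • (a • (P + Q)) - (a • (P + Q)) * (a • (P + Q)) := by
    simp only [mul_add, add_mul, mul_sub, sub_mul, smul_mul_assoc, mul_smul_comm, hP, hQ, smul_add]
    module
  rw [e1, h, hab]
  simp only [mul_add, add_mul, mul_sub, sub_mul, smul_mul_assoc, mul_smul_comm, hR, hS, smul_add]
  module

theorem alg_bwd {A : Type*} [Ring A] [Algebra ℝ A] (P Q G k : A) (a b : ℝ)
    (hab : 2 * a = 1 + b) (hb : b ≠ 0)
    (hP : P * P = P) (hQ : Q * Q = Q)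
    (hGP : G * (P - Q) = (P - Q) * G) (hGA : G * (P + Q - 1) = (P + Q - 1) * G)
    (hkP : k * (P - Q) = (P - Q) * k) (hkA : k * (P + Q - 1) = (P + Q - 1) * k)
    (hGk : G * k = k * G)
    (hG : G - G * ((P - Q) * (P - Q)) = ((a - 1)/b) • (1 : A))
    (hk : k * k = (a / b) • (1 : A) - G + (a / b) • (G * ((P - Q) * (P - Q))))
    (s : A) (hs : s = (1 + G * ((P - Q) * (P - Q))) * (P + Q - 1) + k * (P - Q)) :
    s * s = 1 ∧ ((2 * a) • (P + Q - 1) - b • s) * ((2 * a) • (P + Q - 1) - b • s) = 1 := by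
  have hAD : (P + Q - 1) * (P - Q) = - ((P - Q) * (P + Q - 1)) := by
    simp only [mul_add, add_mul, mul_sub, sub_mul, hP, hQ, mul_one, one_mul]
    abel
  have hAA : (P + Q - 1) * (P + Q - 1) = 1 - (P - Q) * (P - Q) := by
    simp only [mul_add, add_mul, mul_sub, sub_mul, hP, hQ, mul_one, one_mul]
    abel
  generalize P - Q = D at *
  generalize P + Q - 1 = B at *
  have huB : B * (D * D) = D * D * B := by
    rw [← mul_assoc, hAD, neg_mul, mul_assoc, hAD]; simp [mul_assoc]
  generalize hu : D * D = u at *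
  have huG : G * u = u * G := by
    rw [← hu, ← mul_assoc, hGP, mul_assoc, hGP, mul_assoc]
  have huk : k * u = u * k := by
    rw [← hu, ← mul_assoc, hkP, mul_assoc, hkP, mul_assoc]
  have huD : D * u = u * D := by rw [← hu, mul_assoc]
  generalize hα : 1 + G * u = α at *
  have cαB : B * α = α * B := by
    rw [← hα, mul_add, add_mul, mul_assoc, ← huB, ← mul_assoc, ← mul_assoc, hGA]; simp
  have cαD : D * α = α * D := by
    rw [← hα, mul_add, add_mul, mul_assoc, ← huD, ← mul_assoc, ← mul_assoc, hGP]; simp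
  have cαk : k * α = α * k := by
    rw [← hα, mul_add, add_mul, mul_assoc, ← huk, ← mul_assoc, ← mul_assoc, hGk]; simp
  have hα1 : α * (1 - u) = 1 - (a / b) • u := by
    have : α * (1 - u) = 1 - u + (G - G * u) * u := by rw [← hα]; noncomm_ring
    rw [this, hG, smul_mul_assoc, one_mul]
    have : a / b = 1 - (a - 1) / b := by field_simp; linarith
    rw [this]; module
  have hss : s * s = α * (α * (1 - u)) + k * k * u := by
    have e1 : α * B * (α * B) = α * (α * (1 - u)) := by
      rw [← hAA, mul_assoc, ← mul_assoc B, cαB, mul_assoc α B B]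
    have e2 : k * D * (k * D) = k * k * u := by
      rw [← hu, mul_assoc, ← mul_assoc D, ← hkP]; simp only [mul_assoc]
    have e3 : α * B * (k * D) = α * k * (B * D) := by
      rw [mul_assoc, ← mul_assoc B, ← hkA]; simp only [mul_assoc]
    have e4 : k * D * (α * B) = α * k * (D * B) := by
      rw [mul_assoc, ← mul_assoc D, cαD, ← cαk]; simp only [mul_assoc]
    rw [hs, mul_add, add_mul, add_mul, e1, e2, e3, e4, hAD, mul_neg]; abel
  have hs1 : s * s = 1 := by
    rw [hss, hα1, hk, ← hα]
    simp only [mul_add, add_mul, mul_sub, sub_mul, smul_mul_assoc, mul_smul_comm, mul_one, one_mul]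
    module
  refine ⟨hs1, ?_⟩
  have hBs : B * s + s * B = (2 : ℝ) • (1 - (a / b) • u) := by
    rw [← hα1, ← hAA, hs, mul_add, add_mul, ← mul_assoc, cαB, ← mul_assoc, ← hkA, mul_assoc k B D,
      hAD, mul_assoc k D B, mul_assoc, mul_neg]
    module
  have : ((2 * a) • B - b • s) * ((2 * a) • B - b • s)
      = (4 * a ^ 2) • (B * B) + b ^ 2 • (s * s) - (2 * a * b) • (B * s + s * B) := by
    simp only [mul_sub, sub_mul, smul_mul_assoc, mul_smul_comm]
    module
  rw [this, hAA, hs1, hBs]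
  have e : a / b * (2 * a * b) = 2 * a ^ 2 := by field_simp
  have : (2 * a * b) • ((2:ℝ) • (1 - (a / b) • u)) = (4 * a * b) • (1 : A) - (4 * a ^ 2) • u := by
    rw [show 4 * a ^ 2 = 2 * (a / b * (2 * a * b)) by rw [e]; ring]
    module
  rw [this]
  obtain rfl : b = 2 * a - 1 := by linarith
  module

theorem norm_diff {A : Type*} [CStarAlgebra A] [PartialOrder A] [StarOrderedRing A] (R S : A)
    (hR : IsStarProjection R) (hS : IsStarProjection S) : ‖(R - S) * (R - S)‖ ≤ 1 := by
  have h1 : IsSelfAdjoint (R - S) := hR.isSelfAdjoint.sub hS.isSelfAdjoint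
  have h2 : IsSelfAdjoint (R + S - 1) :=
    (hR.isSelfAdjoint.add hS.isSelfAdjoint).sub (IsSelfAdjoint.one _)
  rw [CStarAlgebra.norm_le_one_iff_of_nonneg _ h1.mul_self_nonneg]
  have : (R - S) * (R - S) = 1 - (R + S - 1) * (R + S - 1) := by
    have a1 := hR.isIdempotentElem.eq
    have a2 := hS.isIdempotentElem.eq
    simp only [mul_add, add_mul, mul_sub, sub_mul, a1, a2, mul_one, one_mul]
    abel
  rw [this]
  exact sub_le_self _ h2.mul_self_nonneg

theorem exist_proj {A : Type*} [CStarAlgebra A] (P Q : A)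
    (hP : IsStarProjection P) (hQ : IsStarProjection Q) (a b : ℝ) (hab : 2 * a = 1 + b) (hb : 0 < b)
    (ha1 : a ≠ 1) (h : ‖(P - Q) * (P - Q)‖ ≤ b / a ^ 2) :
    ∃ S C E : A, IsStarProjection S ∧ IsStarProjection (a • (P + Q) - b • S) ∧
      S = C * P + E * Q := by
  have ha : 0 < a := by linarith
  have h1 : IsSelfAdjoint (P - Q) := hP.isSelfAdjoint.sub hQ.isSelfAdjoint
  have h2 : IsSelfAdjoint (P + Q - 1) :=
    (hP.isSelfAdjoint.add hQ.isSelfAdjoint).sub (IsSelfAdjoint.one _)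
  have hPP := hP.isIdempotentElem.eq
  have hQQ := hQ.isIdempotentElem.eq
  set u := (P - Q) * (P - Q) with hu
  have hus : IsSelfAdjoint u := by
    rw [IsSelfAdjoint, hu, star_mul, h1.star_eq]
  have hlt : b / a ^ 2 < 1 := by
    rw [div_lt_one (by positivity)]
    nlinarith [sq_pos_of_ne_zero (sub_ne_zero.2 ha1)]
  have hspec : ∀ x ∈ spectrum ℝ u, x ≤ b / a ^ 2 := fun x hx => by
    rcases subsingleton_or_nontrivial A with hA | hA
    · simp [spectrum.of_subsingleton] at hx
    exact (le_abs_self x).trans ((spectrum.norm_le_norm_of_mem hx).trans h)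
  have hne : ∀ x ∈ spectrum ℝ u, 1 - x ≠ 0 := fun x hx => by
    have := hspec x hx
    linarith
  let g : ℝ → ℝ := fun x => ((a - 1) / b) / (1 - x)
  let q : ℝ → ℝ := fun x => a / b - g x + a / b * (g x * x)
  have hgc : ContinuousOn g (spectrum ℝ u) := by
    apply ContinuousOn.div (by fun_prop) (by fun_prop) hne
  have hqc : ContinuousOn q (spectrum ℝ u) := by fun_prop
  have hsc : ContinuousOn (fun x => Real.sqrt (q x)) (spectrum ℝ u) := hqc.sqrt
  have hq0 : ∀ x ∈ spectrum ℝ u, 0 ≤ q x := fun x hx => by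
    have h3 := hspec x hx
    have h4 := hne x hx
    have h5 : 0 < 1 - x := by linarith
    have : q x = (b - a ^ 2 * x) / (b ^ 2 * (1 - x)) := by
      simp only [q, g]
      obtain rfl : b = 2 * a - 1 := by linarith
      field_simp
      ring
    rw [this]
    rw [le_div_iff₀ (by positivity)] at h3
    apply div_nonneg _ (by positivity)
    linarith
  have cA : u * (P + Q - 1) = (P + Q - 1) * u := by
    have hAD : (P + Q - 1) * (P - Q) = - ((P - Q) * (P + Q - 1)) := by
      simp only [mul_add, add_mul, mul_sub, sub_mul, hPP, hQQ, mul_one, one_mul]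
      abel
    rw [hu, ← mul_assoc, hAD, neg_mul, mul_assoc, mul_assoc, hAD]; simp
  have cD : u * (P - Q) = (P - Q) * u := by rw [hu, mul_assoc]
  set G := cfc g u with hGdef
  set k := cfc (fun x => Real.sqrt (q x)) u with hkdef
  have hGs : IsSelfAdjoint G := cfc_predicate _ _
  have hks : IsSelfAdjoint k := cfc_predicate _ _
  have hGu : G * u = cfc (fun x => g x * x) u := by
    rw [cfc_mul g (fun x => x) u, cfc_id' ℝ u]
  have hG : G - G * u = ((a - 1) / b) • (1 : A) := by
    rw [hGu, hGdef, ← cfc_sub g (fun x => g x * x) u, ← Algebra.algebraMap_eq_smul_one,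
      ← cfc_const ((a - 1) / b) u]
    apply cfc_congr
    intro x hx
    have := hne x hx
    simp only [g]
    field_simp
  have hk : k * k = (a / b) • (1 : A) - G + (a / b) • (G * u) := by
    rw [hGu, hGdef, hkdef, ← cfc_mul _ _ u, ← Algebra.algebraMap_eq_smul_one,
      ← cfc_const (a / b) u, ← cfc_smul (a / b) (fun x => g x * x) u,
      ← cfc_sub (fun _ => a / b) g u, ← cfc_add u (fun x => a / b - g x) _]
    apply cfc_congr
    intro x hx
    exact Real.mul_self_sqrt (hq0 x hx)
  have cGB : G * (P + Q - 1) = (P + Q - 1) * G := Commute.cfc_real cA g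
  have cGD : G * (P - Q) = (P - Q) * G := Commute.cfc_real cD g
  have ckB : k * (P + Q - 1) = (P + Q - 1) * k := Commute.cfc_real cA _
  have ckD : k * (P - Q) = (P - Q) * k := Commute.cfc_real cD _
  have cGu : G * u = u * G := Commute.cfc_real (Commute.refl u) g
  have cGk : G * k = k * G := cfc_commute_cfc _ _ _
  obtain ⟨s1, r1⟩ := alg_bwd P Q G k a b hab hb.ne' hPP hQQ cGD cGB ckD ckB cGk hG hk _ rfl
  set s := (1 + G * ((P - Q) * (P - Q))) * (P + Q - 1) + k * (P - Q) with hs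
  have hss : IsSelfAdjoint s := by
    rw [IsSelfAdjoint, hs, ← hu]
    simp only [star_add, star_mul, h1.star_eq, hks.star_eq, hus.star_eq, hGs.star_eq, h2.star_eq,
      star_one, ← ckD, ← cGu]
    rw [mul_add, add_mul, mul_assoc G, cA, ← mul_assoc, ← mul_assoc, ← cGB]
    simp [hu, mul_assoc]
  have key : ∀ t : A, IsSelfAdjoint t → t * t = 1 → IsStarProjection ((1 / 2 : ℝ) • (1 + t)) := by
    intro t ht htt
    refine ⟨?_, ?_⟩
    · rw [IsIdempotentElem]
      simp only [smul_mul_assoc, mul_smul_comm, mul_add, add_mul, htt, mul_one, one_mul]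
      module
    · exact (IsSelfAdjoint.all _).smul ((IsSelfAdjoint.one _).add ht)
  refine ⟨(1 / 2 : ℝ) • (1 + s), (1 / 2 : ℝ) • (1 + (k + G * (P - Q) * (-(P + Q - 1)))),
    (1 / 2 : ℝ) • (1 - (k + G * (P - Q) * (-(P + Q - 1)))), key s hss s1, ?_, ?_⟩
  · have := key _ (((IsSelfAdjoint.all (2 * a)).smul h2).sub ((IsSelfAdjoint.all b).smul hss)) r1
    convert this using 1
    obtain rfl : b = 2 * a - 1 := by linarith
    module
  · have hAD : -(P + Q - 1) * (P - Q) = ((P - Q) * (P + Q - 1)) := by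
      simp only [mul_add, add_mul, mul_sub, sub_mul, hPP, hQQ, mul_one, one_mul, neg_mul]
      abel
    have : s = (P + Q - 1) + (k + G * (P - Q) * (-(P + Q - 1))) * (P - Q) := by
      rw [hs, add_mul k, mul_assoc _ (-(P + Q - 1)), hAD]
      noncomm_ring
    rw [this]
    generalize k + G * (P - Q) * (-(P + Q - 1)) = M
    simp only [smul_mul_assoc, mul_add, add_mul, mul_sub, sub_mul, mul_one, one_mul]
    module

theorem Pj_eq {H : Type*} [NormedAddCommGroup H] [InnerProductSpace ℂ H]
    (X : Submodule ℂ H) [h : FiniteDimensional ℂ X] : Pj X = X.starProjection := by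
  rw [Pj, dif_pos h]
  rfl

theorem Pj_star {H : Type*} [NormedAddCommGroup H] [InnerProductSpace ℂ H] [CompleteSpace H]
    (X : Submodule ℂ H) [h : FiniteDimensional ℂ X] : IsStarProjection (Pj X) := by
  rw [Pj_eq]
  exact isStarProjection_starProjection

theorem proj_inner {H : Type*} [NormedAddCommGroup H] [InnerProductSpace ℂ H] [CompleteSpace H]
    (R : H →L[ℂ] H) (hR : IsStarProjection R) (x : H) :
    (inner ℂ (R x) x : ℂ) = ((‖R x‖ ^ 2 : ℝ) : ℂ) := by
  have h1 : R (R x) = R x := congrArg (fun T : H →L[ℂ] H => T x) hR.isIdempotentElem.eq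
  have h2 := hR.isSelfAdjoint.isSymmetric (R x) x
  simp only [ContinuousLinearMap.coe_coe, h1] at h2
  rw [h2, inner_self_eq_norm_sq_to_K]
  norm_cast

theorem proj_norm {H : Type*} [NormedAddCommGroup H] [InnerProductSpace ℂ H] [CompleteSpace H]
    (R : H →L[ℂ] H) (hR : IsStarProjection R) (x : H) :
    ‖x - R x‖ ^ 2 = ‖x‖ ^ 2 - ‖R x‖ ^ 2 := by
  have h := proj_inner R hR x
  have h3 : RCLike.re (inner ℂ (R x) x : ℂ) = ‖R x‖ ^ 2 := by rw [h]; exact Complex.ofReal_re _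
  have := norm_sub_sq (𝕜 := ℂ) (R x) x
  rw [h3] at this
  rw [norm_sub_rev, this]
  ring

theorem hol_facts {H : Type*} [NormedAddCommGroup H] [InnerProductSpace ℂ H] [CompleteSpace H]
    (P Q R S : H →L[ℂ] H) (hP : IsStarProjection P) (hQ : IsStarProjection Q)
    (hR : IsStarProjection R) (hS : IsStarProjection S) (a b : ℝ)
    (h : a • (P + Q) = R + b • S) (x : H) :
    a * (‖P x‖ ^ 2 + ‖Q x‖ ^ 2) = ‖R x‖ ^ 2 + b * ‖S x‖ ^ 2 := by
  have := congrArg (fun T : H →L[ℂ] H => (inner ℂ (T x) x : ℂ)) h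
  simp only [ContinuousLinearMap.add_apply, ContinuousLinearMap.smul_apply, inner_add_left,
    ← Complex.coe_smul, inner_smul_left, Complex.conj_ofReal, proj_inner _ hP, proj_inner _ hQ,
    proj_inner _ hR, proj_inner _ hS] at this
  exact_mod_cast this

/-- Proposition `prophol`, nonemptiness and location parts. -/
theorem stmt4 {H : Type*} [NormedAddCommGroup H] [InnerProductSpace ℂ H] [CompleteSpace H]
    (X Y : Submodule ℂ H) [FiniteDimensional ℂ X] [FiniteDimensional ℂ Y]
    (a : ℝ) (ha : 1 / 2 < a) :
    ((Hol a X Y).Nonempty ↔ ‖Pj X - Pj Y‖ ≤ Real.sqrt (2 * a - 1) / a) ∧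
    (∀ Z ∈ Hol a X Y, X ⊓ Y ≤ Z ∧ Z ≤ X ⊔ Y) := by
  have hb : 0 < 2 * a - 1 := by linarith
  have ha0 : 0 < a := by linarith
  have hab : 2 * a = 1 + (2 * a - 1) := by ring
  have hP := Pj_star X
  have hQ := Pj_star Y
  have hZ : ∀ Z ∈ Hol a X Y, FiniteDimensional ℂ Z ∧ ∃ R : H →L[ℂ] H, IsStarProjection R ∧
      a • (Pj X + Pj Y) = R + (2 * a - 1) • Pj Z := by
    rintro Z ⟨h1, h2, h3⟩
    refine ⟨h1, _, ⟨h3, h2⟩, ?_⟩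
    module
  have hnn : ‖(Pj X - Pj Y) * (Pj X - Pj Y)‖ = ‖Pj X - Pj Y‖ ^ 2 := by
    have h1 : IsSelfAdjoint (Pj X - Pj Y) := hP.isSelfAdjoint.sub hQ.isSelfAdjoint
    rw [h1.norm_mul_self]
  have hiff : ‖Pj X - Pj Y‖ ≤ Real.sqrt (2 * a - 1) / a ↔
      ‖(Pj X - Pj Y) * (Pj X - Pj Y)‖ ≤ (2 * a - 1) / a ^ 2 := by
    have : (2 * a - 1) / a ^ 2 = (Real.sqrt (2 * a - 1) / a) ^ 2 := by
      rw [div_pow, Real.sq_sqrt hb.le]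
    rw [hnn, this, sq_le_sq₀ (norm_nonneg _) (by positivity)]
  refine ⟨⟨?_, ?_⟩, ?_⟩
  · rintro ⟨Z, hZm⟩
    obtain ⟨hf, R, hR, h⟩ := hZ Z hZm
    have hS := Pj_star Z
    have e := alg_fwd _ _ _ _ a _ hab hP.isIdempotentElem.eq hQ.isIdempotentElem.eq
      hR.isIdempotentElem.eq hS.isIdempotentElem.eq h
    have hn := norm_diff _ _ hR hS
    have e2 := congrArg norm e
    rw [norm_smul, norm_smul, Real.norm_of_nonneg hb.le, Real.norm_of_nonneg (sq_nonneg a)] at e2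
    rw [hiff, le_div_iff₀ (by positivity), mul_comm, e2]
    exact mul_le_of_le_one_right hb.le hn
  · intro h
    rw [hiff] at h
    by_cases ha1 : a = 1
    · subst ha1
      refine ⟨X, inferInstance, ?_⟩
      have : (1 : ℝ) • (Pj X + Pj Y) + (1 - 2 * (1 : ℝ)) • Pj X = Pj Y := by module
      rw [this]
      exact ⟨hQ.isSelfAdjoint, hQ.isIdempotentElem.eq⟩
    · obtain ⟨S, C, E, hS, hR, hCE⟩ := exist_proj _ _ hP hQ a _ hab hb ha1 h
      have hle : LinearMap.range (S : H →ₗ[ℂ] H) ≤ X ⊔ Y := by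
        have hS2 : S = Pj X * star C + Pj Y * star E := by
          rw [← hS.isSelfAdjoint.star_eq, hCE, star_add, star_mul, star_mul,
            hP.isSelfAdjoint.star_eq, hQ.isSelfAdjoint.star_eq]
        rintro _ ⟨x, rfl⟩
        have : S x = Pj X (star C x) + Pj Y (star E x) :=
          congrArg (fun T : H →L[ℂ] H => T x) hS2
        rw [ContinuousLinearMap.coe_coe, this, Pj_eq, Pj_eq]
        exact Submodule.add_mem_sup (Submodule.starProjection_apply_mem _ _)
          (Submodule.starProjection_apply_mem _ _)
      have hfd : FiniteDimensional ℂ (LinearMap.range (S : H →ₗ[ℂ] H)) :=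
        Submodule.finiteDimensional_of_le hle
      obtain ⟨_, hS3⟩ := isStarProjection_iff_eq_starProjection_range.1 hS
      have hPS : Pj (LinearMap.range (S : H →ₗ[ℂ] H)) = S := by
        rw [Pj_eq]; exact hS3.symm
      refine ⟨LinearMap.range (S : H →ₗ[ℂ] H), hfd, ?_⟩
      have : a • (Pj X + Pj Y) + (1 - 2 * a) • S = a • (Pj X + Pj Y) - (2 * a - 1) • S := by module
      rw [hPS, this]
      exact ⟨hR.isSelfAdjoint, hR.isIdempotentElem.eq⟩
  · intro Z hZm
    obtain ⟨hf, R, hR, h⟩ := hZ Z hZm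
    have hS := Pj_star Z
    have key := hol_facts _ _ _ _ hP hQ hR hS a _ h
    constructor
    · rintro x ⟨hx, hy⟩
      have k := key x
      have n1 := proj_norm R hR x
      have n2 := proj_norm _ hS x
      have p1 : Pj X x = x := by rw [Pj_eq]; exact Submodule.starProjection_eq_self_iff.2 hx
      have p2 : Pj Y x = x := by rw [Pj_eq]; exact Submodule.starProjection_eq_self_iff.2 hy
      rw [p1, p2] at k
      have : ‖x - Pj Z x‖ ^ 2 ≤ 0 := by
        have : (2 * a - 1) * ‖x - Pj Z x‖ ^ 2 = - ‖x - R x‖ ^ 2 := by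
          rw [n1, n2]; linarith
        by_contra! hc
        nlinarith [sq_nonneg ‖x - R x‖, mul_pos hb hc]
      have : x - Pj Z x = 0 := by
        rw [← norm_eq_zero]; exact pow_eq_zero_iff (two_ne_zero) |>.1 (le_antisymm this (sq_nonneg _))
      rw [Pj_eq] at this
      exact Submodule.starProjection_eq_self_iff.1 (sub_eq_zero.1 this).symm
    · rw [← Submodule.orthogonal_orthogonal (X ⊔ Y), ← Submodule.orthogonal_orthogonal Z]
      apply Submodule.orthogonal_le
      intro x hx
      rw [← Submodule.inf_orthogonal] at hx
      have k := key x
      have p1 : Pj X x = 0 := by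
        rw [Pj_eq]; exact (Submodule.starProjection_apply_eq_zero_iff _).2 hx.1
      have p2 : Pj Y x = 0 := by
        rw [Pj_eq]; exact (Submodule.starProjection_apply_eq_zero_iff _).2 hx.2
      rw [p1, p2] at k
      have : ‖Pj Z x‖ ^ 2 ≤ 0 := by
        by_contra! hc
        have := mul_pos hb hc
        simp at k
        nlinarith [sq_nonneg ‖R x‖]
      have : Pj Z x = 0 := by
        rw [← norm_eq_zero]; exact pow_eq_zero_iff (two_ne_zero) |>.1 (le_antisymm this (sq_nonneg _))
      rw [Pj_eq] at this
      exact (Submodule.starProjection_apply_eq_zero_iff _).1 this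
end

section
/- Let a ∈ (1/2, ∞) with a ≠ 1, and let X, Y be finite-dimensional subspaces of a complex Hilbert space H such that H_a(X, Y) ≠ ∅. Then there exists k ∈ ℕ ∪ {0} with k ≤ dim H such that dim X = dim Y = k and every Z ∈ H_a(X, Y) satisfies dim Z = k. -/
section helpers
variable {H : Type*} [NormedAddCommGroup H] [InnerProductSpace ℂ H]

lemma aux_inj (U V : Submodule ℂ H) [FiniteDimensional ℂ V] (f : H →ₗ[ℂ] H)
    (h1 : ∀ x ∈ U, f x ∈ V) (h2 : ∀ x ∈ U, f x = 0 → x = 0) :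
    Module.finrank ℂ U ≤ Module.finrank ℂ V := by
  refine LinearMap.finrank_le_finrank_of_injective (f := f.restrict h1) ?_
  rw [← LinearMap.ker_eq_bot, LinearMap.ker_eq_bot']
  rintro ⟨x, hx⟩ h
  have : f x = 0 := congrArg Subtype.val h
  exact Subtype.ext (h2 x hx this)

lemma aux_dim (W Z : Submodule ℂ H) [FiniteDimensional ℂ W] [FiniteDimensional ℂ Z]
    (h : Module.finrank ℂ (W ⊓ Zᗮ : Submodule ℂ H) ≤ Module.finrank ℂ (Z ⊓ Wᗮ : Submodule ℂ H)) :
    Module.finrank ℂ W ≤ Module.finrank ℂ Z := by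
  have e1 := Submodule.finrank_add_inf_finrank_orthogonal (K₁ := W ⊓ Zᗮ) (K₂ := W) inf_le_left
  have e2 := Submodule.finrank_add_inf_finrank_orthogonal (K₁ := Z ⊓ Wᗮ) (K₂ := Z) inf_le_left
  have : Module.finrank ℂ ((W ⊓ Zᗮ)ᗮ ⊓ W : Submodule ℂ H) ≤
      Module.finrank ℂ ((Z ⊓ Wᗮ)ᗮ ⊓ Z : Submodule ℂ H) := by
    refine aux_inj _ _ (Z.starProjection : H →ₗ[ℂ] H) ?_ ?_
    · rintro x ⟨hx1, hx2⟩
      refine ⟨?_, Submodule.starProjection_apply_mem _ _⟩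
      rintro l ⟨hl1, hl2⟩
      have h3 := (Submodule.starProjection_eq_self_iff (K := Z)).2 hl1
      have h4 := Submodule.inner_starProjection_left_eq_right Z l x
      rw [h3] at h4
      refine h4.symm.trans ?_
      exact Submodule.inner_left_of_mem_orthogonal hx2 hl2
    · rintro x ⟨hx1, hx2⟩ h0
      have : x ∈ Zᗮ := (Submodule.starProjection_apply_eq_zero_iff Z).1 h0
      have h5 := hx1 x ⟨hx2, this⟩
      exact inner_self_eq_zero.1 h5
  omega

lemma aux_norm (Z : Submodule ℂ H) [FiniteDimensional ℂ Z] (x : H) (s : ℝ) :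
    ‖x - s • Z.starProjection x‖ ^ 2 =
      ‖x‖ ^ 2 + (s ^ 2 - 2 * s) * ‖Z.starProjection x‖ ^ 2 := by
  have h4 := Submodule.inner_starProjection_left_eq_right Z (Z.starProjection x) x
  rw [(Submodule.starProjection_eq_self_iff (K := Z)).2
    (Submodule.starProjection_apply_mem _ _)] at h4
  have h5 := congrArg Complex.re h4
  have h6 : (inner ℂ x (Z.starProjection x)).re = ‖Z.starProjection x‖ ^ 2 := by
    rw [Submodule.inner_starProjection_left_eq_right] at h4
    rw [← inner_conj_symm, Complex.conj_re, h5]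
    exact inner_self_eq_norm_sq (𝕜 := ℂ) _
  have h7 := norm_sub_sq (𝕜 := ℂ) x (s • Z.starProjection x)
  rw [h7, norm_smul, mul_pow, Real.norm_eq_abs, sq_abs]
  have : RCLike.re (inner ℂ x (s • Z.starProjection x)) = s * ‖Z.starProjection x‖ ^ 2 := by
    rw [inner_smul_right_eq_smul, RCLike.smul_re]; rw [← h6]; rfl
  rw [this]; ring

lemma aux_D (a l : ℝ) (ha : 0 < a) (X Y : Submodule ℂ H) [FiniteDimensional ℂ X]
    [FiniteDimensional ℂ Y] (hl0 : l ≠ 0) (hl : l ≠ 2 * a) (x : H)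
    (h : a • (X.starProjection x + Y.starProjection x) = l • x) :
    a • (X.starProjection (X.starProjection x - Y.starProjection x) +
      Y.starProjection (X.starProjection x - Y.starProjection x)) =
      (2 * a - l) • (X.starProjection x - Y.starProjection x) ∧
    (X.starProjection x - Y.starProjection x = 0 → x = 0) := by
  have i1 : X.starProjection (X.starProjection x) = X.starProjection x :=
    (Submodule.starProjection_eq_self_iff).2 (Submodule.starProjection_apply_mem _ _)
  have i2 : Y.starProjection (Y.starProjection x) = Y.starProjection x :=
    (Submodule.starProjection_eq_self_iff).2 (Submodule.starProjection_apply_mem _ _)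
  have k1 := congrArg X.starProjection h
  have k2 := congrArg Y.starProjection h
  rw [ContinuousLinearMap.map_smul_of_tower, ContinuousLinearMap.map_smul_of_tower, map_add, i1] at k1
  rw [ContinuousLinearMap.map_smul_of_tower, ContinuousLinearMap.map_smul_of_tower, map_add, i2] at k2
  refine ⟨?_, ?_⟩
  · rw [map_sub, map_sub, i1, i2]
    linear_combination (norm := module) k2 - k1
  · intro h0
    have h1 := sub_eq_zero.1 h0
    rw [← h1, i1] at k1
    have h2 : (2 * a - l) • X.starProjection x = 0 := by
      linear_combination (norm := module) k1
    have h3 : X.starProjection x = 0 :=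
      (smul_eq_zero.1 h2).resolve_left (fun h => hl (by linarith))
    rw [← h1, h3] at h
    rw [add_zero, smul_zero] at h
    exact (smul_eq_zero.1 h.symm).resolve_left hl0

lemma aux_main (a : ℝ) (ha : 1 / 2 < a) (ha1 : a ≠ 1) (X Y Z W : Submodule ℂ H)
    [FiniteDimensional ℂ X] [FiniteDimensional ℂ Y] [FiniteDimensional ℂ Z]
    [FiniteDimensional ℂ W]
    (h : ∀ x, a • (X.starProjection x + Y.starProjection x) =
      W.starProjection x + (2 * a - 1) • Z.starProjection x) :
    Module.finrank ℂ X = Module.finrank ℂ Y ∧ Module.finrank ℂ Z = Module.finrank ℂ X := by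
  have z0 : ∀ (K : Submodule ℂ H) [FiniteDimensional ℂ K] (x : H), x ∈ Kᗮ ↔ K.starProjection x = 0 :=
    fun K _ x => (Submodule.starProjection_apply_eq_zero_iff K).symm
  have z1 : ∀ (K : Submodule ℂ H) [FiniteDimensional ℂ K] (x : H), x ∈ K ↔ K.starProjection x = x :=
    fun K _ x => (Submodule.starProjection_eq_self_iff).symm
  -- eigenvalue a
  have ea : ∀ x, a • (X.starProjection x + Y.starProjection x) = a • x → x = 0 := by
    intro x hx
    rw [h] at hx
    have n1 := aux_norm W x 2
    have n2 := aux_norm Z x 2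
    have : x - (2:ℝ) • W.starProjection x =
        (-(2 * a - 1)) • (x - (2:ℝ) • Z.starProjection x) := by
      linear_combination (norm := module) (-2 : ℝ) • hx
    rw [this, norm_smul, mul_pow, n2, Real.norm_eq_abs, sq_abs] at n1
    have : (a * (a - 1)) * ‖x‖ ^ 2 = 0 := by linear_combination n1 / 4
    have h3 : a * (a - 1) ≠ 0 := mul_ne_zero (by linarith) (sub_ne_zero.2 ha1)
    simpa [h3] using this
  have e1 : ∀ x, a • (X.starProjection x + Y.starProjection x) = (1:ℝ) • x → x ∈ W ⊓ Zᗮ := by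
    intro x hx
    rw [h] at hx
    have n1 := aux_norm W x 2
    have n2 := aux_norm Z x (2 * (2 * a - 1))
    have : x - (2:ℝ) • W.starProjection x =
        (-1 : ℝ) • (x - (2 * (2 * a - 1)) • Z.starProjection x) := by
      linear_combination (norm := module) (-2 : ℝ) • hx
    rw [this, norm_smul, mul_pow, n2, Real.norm_eq_abs, sq_abs] at n1
    have h4 : ((2 * a - 1) * (a - 1)) * ‖Z.starProjection x‖ ^ 2 = 0 := by
      linear_combination n1 / 8
    have h3 : (2 * a - 1) * (a - 1) ≠ 0 := mul_ne_zero (by linarith) (sub_ne_zero.2 ha1)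
    have h5 : Z.starProjection x = 0 := by
      have := (mul_eq_zero.1 h4).resolve_left h3
      simpa using this
    refine ⟨(z1 W x).2 ?_, (z0 Z x).2 h5⟩
    simpa [h5] using hx
  have eb : ∀ x, a • (X.starProjection x + Y.starProjection x) = (2 * a - 1) • x →
      x ∈ Z ⊓ Wᗮ := by
    intro x hx
    rw [h] at hx
    have n1 := aux_norm W x (2 / (2 * a - 1))
    have n2 := aux_norm Z x 2
    have hb : 2 * a - 1 ≠ 0 := by linarith
    have hx' : (2 / (2 * a - 1)) • W.starProjection x = (2:ℝ) • x - (2:ℝ) • Z.starProjection x := by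
      have := congrArg (fun v => (2 / (2 * a - 1)) • v) (eq_sub_of_add_eq hx)
      simp only [smul_sub, smul_smul, div_mul_cancel₀ _ hb] at this
      exact this
    have : x - (2 / (2 * a - 1)) • W.starProjection x =
        (-1 : ℝ) • (x - (2 : ℝ) • Z.starProjection x) := by
      rw [hx']; module
    rw [this, norm_smul, mul_pow, n2, Real.norm_eq_abs, sq_abs] at n1
    have h4 : (1 - a) * ‖W.starProjection x‖ ^ 2 = 0 := by
      field_simp at n1
      linear_combination -n1 / 8
    have h5 : W.starProjection x = 0 := by
      have := (mul_eq_zero.1 h4).resolve_left (sub_ne_zero.2 ha1.symm)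
      simpa using this
    refine ⟨(z1 Z x).2 ?_, (z0 W x).2 h5⟩
    rw [h5, zero_add] at hx
    exact smul_right_injective H hb hx
  have bXY : X ⊓ Yᗮ = ⊥ := by
    rw [eq_bot_iff]
    rintro x ⟨h1, h2⟩
    rw [Submodule.mem_bot]
    exact ea x (by rw [(z1 X x).1 h1, (z0 Y x).1 h2, add_zero])
  have bYX : Y ⊓ Xᗮ = ⊥ := by
    rw [eq_bot_iff]
    rintro x ⟨h1, h2⟩
    rw [Submodule.mem_bot]
    exact ea x (by rw [(z1 Y x).1 h1, (z0 X x).1 h2, zero_add])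
  have hXY : Module.finrank ℂ X = Module.finrank ℂ Y :=
    le_antisymm (aux_dim X Y (by rw [bXY, finrank_bot]; exact Nat.zero_le _)) (aux_dim Y X (by rw [bYX, finrank_bot]; exact Nat.zero_le _))
  have c1 : ∀ x ∈ W ⊓ Zᗮ, a • (X.starProjection x + Y.starProjection x) = (1:ℝ) • x := by
    rintro x ⟨h1, h2⟩
    rw [h, (z1 W x).1 h1, (z0 Z x).1 h2]; simp
  have cb : ∀ x ∈ Z ⊓ Wᗮ, a • (X.starProjection x + Y.starProjection x) = (2 * a - 1) • x := by
    rintro x ⟨h1, h2⟩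
    rw [h, (z1 Z x).1 h1, (z0 W x).1 h2]; simp
  have hWZ : Module.finrank ℂ W = Module.finrank ℂ Z := by
    refine le_antisymm (aux_dim W Z ?_) (aux_dim Z W ?_)
    · refine aux_inj _ _ ((X.starProjection - Y.starProjection : H →L[ℂ] H) : H →ₗ[ℂ] H) ?_ ?_
      · intro x hx
        exact eb _ (aux_D a 1 (by linarith) X Y (by norm_num) (by linarith) x (c1 x hx)).1
      · intro x hx
        exact (aux_D a 1 (by linarith) X Y (by norm_num) (by linarith) x (c1 x hx)).2
    · refine aux_inj _ _ ((X.starProjection - Y.starProjection : H →L[ℂ] H) : H →ₗ[ℂ] H) ?_ ?_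
      · intro x hx
        have := (aux_D a (2 * a - 1) (by linarith) X Y (by linarith) (by linarith) x (cb x hx)).1
        rw [sub_sub_cancel] at this
        exact e1 _ this
      · intro x hx
        exact (aux_D a (2 * a - 1) (by linarith) X Y (by linarith) (by linarith) x (cb x hx)).2
  -- energy: general facts on c (p+q) forms
  have key : ∀ x, a * (‖X.starProjection x‖ ^ 2 + ‖Y.starProjection x‖ ^ 2) =
      ‖W.starProjection x‖ ^ 2 + (2 * a - 1) * ‖Z.starProjection x‖ ^ 2 := by
    intro x
    have q : ∀ (K : Submodule ℂ H) [FiniteDimensional ℂ K],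
        RCLike.re (inner ℂ x (K.starProjection x)) = ‖K.starProjection x‖ ^ 2 := by
      intro K _
      have n := aux_norm K x 1
      have n' := norm_sub_sq (𝕜 := ℂ) x (K.starProjection x)
      rw [one_smul] at n
      linarith
    have := congrArg (fun v => RCLike.re (inner ℂ x v)) (h x)
    simpa only [inner_smul_right_eq_smul, inner_add_right, RCLike.smul_re, map_add, q] using this
  have orth : Xᗮ ⊓ Yᗮ = Wᗮ ⊓ Zᗮ := by
    ext x
    simp only [Submodule.mem_inf, z0]
    have k := key x
    have p1 := sq_nonneg ‖X.starProjection x‖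
    have p2 := sq_nonneg ‖Y.starProjection x‖
    have p3 := sq_nonneg ‖W.starProjection x‖
    have p4 := sq_nonneg ‖Z.starProjection x‖
    have s : ∀ v : H, v = 0 ↔ ‖v‖ ^ 2 = 0 := fun v => by simp
    rw [s, s, s, s]
    constructor
    · rintro ⟨h1, h2⟩
      rw [h1, h2] at k
      constructor <;> nlinarith
    · rintro ⟨h1, h2⟩
      rw [h1, h2] at k
      constructor <;> nlinarith
  have hsup : X ⊔ Y = W ⊔ Z := by
    rw [Submodule.inf_orthogonal, Submodule.inf_orthogonal] at orth
    rw [← Submodule.orthogonal_orthogonal (X ⊔ Y), orth, Submodule.orthogonal_orthogonal]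
  have hinf : X ⊓ Y = W ⊓ Z := by
    ext x
    have t : ∀ (K : Submodule ℂ H) [FiniteDimensional ℂ K],
        0 ≤ ‖x‖ ^ 2 - ‖K.starProjection x‖ ^ 2 ∧
        (x ∈ K ↔ ‖x‖ ^ 2 - ‖K.starProjection x‖ ^ 2 = 0) := by
      intro K _
      have n := aux_norm K x 1
      rw [one_smul] at n
      have n2 : ‖x‖ ^ 2 - ‖K.starProjection x‖ ^ 2 = ‖x - K.starProjection x‖ ^ 2 := by linarith
      rw [n2, z1]
      refine ⟨sq_nonneg _, ?_⟩
      rw [sq_eq_zero_iff, norm_eq_zero, sub_eq_zero, eq_comm]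
    have k := key x
    obtain ⟨x1, x2⟩ := t X
    obtain ⟨y1, y2⟩ := t Y
    obtain ⟨w1, w2⟩ := t W
    obtain ⟨z1, z2⟩ := t Z
    rw [Submodule.mem_inf, Submodule.mem_inf, x2, y2, w2, z2]
    constructor
    · rintro ⟨h1, h2⟩
      constructor <;> nlinarith
    · rintro ⟨h1, h2⟩
      constructor <;> nlinarith
  have d1 := Submodule.finrank_sup_add_finrank_inf_eq X Y
  have d2 := Submodule.finrank_sup_add_finrank_inf_eq W Z
  rw [hsup, hinf] at d1
  omega

lemma aux_Pj (X : Submodule ℂ H) [h : FiniteDimensional ℂ X] : Pj X = X.starProjection := by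
  unfold Pj
  rw [dif_pos h]
  rfl

end helpers

/-- Corollary `dimhol`. -/
theorem stmt5 {H : Type*} [NormedAddCommGroup H] [InnerProductSpace ℂ H] [CompleteSpace H]
    (a : ℝ) (ha : 1 / 2 < a) (ha1 : a ≠ 1)
    (X Y : Submodule ℂ H) [FiniteDimensional ℂ X] [FiniteDimensional ℂ Y]
    (hne : (Hol a X Y).Nonempty) :
    ∃ k : ℕ, (k : Cardinal) ≤ Module.rank ℂ H ∧
      Module.finrank ℂ X = k ∧ Module.finrank ℂ Y = k ∧
      ∀ Z ∈ Hol a X Y, Module.finrank ℂ Z = k := by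
  have main : ∀ Z ∈ Hol a X Y, Module.finrank ℂ X = Module.finrank ℂ Y ∧
      Module.finrank ℂ Z = Module.finrank ℂ X := by
    rintro Z ⟨hZ, hsa, hid⟩
    haveI := hZ
    rw [aux_Pj, aux_Pj, aux_Pj] at hsa hid
    set T : H →L[ℂ] H := a • (X.starProjection + Y.starProjection) +
      (1 - 2 * a) • Z.starProjection with hT
    have hst : IsStarProjection T := ⟨hid, hsa⟩
    have hfin : FiniteDimensional ℂ T.range := by
      have hle : T.range ≤ X ⊔ Y ⊔ Z := by
        rintro x ⟨y, rfl⟩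
        refine Submodule.add_mem _ ?_ ?_
        · refine Submodule.smul_of_tower_mem _ a ?_
          exact Submodule.mem_sup_left (Submodule.add_mem_sup
            (Submodule.starProjection_apply_mem _ _) (Submodule.starProjection_apply_mem _ _))
        · refine Submodule.smul_of_tower_mem _ (1 - 2 * a) ?_
          exact Submodule.mem_sup_right (Submodule.starProjection_apply_mem _ _)
      exact Submodule.finiteDimensional_of_le hle
    obtain ⟨_, hTW⟩ := isStarProjection_iff_eq_starProjection_range.1 hst
    refine aux_main a ha ha1 X Y Z T.range fun x => ?_
    have : T x = T.range.starProjection x := by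
      conv_lhs => rw [hTW]
    rw [← this, hT]
    simp only [ContinuousLinearMap.add_apply, ContinuousLinearMap.smul_apply]
    module
  obtain ⟨Z₀, hZ₀⟩ := hne
  refine ⟨Module.finrank ℂ X, ?_, rfl, (main Z₀ hZ₀).1.symm, fun Z hZ => (main Z hZ).2⟩
  rw [Module.finrank_eq_rank]
  exact Submodule.rank_le X
end
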